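/- arXiv:2505.22975 — 2 statements merged into one kernel-verified Lean document; each statement's English description precedes it below -/
import Mathlib

section
/- Let f : (a,b) → ℝ be a convex function, where −∞ ≤ a < b ≤ ∞. Then for every ε₀ > 0 and for every continuous function ε : (a,b) → (0,∞) there exists a convex function g of class C² on (a,b) such that the Lebesgue measure of the set {x ∈ (a,b) : f(x) ≠ g(x)} is less than ε₀, and |f(x) − g(x)| < ε(x) for all x ∈ (a,b). -/
open MeasureTheory Set

theorem hasDerivAt_half_posPart_sq (x : ℝ) :
    HasDerivAt (fun y : ℝ => max y 0 ^ 2 / 2) (max x 0) x := by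
  rcases lt_trichotomy x 0 with h | h | h
  · rw [max_eq_right h.le]
    refine (hasDerivAt_const x (0 : ℝ)).congr_of_eventuallyEq ?_
    filter_upwards [Iio_mem_nhds h] with y hy
    simp [max_eq_right (le_of_lt (mem_Iio.1 hy))]
  · subst h
    rw [max_self, hasDerivAt_iff_isLittleO, Asymptotics.isLittleO_iff]
    intro c hc
    filter_upwards [Metric.ball_mem_nhds (0 : ℝ) hc] with y hy
    rw [Metric.mem_ball, dist_zero_right] at hy
    simp only [max_self, sub_zero, smul_zero, ne_eq, OfNat.ofNat_ne_zero, not_false_eq_true,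
      zero_pow, zero_div]
    simp only [Real.norm_eq_abs] at *
    have h1 : 0 ≤ max y 0 := le_max_right _ _
    have h2 : max y 0 ≤ |y| := max_le (le_abs_self y) (abs_nonneg y)
    rw [abs_of_nonneg (by positivity)]
    nlinarith [abs_nonneg y]
  · rw [max_eq_left h.le]
    have : HasDerivAt (fun y : ℝ => y ^ 2 / 2) x x := by
      have := ((hasDerivAt_id x).pow 2).div_const 2
      simpa using this
    refine this.congr_of_eventuallyEq ?_
    filter_upwards [Ioi_mem_nhds h] with y hy
    simp [max_eq_left (le_of_lt (mem_Ioi.1 hy))]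

theorem hasDerivAt_sixth_posPart_cube (x : ℝ) :
    HasDerivAt (fun y : ℝ => max y 0 ^ 3 / 6) (max x 0 ^ 2 / 2) x := by
  rcases lt_trichotomy x 0 with h | h | h
  · rw [max_eq_right h.le]
    have : HasDerivAt (fun _ : ℝ => (0 : ℝ)) (0 ^ 2 / 2) x := by
      simpa using hasDerivAt_const x (0 : ℝ)
    refine this.congr_of_eventuallyEq ?_
    filter_upwards [Iio_mem_nhds h] with y hy
    simp [max_eq_right (le_of_lt (mem_Iio.1 hy))]
  · subst h
    rw [max_self, hasDerivAt_iff_isLittleO, Asymptotics.isLittleO_iff]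
    intro c hc
    filter_upwards [Metric.ball_mem_nhds (0 : ℝ) hc, Metric.ball_mem_nhds (0 : ℝ) one_pos]
      with y hy hy'
    rw [Metric.mem_ball, dist_zero_right] at hy hy'
    simp only [max_self, sub_zero, ne_eq, OfNat.ofNat_ne_zero, not_false_eq_true,
      zero_pow, zero_div, smul_eq_mul, mul_zero]
    simp only [Real.norm_eq_abs] at *
    have h1 : 0 ≤ max y 0 := le_max_right _ _
    have h2 : max y 0 ≤ |y| := max_le (le_abs_self y) (abs_nonneg y)
    rw [abs_of_nonneg (by positivity)]
    have h3 : max y 0 ^ 2 ≤ c := by nlinarith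
    nlinarith [abs_nonneg y, mul_le_mul h3 h2 h1 hc.le]
  · rw [max_eq_left h.le]
    have : HasDerivAt (fun y : ℝ => y ^ 3 / 6) (x ^ 2 / 2) x := by
      refine ((hasDerivAt_pow 3 x).div_const 6).congr_deriv ?_
      norm_num; ring
    refine this.congr_of_eventuallyEq ?_
    filter_upwards [Ioi_mem_nhds h] with y hy
    simp [max_eq_left (le_of_lt (mem_Ioi.1 hy))]

/-- `IsSecondPrimitive u v w` says that `w` is continuous, `v` is a primitive of `w` and `u` is
a primitive of `v`. -/
structure IsSecondPrimitive (u v w : ℝ → ℝ) : Prop where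
  hasDerivAt_fst : ∀ x, HasDerivAt u (v x) x
  hasDerivAt_snd : ∀ x, HasDerivAt v (w x) x
  continuous : Continuous w

namespace IsSecondPrimitive

theorem add {u v w u' v' w' : ℝ → ℝ} (h : IsSecondPrimitive u v w)
    (h' : IsSecondPrimitive u' v' w') :
    IsSecondPrimitive (fun x => u x + u' x) (fun x => v x + v' x) (fun x => w x + w' x) :=
  ⟨fun x => (h.1 x).add (h'.1 x), fun x => (h.2 x).add (h'.2 x), h.3.add h'.3⟩

theorem const_mul {u v w : ℝ → ℝ} (h : IsSecondPrimitive u v w) (c : ℝ) :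
    IsSecondPrimitive (fun x => c * u x) (fun x => c * v x) (fun x => c * w x) :=
  ⟨fun x => (h.1 x).const_mul c, fun x => (h.2 x).const_mul c, h.3.const_mul c⟩

theorem comp_sub_const {u v w : ℝ → ℝ} (h : IsSecondPrimitive u v w) (c : ℝ) :
    IsSecondPrimitive (fun x => u (x - c)) (fun x => v (x - c)) (fun x => w (x - c)) :=
  ⟨fun x => (h.1 _).comp_sub_const x c, fun x => (h.2 _).comp_sub_const x c,
    h.3.comp (continuous_id.sub continuous_const)⟩

theorem comp_const_sub {u v w : ℝ → ℝ} (h : IsSecondPrimitive u v w) (c : ℝ) :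
    IsSecondPrimitive (fun x => u (c - x)) (fun x => -v (c - x)) (fun x => w (c - x)) :=
  ⟨fun x => (h.1 _).comp_const_sub c x,
    fun x => ((h.2 _).comp_const_sub c x).neg.congr_deriv (neg_neg _),
    h.3.comp (continuous_const.sub continuous_id)⟩

theorem quadratic (a b c : ℝ) :
    IsSecondPrimitive (fun x => a * x ^ 2 / 2 + b * x + c) (fun x => a * x + b) (fun _ => a) := by
  refine ⟨fun x => ?_, fun x => ?_, continuous_const⟩
  · refine (((((hasDerivAt_pow 2 x).const_mul a).div_const 2).add
      ((hasDerivAt_id' x).const_mul b)).add_const c).congr_deriv ?_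
    norm_num; ring
  · simpa using ((hasDerivAt_id x).const_mul a).add_const b

theorem posPart :
    IsSecondPrimitive (fun x => max x 0 ^ 3 / 6) (fun x => max x 0 ^ 2 / 2) (fun x => max x 0) :=
  ⟨hasDerivAt_sixth_posPart_cube, hasDerivAt_half_posPart_sq, continuous_id.max continuous_const⟩

/-- A tent of mass `m` and height `4 * b` centred at `c`. -/
theorem exists_tent {b m : ℝ} (hb : 0 < b) (hm : 0 < m) (c : ℝ) :
    ∃ u v w : ℝ → ℝ, IsSecondPrimitive u v w ∧ (∀ x, 0 ≤ w x) ∧ (∀ x, w x ≤ 4 * b) ∧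
      (∀ x ≤ c - m / (4 * b), u x = 0 ∧ v x = 0 ∧ w x = 0) ∧
      (∀ x, c + m / (4 * b) ≤ x → u x = m * (x - c) ∧ v x = m ∧ w x = 0) := by
  obtain ⟨h, hh, hmh⟩ : ∃ h, 0 < h ∧ m = 4 * b * h := ⟨m / (4 * b), by positivity, by field_simp⟩
  have hmh' : m / (4 * b) = h := by rw [hmh]; field_simp
  rw [hmh']
  have P := ((posPart.comp_sub_const (c - h)).add
    (((posPart.comp_sub_const c).const_mul (-2)).add (posPart.comp_sub_const (c + h)))).const_mul
      (4 * b / h)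
  have hκ : 0 ≤ 4 * b / h := by positivity
  have key : ∀ x, 0 ≤ max (x - (c - h)) 0 + (-2 * max (x - c) 0 + max (x - (c + h)) 0) ∧
      max (x - (c - h)) 0 + (-2 * max (x - c) 0 + max (x - (c + h)) 0) ≤ h := by
    intro x
    rcases max_cases (x - (c - h)) 0 with h1 | h1 <;> rcases max_cases (x - c) 0 with h2 | h2 <;>
      rcases max_cases (x - (c + h)) 0 with h3 | h3 <;> rw [h1.1, h2.1, h3.1] <;>
      constructor <;> linarith [h1.2, h2.2, h3.2]
  refine ⟨_, _, _, P, fun x => mul_nonneg hκ (key x).1, fun x => ?_, fun x hx => ?_,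
    fun x hx => ?_⟩
  · calc _ ≤ 4 * b / h * h := mul_le_mul_of_nonneg_left (key x).2 hκ
      _ = 4 * b := by field_simp
  · have h1 : max (x - (c - h)) 0 = 0 := max_eq_right (by linarith)
    have h2 : max (x - c) 0 = 0 := max_eq_right (by linarith)
    have h3 : max (x - (c + h)) 0 = 0 := max_eq_right (by linarith)
    simp [h1, h2, h3]
  · have h1 : max (x - (c - h)) 0 = x - (c - h) := max_eq_left (by linarith)
    have h2 : max (x - c) 0 = x - c := max_eq_left (by linarith)
    have h3 : max (x - (c + h)) 0 = x - (c + h) := max_eq_left (by linarith)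
    simp only [h1, h2, h3]
    refine ⟨?_, ?_, ?_⟩
    · rw [hmh]; field_simp; ring
    · rw [hmh]; field_simp; ring
    · ring

/-- A ramp supported in `[0, ∞)` taking the value `q` at `r`. -/
theorem exists_ramp {q r : ℝ} (hq : 0 ≤ q) (hr : 0 < r) :
    ∃ u v w : ℝ → ℝ, IsSecondPrimitive u v w ∧ (∀ x, 0 ≤ w x) ∧ (∀ x ≤ r, w x ≤ q) ∧
      (∀ x ≤ 0, u x = 0 ∧ v x = 0 ∧ w x = 0) ∧
      u r = q * r ^ 2 / 6 ∧ v r = q * r / 2 ∧ w r = q := by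
  have hκ : 0 ≤ q / r := by positivity
  have hr' : max r 0 = r := max_eq_left hr.le
  refine ⟨_, _, _, posPart.const_mul (q / r), fun x => mul_nonneg hκ (le_max_right _ _),
    fun x hx => ?_, fun x hx => ?_, ?_, ?_, ?_⟩
  · calc _ ≤ q / r * r := mul_le_mul_of_nonneg_left (max_le hx hr.le) hκ
      _ = q := by field_simp
  · simp [max_eq_right hx]
  · rw [hr']; field_simp
  · rw [hr']; field_simp
  · rw [hr']; field_simp

/-- A nonnegative continuous density on `[0, ℓ]`, bounded by `6 * b`, with prescribed boundary
values, mass and first moment. -/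
theorem exists_of_moments {ℓ b m M p q : ℝ} (hℓ : 0 < ℓ) (hb : 0 < b) (hm : 0 < m)
    (hmb : m ≤ b * ℓ) (hM : m ^ 2 / (2 * b) ≤ M) (hM' : M ≤ m * ℓ - m ^ 2 / (2 * b))
    (hp : 0 ≤ p) (hpb : p ≤ b) (hq : 0 ≤ q) (hqb : q ≤ b) :
    ∃ u v w : ℝ → ℝ, IsSecondPrimitive u v w ∧ (∀ x, 0 ≤ w x) ∧
      (∀ x ∈ Icc 0 ℓ, w x ≤ 6 * b) ∧ u 0 = 0 ∧ v 0 = 0 ∧ w 0 = p ∧ u ℓ = M ∧ v ℓ = m ∧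
      w ℓ = q := by
  obtain ⟨r, hr, hrm⟩ : ∃ r, 0 < r ∧ m ^ 2 = 4 * b ^ 2 * ℓ * r :=
    ⟨m ^ 2 / (4 * b ^ 2 * ℓ), by positivity, by field_simp⟩
  have hbr : 4 * (b * r) ≤ m := by
    have : m * (4 * (b * r)) ≤ m * m := by
      nlinarith [mul_le_mul_of_nonneg_right hmb (by positivity : 0 ≤ b * r)]
    exact le_of_mul_le_mul_left this hm
  have hrℓ : 4 * r ≤ ℓ := by
    have : b * (4 * r) ≤ b * ℓ := by linarith
    exact le_of_mul_le_mul_left this hb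
  have hM2 : m ^ 2 / (2 * b) = 2 * (b * ℓ * r) := by rw [hrm]; field_simp; ring
  rw [hM2] at hM hM'
  have hpr : p * r ≤ b * r := mul_le_mul_of_nonneg_right hpb hr.le
  have hqr : q * r ≤ b * r := mul_le_mul_of_nonneg_right hqb hr.le
  have hpr0 : 0 ≤ p * r := by positivity
  have hqr0 : 0 ≤ q * r := by positivity
  obtain ⟨m', hm'⟩ : ∃ m', m' = m - p * r / 2 - q * r / 2 := ⟨_, rfl⟩
  have hm'0 : 0 < m' := by nlinarith
  have hm'm : m' ≤ m := by linarith
  obtain ⟨N, hN⟩ : ∃ N, N = M - p * r * ℓ / 2 + p * r ^ 2 / 6 - q * r ^ 2 / 6 := ⟨_, rfl⟩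
  obtain ⟨c, hc⟩ : ∃ c, m' * (ℓ - c) = N := ⟨ℓ - N / m', by field_simp; ring⟩
  obtain ⟨h, hh, hmh⟩ : ∃ h, 0 < h ∧ m' = 4 * b * h := ⟨m' / (4 * b), by positivity, by field_simp⟩
  have hmh' : m' / (4 * b) = h := by rw [hmh]; field_simp
  have hm'h : m' * h ≤ b * ℓ * r := by
    have : 4 * b * (m' * h) ≤ 4 * b * (b * ℓ * r) := by nlinarith
    exact le_of_mul_le_mul_left this (by positivity)
  have e1 : p * r * ℓ ≤ b * ℓ * r := by nlinarith
  have e2 : q * r * ℓ ≤ b * ℓ * r := by nlinarith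
  have e3 : 4 * (p * r ^ 2) ≤ b * ℓ * r := by nlinarith
  have e4 : 4 * (q * r ^ 2) ≤ b * ℓ * r := by nlinarith
  have e5 : 0 ≤ p * r ^ 2 := by positivity
  have e6 : 0 ≤ q * r ^ 2 := by positivity
  have hc1 : c + h ≤ ℓ := by
    have : m' * h ≤ m' * (ℓ - c) := by rw [hc, hN]; linarith
    have := le_of_mul_le_mul_left this hm'0
    linarith
  have hc2 : 0 ≤ c - h := by
    have : m' * h ≤ m' * c := by
      have : m' * c = m' * ℓ - N := by linarith
      rw [this, hN, hm']
      have : (m - p * r / 2 - q * r / 2) * h ≤ b * ℓ * r := by rw [← hm']; exact hm'h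
      nlinarith
    have := le_of_mul_le_mul_left this hm'0
    linarith
  obtain ⟨u₁, v₁, w₁, H₁, w₁0, w₁b, L₁, R₁⟩ := exists_tent hb hm'0 c
  obtain ⟨u₂, v₂, w₂, H₂, w₂0, w₂b, L₂, ur₂, vr₂, wr₂⟩ := exists_ramp hp hr
  obtain ⟨u₃, v₃, w₃, H₃, w₃0, w₃b, L₃, ur₃, vr₃, wr₃⟩ := exists_ramp hq hr
  rw [hmh'] at L₁ R₁
  have hL₁ := L₁ 0 (by linarith)
  have hR₁ := R₁ ℓ (by linarith)
  have hL₂ := L₂ (r - ℓ) (by linarith)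
  have hL₃ := L₃ (0 - (ℓ - r)) (by linarith)
  have a0 : ℓ - (ℓ - r) = r := by ring
  refine ⟨_, _, _, (H₁.add ((H₂.comp_const_sub r).add (H₃.comp_sub_const (ℓ - r)))).add
    (quadratic 0 (p * r / 2) (-(p * r ^ 2 / 6))), fun x => ?_, fun x hx => ?_, ?_, ?_, ?_, ?_, ?_,
    ?_⟩
  · have := w₁0 x; have := w₂0 (r - x); have := w₃0 (x - (ℓ - r))
    positivity
  · have := w₁b x; have := w₂b (r - x) (by linarith [hx.1])
    have := w₃b (x - (ℓ - r)) (by linarith [hx.2])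
    linarith
  · simp only [hL₁, hL₃, sub_zero, ur₂]; ring
  · simp only [hL₁, hL₃, sub_zero, vr₂]; ring
  · simp only [hL₁, hL₃, sub_zero, wr₂]; ring
  · simp only [hR₁, hL₂, a0, ur₃, hc, hN]; ring
  · simp only [hR₁, hL₂, a0, vr₃, hm']; ring
  · simp only [hR₁, hL₂, a0, wr₃]; ring

end IsSecondPrimitive

theorem sub_le_sub_of_rightDeriv_le {f F P P' : ℝ → ℝ} {x y : ℝ} (hxy : x ≤ y)
    (hf : ContinuousOn f (Icc x y))
    (hf' : ∀ t ∈ Ico x y, HasDerivWithinAt f (F t) (Ici t) t) (hP : ∀ t, HasDerivAt P (P' t) t)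
    (h : ∀ t ∈ Ico x y, F t ≤ P' t) : f y - f x ≤ P y - P x := by
  have := image_le_of_deriv_right_le_deriv_boundary hf hf' (B := fun t => P t + (f x - P x))
    (by simp) (fun t _ => ((hP t).continuousAt.add continuousAt_const).continuousWithinAt)
    (fun t _ => ((hP t).add_const _).hasDerivWithinAt) h (right_mem_Icc.2 hxy)
  linarith

theorem sub_le_sub_of_le_rightDeriv {f F P P' : ℝ → ℝ} {x y : ℝ} (hxy : x ≤ y)
    (hf : ContinuousOn f (Icc x y))
    (hf' : ∀ t ∈ Ico x y, HasDerivWithinAt f (F t) (Ici t) t) (hP : ∀ t, HasDerivAt P (P' t) t)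
    (h : ∀ t ∈ Ico x y, P' t ≤ F t) : P y - P x ≤ f y - f x := by
  have := sub_le_sub_of_rightDeriv_le hxy hf.neg (fun t ht => (hf' t ht).neg)
    (fun t => (hP t).neg) (fun t ht => neg_le_neg (h t ht))
  simp only [Pi.neg_apply] at this
  linarith

/-- On `[x, y]`, the function `F` is affine of slope `σ` up to an error `η`, as seen from each of
the endpoints, and its slopes `A` and `B` at the endpoints agree with `σ` up to `η`. -/
structure NearlyAffine (F : ℝ → ℝ) (x y A B σ η : ℝ) : Prop where
  left_slope : |A - σ| ≤ η
  right_slope : |B - σ| ≤ η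
  left_error : ∀ t ∈ Icc x y, |F t - F x - σ * (t - x)| ≤ η * (t - x)
  right_error : ∀ t ∈ Icc x y, |F y - F t - σ * (y - t)| ≤ η * (y - t)

theorem first_moment_bounds {f F : ℝ → ℝ} {x y a b : ℝ} (hb : 0 < b)
    (hf : ContinuousOn f (Icc x y))
    (hf' : ∀ t ∈ Ico x y, HasDerivWithinAt f (F t) (Ici t) t)
    {m : ℝ} (hm : m = F y - F x - a * (y - x)) (hm0 : 0 ≤ m) (hmb : m ≤ b * (y - x))
    (h1 : ∀ t ∈ Icc x y, 0 ≤ F t - F x - a * (t - x))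
    (h2 : ∀ t ∈ Icc x y, F t - F x - a * (t - x) ≤ b * (t - x))
    (h3 : ∀ t ∈ Icc x y, 0 ≤ F y - F t - a * (y - t))
    (h4 : ∀ t ∈ Icc x y, F y - F t - a * (y - t) ≤ b * (y - t)) :
    m ^ 2 / (2 * b) ≤ f y - f x - F x * (y - x) - a * (y - x) ^ 2 / 2 ∧
      f y - f x - F x * (y - x) - a * (y - x) ^ 2 / 2 ≤ m * (y - x) - m ^ 2 / (2 * b) := by
  obtain ⟨d, hd⟩ : ∃ d, m = b * d := ⟨m / b, by field_simp⟩
  have hd0 : 0 ≤ d := by rw [hd] at hm0; exact nonneg_of_mul_nonneg_right hm0 hb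
  have hdl : d ≤ y - x := by rw [hd] at hmb; exact le_of_mul_le_mul_left hmb hb
  have hmd : m ^ 2 / (2 * b) = b * d ^ 2 / 2 := by rw [hd]; field_simp
  rw [hmd]
  have split : ∀ z ∈ Icc x y, (ContinuousOn f (Icc x z) ∧
      ∀ t ∈ Ico x z, HasDerivWithinAt f (F t) (Ici t) t) ∧ (ContinuousOn f (Icc z y) ∧
      ∀ t ∈ Ico z y, HasDerivWithinAt f (F t) (Ici t) t) := fun z hz =>
    ⟨⟨hf.mono (Icc_subset_Icc_right hz.2), fun t ht => hf' t ⟨ht.1, ht.2.trans_le hz.2⟩⟩,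
      ⟨hf.mono (Icc_subset_Icc_left hz.1), fun t ht => hf' t ⟨hz.1.trans ht.1, ht.2⟩⟩⟩
  have Q := fun (a' b' : ℝ) => ((IsSecondPrimitive.quadratic a' b' 0).comp_sub_const x).1
  constructor
  · have hz : y - d ∈ Icc x y := ⟨by linarith, by linarith⟩
    obtain ⟨⟨c1, d1⟩, c2, d2⟩ := split _ hz
    have i1 := sub_le_sub_of_le_rightDeriv hz.1 c1 d1 (Q a (F x)) (fun t ht => by
      have := h1 t ⟨ht.1, ht.2.le.trans hz.2⟩
      linarith)
    have i2 := sub_le_sub_of_le_rightDeriv hz.2 c2 d2 (Q (a + b) (F x + m - b * (y - x)))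
      (fun t ht => by
        have := h4 t ⟨hz.1.trans ht.1, ht.2.le⟩
        rw [hm]
        nlinarith)
    rw [hd] at i2
    nlinarith
  · have hz : x + d ∈ Icc x y := ⟨by linarith, by linarith⟩
    obtain ⟨⟨c1, d1⟩, c2, d2⟩ := split _ hz
    have i1 := sub_le_sub_of_rightDeriv_le hz.1 c1 d1 (Q (a + b) (F x)) (fun t ht => by
      have := h2 t ⟨ht.1, ht.2.le.trans hz.2⟩
      linarith)
    have i2 := sub_le_sub_of_rightDeriv_le hz.2 c2 d2 (Q a (F x + m))
      (fun t ht => by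
        have := h3 t ⟨hz.1.trans ht.1, ht.2.le⟩
        rw [hm]
        nlinarith)
    rw [hd] at i2 ⊢
    nlinarith

theorem slope_eq_of_affine {F : ℝ → ℝ} {x y z a A c : ℝ} (hxy : x < y) (hz : z ∈ Icc x y)
    (hA : HasDerivAt F A z) (h : ∀ t ∈ Icc x y, F t = c + a * t) : A = a := by
  have h1 : HasDerivWithinAt F a (Icc x y) z := by
    have : HasDerivAt (fun t => c + a * t) a z := by
      simpa using ((hasDerivAt_id z).const_mul a).const_add c
    exact this.hasDerivWithinAt.congr h (h z hz)
  exact (uniqueDiffOn_Icc hxy z hz).eq_deriv _ hA.hasDerivWithinAt h1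

/-- Given a nearly affine monotone function `F` with primitive `f` on `[x, y]`, there is a `C²`
function which has the same 2-jets at the endpoints as `f` and whose second derivative is
nonnegative and close to the slope of `F`. -/
theorem NearlyAffine.exists_interpolation {f F : ℝ → ℝ} {x y A B σ η : ℝ}
    (H : NearlyAffine F x y A B σ η) (hxy : x < y)
    (hf : ContinuousOn f (Icc x y))
    (hf' : ∀ t ∈ Ico x y, HasDerivWithinAt f (F t) (Ici t) t) (hF : MonotoneOn F (Icc x y))
    (hA : HasDerivAt F A x) (hB : HasDerivAt F B y) (hA0 : 0 ≤ A) (hB0 : 0 ≤ B) (hσ : 0 ≤ σ) :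
    ∃ u v w : ℝ → ℝ, IsSecondPrimitive u v w ∧
      (∀ t ∈ Icc x y, 0 ≤ w t ∧ |w t - σ| ≤ 11 * η) ∧ w x = A ∧ w y = B ∧ v x = F x ∧ v y = F y ∧
      u x = f x ∧ u y = f y := by
  have hη : 0 ≤ η := (abs_nonneg _).trans H.left_slope
  obtain ⟨a, ha⟩ : ∃ a, a = max (σ - η) 0 := ⟨_, rfl⟩
  have ha0 : 0 ≤ a := ha ▸ le_max_right _ _
  have haσ : σ - η ≤ a := ha ▸ le_max_left _ _
  have haσ' : a ≤ σ := ha ▸ max_le (by linarith) hσ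
  have key : ∀ z, σ - η ≤ z → 0 ≤ z → a ≤ z := fun z h h' => ha ▸ max_le h h'
  obtain ⟨b, hb⟩ : ∃ b, b = σ + η - a := ⟨_, rfl⟩
  have hb0 : 0 ≤ b := by linarith
  have hpA := abs_le.1 H.left_slope
  have hqB := abs_le.1 H.right_slope
  have hAa := key A (by linarith) hA0
  have hBa := key B (by linarith) hB0
  have low : ∀ D s, 0 ≤ s → (σ - η) * s ≤ D → 0 ≤ D → 0 ≤ D - a * s := by
    intro D s hs h h'
    rw [ha]
    rcases max_cases (σ - η) 0 with h1 | h1 <;> rw [h1.1] <;> linarith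
  have xI : x ∈ Icc x y := left_mem_Icc.2 hxy.le
  have yI : y ∈ Icc x y := right_mem_Icc.2 hxy.le
  have h1 : ∀ t ∈ Icc x y, 0 ≤ F t - F x - a * (t - x) := fun t ht =>
    low _ _ (by linarith [ht.1]) (by linarith [(abs_le.1 (H.left_error t ht)).1])
      (by linarith [hF xI ht ht.1])
  have h2 : ∀ t ∈ Icc x y, F t - F x - a * (t - x) ≤ b * (t - x) := fun t ht => by
    rw [hb]; linarith [(abs_le.1 (H.left_error t ht)).2]
  have h3 : ∀ t ∈ Icc x y, 0 ≤ F y - F t - a * (y - t) := fun t ht =>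
    low _ _ (by linarith [ht.2]) (by linarith [(abs_le.1 (H.right_error t ht)).1])
      (by linarith [hF ht yI ht.2])
  have h4 : ∀ t ∈ Icc x y, F y - F t - a * (y - t) ≤ b * (y - t) := fun t ht => by
    rw [hb]; linarith [(abs_le.1 (H.right_error t ht)).2]
  obtain ⟨m, hm⟩ : ∃ m, m = F y - F x - a * (y - x) := ⟨_, rfl⟩
  have hm0 : 0 ≤ m := hm ▸ h1 y yI
  have hmb : m ≤ b * (y - x) := hm ▸ h2 y yI
  have hl : 0 < y - x := sub_pos.2 hxy
  have main : ∃ u v w : ℝ → ℝ, IsSecondPrimitive u v w ∧ (∀ x, 0 ≤ w x) ∧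
      (∀ t ∈ Icc 0 (y - x), w t ≤ 6 * b) ∧ u 0 = 0 ∧ v 0 = 0 ∧ w 0 = A - a ∧
      u (y - x) = f y - f x - F x * (y - x) - a * (y - x) ^ 2 / 2 ∧ v (y - x) = m ∧
      w (y - x) = B - a := by
    rcases hm0.eq_or_lt with h0 | h0
    · have aff : ∀ t ∈ Icc x y, F t = (F x - a * x) + a * t := fun t ht => by
        linarith [h1 t ht, h3 t ht]
      have hA' := slope_eq_of_affine hxy xI hA aff
      have hB' := slope_eq_of_affine hxy yI hB aff
      have Q := ((IsSecondPrimitive.quadratic a (F x) 0).comp_sub_const x).1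
      have i1 := sub_le_sub_of_rightDeriv_le hxy.le hf hf' Q (fun t ht => by
        rw [aff t ⟨ht.1, ht.2.le⟩]; linarith)
      have i2 := sub_le_sub_of_le_rightDeriv hxy.le hf hf' Q (fun t ht => by
        rw [aff t ⟨ht.1, ht.2.le⟩]; linarith)
      refine ⟨_, _, _, IsSecondPrimitive.quadratic 0 0 0, by simp, fun _ _ => by linarith, by simp,
        by simp, by simp [hA'], ?_, by simpa using h0, by simp [hB']⟩
      linarith
    · have hb0' : 0 < b := by
        by_contra! h
        have := mul_nonpos_of_nonpos_of_nonneg h hl.le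
        linarith
      obtain ⟨M1, M2⟩ := first_moment_bounds hb0' hf hf' hm hm0 hmb h1 h2 h3 h4
      exact IsSecondPrimitive.exists_of_moments hl hb0' h0 hmb M1 M2 (by linarith) (by linarith)
        (by linarith) (by linarith)
  obtain ⟨u, v, w, P, w0, wb, u0, v0, w00, ul, vl, wl⟩ := main
  refine ⟨_, _, _, ((IsSecondPrimitive.quadratic a (F x) (f x)).add P).comp_sub_const x,
    fun t ht => ⟨add_nonneg ha0 (w0 _), ?_⟩, ?_, ?_, ?_, ?_, ?_, ?_⟩
  · have i1 := w0 (t - x)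
    have i2 := wb (t - x) ⟨by linarith [ht.1], by linarith [ht.2]⟩
    rw [abs_le]
    constructor <;> linarith
  · simp [w00]
  · simp [wl]
  · simp [v0]
  · simp only [vl, hm]; ring
  · simp [u0]
  · simp only [ul]; ring

theorem exists_forall_abs_sub_le_of_hasDerivAt {F : ℝ → ℝ} {z A R : ℝ} {S : Set ℝ}
    (hA : HasDerivAt F A z) (hR : ∀ t ∈ S, |F t - F z| ≤ R) (σ : ℝ) :
    ∃ η, ∀ t ∈ S, |F t - F z - σ * (t - z)| ≤ η * |t - z| := by
  have h := hA.isLittleO.def one_pos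
  obtain ⟨δ, hδ, h⟩ := Metric.eventually_nhds_iff.1 h
  refine ⟨max (1 + |A - σ|) (R / δ + |σ|), fun t ht => ?_⟩
  by_cases htd : dist t z < δ
  · refine le_trans ?_ (mul_le_mul_of_nonneg_right (le_max_left _ _) (abs_nonneg _))
    have := h htd
    simp only [smul_eq_mul, Real.norm_eq_abs, one_mul] at this
    have e : F t - F z - σ * (t - z) = (F t - F z - (t - z) * A) + (A - σ) * (t - z) := by ring
    rw [e, add_mul, one_mul, ← abs_mul]
    exact (abs_add_le _ _).trans (add_le_add this le_rfl)
  · refine le_trans ?_ (mul_le_mul_of_nonneg_right (le_max_right _ _) (abs_nonneg _))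
    rw [Real.dist_eq, not_lt] at htd
    have hR0 : 0 ≤ R := (abs_nonneg _).trans (hR t ht)
    have : R ≤ R / δ * |t - z| := by
      calc R = R / δ * δ := by field_simp
        _ ≤ _ := mul_le_mul_of_nonneg_left htd (by positivity)
    rw [add_mul, ← abs_mul]
    exact (abs_sub _ _).trans (add_le_add ((hR t ht).trans this) le_rfl)

theorem exists_nearlyAffine {F : ℝ → ℝ} {x y A B : ℝ} (hF : MonotoneOn F (Icc x y)) (hxy : x < y)
    (hA : HasDerivAt F A x) (hB : HasDerivAt F B y) : ∃ η, NearlyAffine F x y A B A η := by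
  have xI : x ∈ Icc x y := left_mem_Icc.2 hxy.le
  have yI : y ∈ Icc x y := right_mem_Icc.2 hxy.le
  obtain ⟨η₁, h₁⟩ := exists_forall_abs_sub_le_of_hasDerivAt (S := Icc x y) (R := F y - F x) hA
    (fun t ht => by
      rw [abs_of_nonneg (by linarith [hF xI ht ht.1])]; linarith [hF ht yI ht.2]) A
  obtain ⟨η₂, h₂⟩ := exists_forall_abs_sub_le_of_hasDerivAt (S := Icc x y) (R := F y - F x) hB
    (fun t ht => by
      rw [abs_of_nonpos (by linarith [hF ht yI ht.2])]; linarith [hF xI ht ht.1]) A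
  refine ⟨max |B - A| (max η₁ η₂), ?_, le_max_left _ _, fun t ht => ?_, fun t ht => ?_⟩
  · simp
  · have h := h₁ t ht
    rw [abs_of_nonneg (by linarith [ht.1] : 0 ≤ t - x)] at h
    exact h.trans (mul_le_mul_of_nonneg_right ((le_max_left _ _).trans (le_max_right _ _))
      (by linarith [ht.1]))
  · have h := h₂ t ht
    rw [abs_of_nonpos (by linarith [ht.2] : t - y ≤ 0), ← abs_neg] at h
    have e : -(F t - F y - A * (t - y)) = F y - F t - A * (y - t) := by ring
    rw [e, neg_sub] at h
    exact h.trans (mul_le_mul_of_nonneg_right ((le_max_right _ _).trans (le_max_right _ _))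
      (by linarith [ht.2]))

theorem NearlyAffine.mono {F : ℝ → ℝ} {x y A B σ η η' : ℝ} (H : NearlyAffine F x y A B σ η)
    (h : η ≤ η') : NearlyAffine F x y A B σ η' :=
  ⟨H.1.trans h, H.2.trans h,
    fun t ht => (H.3 t ht).trans (mul_le_mul_of_nonneg_right h (by linarith [ht.1])),
    fun t ht => (H.4 t ht).trans (mul_le_mul_of_nonneg_right h (by linarith [ht.2]))⟩

/-- A `C²` interpolation whose quality is controlled by every admissible error simultaneously. -/
theorem exists_interpolation {f F : ℝ → ℝ} {x y A B : ℝ} (hxy : x < y)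
    (hf : ContinuousOn f (Icc x y))
    (hf' : ∀ t ∈ Ico x y, HasDerivWithinAt f (F t) (Ici t) t) (hF : MonotoneOn F (Icc x y))
    (hA : HasDerivAt F A x) (hB : HasDerivAt F B y) (hA0 : 0 ≤ A) (hB0 : 0 ≤ B) :
    ∃ u v w : ℝ → ℝ, IsSecondPrimitive u v w ∧ (∀ t ∈ Icc x y, 0 ≤ w t) ∧
      (∀ η, NearlyAffine F x y A B A η → ∀ t ∈ Icc x y, |w t - A| ≤ 11 * η) ∧
      w x = A ∧ w y = B ∧ v x = F x ∧ v y = F y ∧ u x = f x ∧ u y = f y := by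
  have hne : {η | NearlyAffine F x y A B A η}.Nonempty := exists_nearlyAffine hF hxy hA hB
  have hbdd : BddBelow {η | NearlyAffine F x y A B A η} :=
    ⟨0, fun η hη => (abs_nonneg _).trans hη.left_slope⟩
  have hmem : ∀ ε > 0, NearlyAffine F x y A B A (sInf {η | NearlyAffine F x y A B A η} + ε) := by
    intro ε hε
    obtain ⟨η, hη, h⟩ := exists_lt_of_csInf_lt hne (lt_add_of_pos_right _ hε)
    exact NearlyAffine.mono hη h.le
  have hH : NearlyAffine F x y A B A (sInf {η | NearlyAffine F x y A B A η}) := by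
    have lim : ∀ D c s : ℝ, (∀ ε > 0, D ≤ (c + ε) * s) → D ≤ c * s := by
      intro D c s h
      have h1 : Filter.Tendsto (fun ε : ℝ => (c + ε) * s) (nhdsWithin 0 (Ioi 0))
          (nhds ((c + 0) * s)) :=
        ((continuous_const.add continuous_id).mul continuous_const).continuousAt.continuousWithinAt
      rw [add_zero] at h1
      exact ge_of_tendsto h1 (by filter_upwards [self_mem_nhdsWithin] with ε hε using h ε hε)
    refine ⟨?_, ?_, fun t ht => lim _ _ _ fun ε hε => (hmem ε hε).3 t ht,
      fun t ht => lim _ _ _ fun ε hε => (hmem ε hε).4 t ht⟩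
    · simpa using lim _ _ 1 fun ε hε => by simpa using (hmem ε hε).1
    · simpa using lim _ _ 1 fun ε hε => by simpa using (hmem ε hε).2
  obtain ⟨u, v, w, P, hw, rest⟩ := hH.exists_interpolation hxy hf hf' hF hA hB hA0 hB0 hA0
  refine ⟨u, v, w, P, fun t ht => (hw t ht).1, fun η hη t ht => (hw t ht).2.trans ?_, rest⟩
  exact mul_le_mul_of_nonneg_left (csInf_le hbdd hη) (by norm_num)

/-- `(x, y)` is a bounded connected component of the complement of `K`. -/
structure IsGap (K : Set ℝ) (x y : ℝ) : Prop where
  left_mem : x ∈ K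
  right_mem : y ∈ K
  lt : x < y
  notMem : ∀ t ∈ Ioo x y, t ∉ K

/-- `K` is a relatively closed subset of `I` which meets both sides of every point of `I`. -/
structure IsSkeleton (I K : Set ℝ) : Prop where
  subset : K ⊆ I
  eventually_notMem : ∀ x ∈ I, x ∉ K → ∀ᶠ t in nhds x, t ∉ K
  exists_le : ∀ x ∈ I, ∃ y ∈ K, y ≤ x
  exists_ge : ∀ x ∈ I, ∃ y ∈ K, x ≤ y

theorem IsGap.unique {K : Set ℝ} {x y x' y' t : ℝ} (h : IsGap K x y) (h' : IsGap K x' y')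
    (ht : t ∈ Ioo x y) (ht' : t ∈ Ioo x' y') : x = x' ∧ y = y' := by
  constructor
  · by_contra hne
    rcases lt_or_gt_of_ne hne with hl | hl
    · exact h.notMem x' ⟨hl, ht'.1.trans ht.2⟩ h'.left_mem
    · exact h'.notMem x ⟨hl, ht.1.trans ht'.2⟩ h.left_mem
  · by_contra hne
    rcases lt_or_gt_of_ne hne with hl | hl
    · exact h'.notMem y ⟨ht'.1.trans ht.2, hl⟩ h.right_mem
    · exact h.notMem y' ⟨ht.1.trans ht'.2, hl⟩ h'.right_mem

theorem exists_glue_gaps (K : Set ℝ) (s : ℝ → ℝ) (W : ℝ → ℝ → ℝ → ℝ) :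
    ∃ w : ℝ → ℝ, (∀ x ∈ K, w x = s x) ∧
      ∀ x y, IsGap K x y → ∀ t ∈ Ioo x y, w t = W x y t := by
  classical
  refine ⟨fun t => if h : ∃ p : ℝ × ℝ, IsGap K p.1 p.2 ∧ t ∈ Ioo p.1 p.2 then
    W h.choose.1 h.choose.2 t else s t, fun t ht => ?_, fun x y hg t ht => ?_⟩
  · refine dif_neg ?_
    rintro ⟨p, hp, hp'⟩
    exact hp.notMem t hp' ht
  · have h : ∃ p : ℝ × ℝ, IsGap K p.1 p.2 ∧ t ∈ Ioo p.1 p.2 := ⟨(x, y), hg, ht⟩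
    obtain ⟨h1, h2⟩ := IsGap.unique hg h.choose_spec.1 ht h.choose_spec.2
    simp only [dif_pos h]
    rw [← h1, ← h2]

namespace IsSkeleton

variable {I K : Set ℝ}

theorem exists_isGap (h : IsSkeleton I K) (hI : I.OrdConnected) {x : ℝ} (hx : x ∈ I)
    (hxK : x ∉ K) : ∃ a b, IsGap K a b ∧ x ∈ Ioo a b := by
  obtain ⟨k, hk, hkx⟩ := h.exists_le x hx
  obtain ⟨l, hl, hxl⟩ := h.exists_ge x hx
  have closed : ∀ z ∈ I, z ∈ closure K → z ∈ K := by
    intro z hz hzK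
    by_contra hn
    obtain ⟨t, ht, ht'⟩ := mem_closure_iff_frequently.1 hzK |>.and_eventually
      (h.eventually_notMem z hz hn) |>.exists
    exact ht' ht
  have ba : BddAbove (K ∩ Iic x) := ⟨x, fun t ht => ht.2⟩
  have bb : BddBelow (K ∩ Ici x) := ⟨x, fun t ht => ht.2⟩
  have na : (K ∩ Iic x).Nonempty := ⟨k, hk, hkx⟩
  have nb : (K ∩ Ici x).Nonempty := ⟨l, hl, hxl⟩
  have hax : sSup (K ∩ Iic x) ≤ x := csSup_le na fun t ht => ht.2
  have hxb : x ≤ sInf (K ∩ Ici x) := le_csInf nb fun t ht => ht.2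
  have ha : sSup (K ∩ Iic x) ∈ K := closed _
    (hI.out (h.subset hk) hx ⟨le_csSup ba ⟨hk, hkx⟩, hax⟩)
    (closure_mono inter_subset_left (csSup_mem_closure na ba))
  have hb : sInf (K ∩ Ici x) ∈ K := closed _
    (hI.out hx (h.subset hl) ⟨hxb, csInf_le bb ⟨hl, hxl⟩⟩)
    (closure_mono inter_subset_left (csInf_mem_closure nb bb))
  have hax' := lt_of_le_of_ne hax fun e => hxK (e ▸ ha)
  have hxb' := lt_of_le_of_ne hxb fun e => hxK (e ▸ hb)
  refine ⟨_, _, ⟨ha, hb, hax'.trans hxb', fun t ht htK => ?_⟩, hax', hxb'⟩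
  rcases le_total t x with h' | h'
  · exact (le_csSup ba ⟨htK, h'⟩).not_gt ht.1
  · exact (csInf_le bb ⟨htK, h'⟩).not_gt ht.2

theorem mem_or_exists_isGap_right (h : IsSkeleton I K) (hI : I.OrdConnected) {p y : ℝ}
    (hp : p ∈ K) (hy : y ∈ I) (hpy : p < y) :
    y ∈ K ∨ ∃ a b, IsGap K a b ∧ p ≤ a ∧ y ∈ Ioo a b := by
  by_cases hyK : y ∈ K
  · exact .inl hyK
  · obtain ⟨a, b, hg, hab⟩ := h.exists_isGap hI hy hyK
    refine .inr ⟨a, b, hg, ?_, hab⟩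
    by_contra! hlt
    exact hg.notMem p ⟨hlt, hpy.trans hab.2⟩ hp

theorem mem_or_exists_isGap_left (h : IsSkeleton I K) (hI : I.OrdConnected) {p y : ℝ}
    (hp : p ∈ K) (hy : y ∈ I) (hpy : y < p) :
    y ∈ K ∨ ∃ a b, IsGap K a b ∧ b ≤ p ∧ y ∈ Ioo a b := by
  by_cases hyK : y ∈ K
  · exact .inl hyK
  · obtain ⟨a, b, hg, hab⟩ := h.exists_isGap hI hy hyK
    refine .inr ⟨a, b, hg, ?_, hab⟩
    by_contra! hlt
    exact hg.notMem p ⟨hab.1.trans hpy, hlt⟩ hp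

theorem exists_isGap_or_exists_mem_right (h : IsSkeleton I K) (hI : I.OrdConnected)
    (hIo : IsOpen I) {p : ℝ} (hp : p ∈ K) :
    (∃ b, IsGap K p b) ∨ ∀ δ > 0, ∃ k ∈ K, p < k ∧ k < p + δ := by
  by_contra! hcon
  obtain ⟨h1, δ, hδ, h2⟩ := hcon
  obtain ⟨ρ, hρ, hball⟩ := Metric.isOpen_iff.1 hIo p (h.subset hp)
  obtain ⟨r, hr0, hr⟩ := exists_between (lt_min hδ hρ)
  obtain ⟨hrδ, hrρ⟩ := lt_min_iff.1 hr
  have hx : p + r ∈ I := hball (by simpa [abs_of_pos hr0] using hrρ)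
  rcases h.mem_or_exists_isGap_right hI hp hx (by linarith) with hk | ⟨a, b, hg, hpa, hab⟩
  · linarith [h2 _ hk (by linarith)]
  · rcases hpa.eq_or_lt with rfl | hlt
    · exact h1 b hg
    · linarith [h2 a hg.left_mem hlt, hab.1]

theorem exists_isGap_or_exists_mem_left (h : IsSkeleton I K) (hI : I.OrdConnected)
    (hIo : IsOpen I) {p : ℝ} (hp : p ∈ K) :
    (∃ a, IsGap K a p) ∨ ∀ δ > 0, ∃ k ∈ K, p - δ < k ∧ k < p := by
  by_contra! hcon
  obtain ⟨h1, δ, hδ, h2⟩ := hcon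
  obtain ⟨ρ, hρ, hball⟩ := Metric.isOpen_iff.1 hIo p (h.subset hp)
  obtain ⟨r, hr0, hr⟩ := exists_between (lt_min hδ hρ)
  obtain ⟨hrδ, hrρ⟩ := lt_min_iff.1 hr
  have hx : p - r ∈ I := hball (by simpa [abs_of_pos hr0] using hrρ)
  rcases h.mem_or_exists_isGap_left hI hp hx (by linarith) with hk | ⟨a, b, hg, hbp, hab⟩
  · linarith [h2 _ hk (by linarith)]
  · rcases hbp.eq_or_lt with rfl | hlt
    · exact h1 a hg
    · linarith [h2 b hg.right_mem (by linarith [hab.2]), hab.2]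

theorem eq_of_hasDerivAt_zero (h : IsSkeleton I K) (hI : I.OrdConnected) (hIo : IsOpen I)
    {D : ℝ → ℝ} (hD : ∀ p ∈ K, HasDerivAt D 0 p) (hg : ∀ x y, IsGap K x y → D x = D y) :
    ∀ x ∈ K, ∀ y ∈ K, D x = D y := by
  obtain ⟨E, EK, EG⟩ := exists_glue_gaps K D (fun a _ _ => D a)
  have hE : ∀ x ∈ I, HasDerivAt E 0 x := by
    intro x hx
    by_cases hxK : x ∈ K
    · rw [hasDerivAt_iff_isLittleO, Asymptotics.isLittleO_iff]
      intro c hc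
      have := (hasDerivAt_iff_isLittleO.1 (hD x hxK)).def hc
      obtain ⟨δ, hδ, hball⟩ := Metric.eventually_nhds_iff.1 this
      filter_upwards [hIo.mem_nhds hx, Metric.ball_mem_nhds x hδ] with y hy hyδ
      rw [Metric.mem_ball, Real.dist_eq] at hyδ
      have claim : ∃ z, E y = D z ∧ |z - x| ≤ |y - x| := by
        rcases lt_trichotomy x y with hlt | heq | hlt
        · rcases h.mem_or_exists_isGap_right hI hxK hy hlt with hk | ⟨a, b, hg', hxa, hab⟩
          · exact ⟨y, EK y hk, le_rfl⟩
          · refine ⟨a, EG a b hg' y hab, ?_⟩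
            rw [abs_of_nonneg (by linarith), abs_of_nonneg (by linarith)]
            linarith [hab.1]
        · exact ⟨y, heq ▸ EK x hxK, le_rfl⟩
        · rcases h.mem_or_exists_isGap_left hI hxK hy hlt with hk | ⟨a, b, hg', hbx, hab⟩
          · exact ⟨y, EK y hk, le_rfl⟩
          · refine ⟨b, (EG a b hg' y hab).trans (hg a b hg'), ?_⟩
            rw [abs_of_nonpos (by linarith), abs_of_nonpos (by linarith)]
            linarith [hab.2]
      obtain ⟨z, hz, hzx⟩ := claim
      have := hball (y := z) (by rw [Real.dist_eq]; exact hzx.trans_lt hyδ)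
      rw [hz, EK x hxK]
      simp only [smul_zero] at this ⊢
      exact this.trans (mul_le_mul_of_nonneg_left hzx hc.le)
    · obtain ⟨a, b, hg', hab⟩ := h.exists_isGap hI hx hxK
      refine (hasDerivAt_const x (D a)).congr_of_eventuallyEq ?_
      filter_upwards [isOpen_Ioo.mem_nhds hab] with t ht using EG a b hg' t ht
  intro x hx y hy
  rw [← EK x hx, ← EK y hy]
  exact hIo.is_const_of_deriv_eq_zero hI.isPreconnected
    (fun t ht => (hE t ht).differentiableAt.differentiableWithinAt)
    (fun t ht => (hE t ht).deriv) (h.subset hx) (h.subset hy)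

end IsSkeleton

/-- `F` is differentiable at the points of `K` with derivative `s`, locally uniformly on `K`. -/
def HasLocallyUniformDerivOn (F s : ℝ → ℝ) (I K : Set ℝ) : Prop :=
  ∀ p ∈ K, ∀ η > 0, ∃ δ > 0, ∀ x ∈ K, |x - p| < δ → ∀ y ∈ I, |y - p| < δ →
    |F y - F x - s x * (y - x)| ≤ η * |y - x|

namespace HasLocallyUniformDerivOn

variable {F s : ℝ → ℝ} {I K : Set ℝ}

theorem hasDerivAt (H : HasLocallyUniformDerivOn F s I K) (hIo : IsOpen I) {p : ℝ} (hp : p ∈ K)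
    (hpI : p ∈ I) : HasDerivAt F (s p) p := by
  rw [hasDerivAt_iff_isLittleO, Asymptotics.isLittleO_iff]
  intro c hc
  obtain ⟨δ, hδ, h⟩ := H p hp c hc
  filter_upwards [hIo.mem_nhds hpI, Metric.ball_mem_nhds p hδ] with y hy hyδ
  have := h p hp (by simpa using hδ) y hy (by simpa [Real.dist_eq] using hyδ)
  simpa [mul_comm] using this

/-- Near a point of `K`, the slopes are close to each other and all gaps are nearly affine. -/
theorem exists_nearlyAffine (H : HasLocallyUniformDerivOn F s I K) (hI : I.OrdConnected)
    (hKI : K ⊆ I) {p η : ℝ} (hp : p ∈ K) (hη : 0 < η) :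
    ∃ δ > 0, (∀ x ∈ K, |x - p| < δ → |s x - s p| ≤ 2 * η) ∧
      ∀ x ∈ K, ∀ y ∈ K, x < y → |x - p| < δ → |y - p| < δ →
        NearlyAffine F x y (s x) (s y) (s x) (3 * η) := by
  obtain ⟨δ, hδ, h⟩ := H p hp η hη
  have slopes : ∀ x ∈ K, ∀ y ∈ K, |x - p| < δ → |y - p| < δ → |s x - s y| ≤ 2 * η := by
    intro x hx y hy hxp hyp
    rcases eq_or_ne x y with rfl | hne
    · simp; exact hη.le
    have h1 := h x hx hxp y (hKI hy) hyp
    have h2 := h y hy hyp x (hKI hx) hxp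
    have h3 : 0 < |y - x| := abs_pos.2 (sub_ne_zero.2 hne.symm)
    rw [abs_sub_comm x y] at h2
    refine le_of_mul_le_mul_right ?_ h3
    rw [← abs_mul]
    calc |(s x - s y) * (y - x)|
        = |-(F y - F x - s x * (y - x)) - (F x - F y - s y * (x - y))| := by congr 1; ring
      _ ≤ _ := abs_sub _ _
      _ ≤ 2 * η * |y - x| := by rw [abs_neg]; linarith
  refine ⟨δ, hδ, fun x hx hxp => slopes x hx p hp hxp (by simpa using hδ), ?_⟩
  intro x hx y hy hxy hxp hyp
  have near : ∀ t ∈ Icc x y, t ∈ I ∧ |t - p| < δ := fun t ht =>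
    ⟨hI.out (hKI hx) (hKI hy) ht, by
      rw [abs_lt] at *; constructor <;> linarith [ht.1, ht.2]⟩
  have sxy := slopes y hy x hx hyp hxp
  refine ⟨by simp; exact hη.le, sxy.trans (by linarith), fun t ht => ?_, fun t ht => ?_⟩
  · have := h x hx hxp t (near t ht).1 (near t ht).2
    rw [abs_of_nonneg (by linarith [ht.1] : 0 ≤ t - x)] at this
    nlinarith [ht.1]
  · have h1 := h y hy hyp t (near t ht).1 (near t ht).2
    rw [abs_of_nonpos (by linarith [ht.2] : t - y ≤ 0)] at h1
    have h2 : |(s y - s x) * (y - t)| ≤ 2 * η * (y - t) := by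
      rw [abs_mul, abs_of_nonneg (by linarith [ht.2] : 0 ≤ y - t)]
      exact mul_le_mul_of_nonneg_right sxy (by linarith [ht.2])
    calc |F y - F t - s x * (y - t)|
        = |-(F t - F y - s y * (t - y)) + (s y - s x) * (y - t)| := by congr 1; ring
      _ ≤ _ := abs_add_le _ _
      _ ≤ _ := by rw [abs_neg]; linarith

/-- Gluing good interpolating densities over the gaps gives a continuous function. -/
theorem continuousOn_glue (H : HasLocallyUniformDerivOn F s I K) (h : IsSkeleton I K)
    (hI : I.OrdConnected) (hIo : IsOpen I) {w : ℝ → ℝ} {W : ℝ → ℝ → ℝ → ℝ}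
    (wK : ∀ x ∈ K, w x = s x) (wW : ∀ x y, IsGap K x y → ∀ t ∈ Icc x y, w t = W x y t)
    (hW : ∀ x y, IsGap K x y → Continuous (W x y))
    (hWs : ∀ x y, IsGap K x y → ∀ η, NearlyAffine F x y (s x) (s y) (s x) η →
      ∀ t ∈ Icc x y, |W x y t - s x| ≤ 11 * η) : ContinuousOn w I := by
  intro p hpI
  refine ContinuousAt.continuousWithinAt ?_
  by_cases hp : p ∈ K
  · refine continuousAt_iff_continuous_left'_right'.2 ⟨?_, ?_⟩
    · rcases h.exists_isGap_or_exists_mem_left hI hIo hp with ⟨a, hg⟩ | hk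
      · refine ((hW a p hg).continuousAt.continuousWithinAt).congr_of_eventuallyEq ?_
          (wW a p hg p (right_mem_Icc.2 hg.lt.le))
        filter_upwards [Ioo_mem_nhdsLT hg.lt] with t ht using wW a p hg t (Ioo_subset_Icc_self ht)
      · rw [ContinuousWithinAt, Metric.tendsto_nhds]
        intro ε hε
        obtain ⟨δ, hδ, h1, h2⟩ := H.exists_nearlyAffine hI h.subset hp
          (by positivity : 0 < ε / 36)
        obtain ⟨k, hk, hkδ, hkp⟩ := hk δ hδ
        filter_upwards [Ioo_mem_nhdsLT hkp] with y hy
        have near : ∀ t ∈ Icc k p, |t - p| < δ := fun t ht => by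
          rw [abs_lt]; constructor <;> linarith [ht.1, ht.2]
        have hyI : y ∈ I := hI.out (h.subset hk) hpI (Ioo_subset_Icc_self hy)
        rw [Real.dist_eq, wK p hp]
        rcases h.mem_or_exists_isGap_left hI hp hyI hy.2 with hyK | ⟨a, b, hg, hb, hab⟩
        · rw [wK y hyK]
          linarith [h1 y hyK (near y (Ioo_subset_Icc_self hy))]
        · have hka : k ≤ a := by
            by_contra! hlt
            exact hg.notMem k ⟨hlt, hy.1.trans hab.2⟩ hk
          have ha := near a ⟨hka, hg.lt.le.trans hb⟩
          have := h2 a hg.left_mem b hg.right_mem hg.lt ha (near b ⟨hka.trans hg.lt.le, hb⟩)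
          have i1 := hWs a b hg _ this y (Ioo_subset_Icc_self hab)
          have i2 := h1 a hg.left_mem ha
          rw [wW a b hg y (Ioo_subset_Icc_self hab)]
          have := abs_sub_le (W a b y) (s a) (s p)
          linarith
    · rcases h.exists_isGap_or_exists_mem_right hI hIo hp with ⟨b, hg⟩ | hk
      · refine ((hW p b hg).continuousAt.continuousWithinAt).congr_of_eventuallyEq ?_
          (wW p b hg p (left_mem_Icc.2 hg.lt.le))
        filter_upwards [Ioo_mem_nhdsGT hg.lt] with t ht using wW p b hg t (Ioo_subset_Icc_self ht)
      · rw [ContinuousWithinAt, Metric.tendsto_nhds]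
        intro ε hε
        obtain ⟨δ, hδ, h1, h2⟩ := H.exists_nearlyAffine hI h.subset hp
          (by positivity : 0 < ε / 36)
        obtain ⟨k, hk, hpk, hkδ⟩ := hk δ hδ
        filter_upwards [Ioo_mem_nhdsGT hpk] with y hy
        have near : ∀ t ∈ Icc p k, |t - p| < δ := fun t ht => by
          rw [abs_lt]; constructor <;> linarith [ht.1, ht.2]
        have hyI : y ∈ I := hI.out hpI (h.subset hk) (Ioo_subset_Icc_self hy)
        rw [Real.dist_eq, wK p hp]
        rcases h.mem_or_exists_isGap_right hI hp hyI hy.1 with hyK | ⟨a, b, hg, ha, hab⟩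
        · rw [wK y hyK]
          linarith [h1 y hyK (near y (Ioo_subset_Icc_self hy))]
        · have hbk : b ≤ k := by
            by_contra! hlt
            exact hg.notMem k ⟨hab.1.trans hy.2, hlt⟩ hk
          have ha' := near a ⟨ha, hg.lt.le.trans hbk⟩
          have := h2 a hg.left_mem b hg.right_mem hg.lt ha' (near b ⟨ha.trans hg.lt.le, hbk⟩)
          have i1 := hWs a b hg _ this y (Ioo_subset_Icc_self hab)
          have i2 := h1 a hg.left_mem ha'
          rw [wW a b hg y (Ioo_subset_Icc_self hab)]
          have := abs_sub_le (W a b y) (s a) (s p)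
          linarith
  · obtain ⟨a, b, hg, hab⟩ := h.exists_isGap hI hpI hp
    refine (hW a b hg).continuousAt.congr_of_eventuallyEq ?_
    filter_upwards [isOpen_Ioo.mem_nhds hab] with t ht using wW a b hg t (Ioo_subset_Icc_self ht)

end HasLocallyUniformDerivOn

theorem exists_primitive_of_continuousOn {I : Set ℝ} (hI : I.OrdConnected) (hIo : IsOpen I)
    {w : ℝ → ℝ} (hw : ContinuousOn w I) {x₀ : ℝ} (hx₀ : x₀ ∈ I) (c : ℝ) :
    ∃ P : ℝ → ℝ, P x₀ = c ∧ ∀ x ∈ I, HasDerivAt P (w x) x := by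
  refine ⟨fun x => (∫ t in x₀..x, w t) + c, by simp, fun x hx => ?_⟩
  refine (intervalIntegral.integral_hasDerivAt_right ?_ ?_ ?_).add_const c
  · exact (hw.mono (hI.uIcc_subset hx₀ hx)).intervalIntegrable
  · exact hw.stronglyMeasurableAtFilter hIo x hx
  · exact hw.continuousAt (hIo.mem_nhds hx)

/-- The data of a convex function `f` on `I` together with its right derivative `F`. -/
structure IsConvexPair (f F : ℝ → ℝ) (I : Set ℝ) : Prop where
  ordConnected : I.OrdConnected
  isOpen : IsOpen I
  continuousOn : ContinuousOn f I
  monotoneOn : MonotoneOn F I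
  hasDerivWithinAt : ∀ x ∈ I, HasDerivWithinAt f (F x) (Ici x) x
  subgradient : ∀ x ∈ I, ∀ y ∈ I, f x + F x * (y - x) ≤ f y

theorem ConvexOn.isConvexPair {f : ℝ → ℝ} {I : Set ℝ} (hf : ConvexOn ℝ I f) (hIo : IsOpen I) :
    IsConvexPair f (fun x => derivWithin f (Ioi x) x) I := by
  have hint : interior I = I := hIo.interior_eq
  refine ⟨hf.1.ordConnected, hIo, hf.continuousOn hIo, ?_, fun x hx => ?_, fun x hx y hy => ?_⟩
  · simpa only [hint] using hf.monotoneOn_rightDeriv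
  · exact (hf.hasDerivWithinAt_rightDeriv_of_mem_interior (hint.symm ▸ hx)).Ici_of_Ioi
  · rcases lt_trichotomy x y with hlt | rfl | hlt
    · have := hf.rightDeriv_le_slope_of_mem_interior (hint.symm ▸ hx) hy hlt
      rw [slope_def_field, le_div_iff₀ (sub_pos.2 hlt)] at this
      linarith
    · simp
    · have h1 := hf.slope_le_leftDeriv_of_mem_interior hy (hint.symm ▸ hx) hlt
      have h2 := hf.leftDeriv_le_rightDeriv_of_mem_interior (x := x) (hint.symm ▸ hx)
      have h3 := h1.trans h2
      rw [slope_def_field, div_le_iff₀ (sub_pos.2 hlt)] at h3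
      linarith

namespace IsConvexPair

variable {f F s : ℝ → ℝ} {I K : Set ℝ}

theorem hasDerivAt (h : IsConvexPair f F I) {p : ℝ} (hp : p ∈ I) (hF : ContinuousAt F p) :
    HasDerivAt f (F p) p := by
  rw [hasDerivAt_iff_isLittleO, Asymptotics.isLittleO_iff]
  intro c hc
  filter_upwards [h.isOpen.mem_nhds hp, Metric.tendsto_nhds.1 hF c hc] with y hy hyc
  rw [Real.dist_eq] at hyc
  have h1 := h.subgradient p hp y hy
  have h2 := h.subgradient y hy p hp
  rw [Real.norm_eq_abs, Real.norm_eq_abs, smul_eq_mul]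
  calc |f y - f p - (y - p) * F p| ≤ |(F y - F p) * (y - p)| := by
        rw [abs_of_nonneg (by linarith)]
        exact le_trans (by linarith) (le_abs_self _)
    _ ≤ c * |y - p| := by
        rw [abs_mul]; exact mul_le_mul_of_nonneg_right hyc.le (abs_nonneg _)

theorem sub_mem_Icc (h : IsConvexPair f F I) {x y : ℝ} (hx : x ∈ I) (hy : y ∈ I) {t : ℝ}
    (ht : t ∈ Icc x y) : f t - f x ∈ Icc (F x * (t - x)) (F y * (t - x)) := by
  have htI : t ∈ I := h.ordConnected.out hx hy ht
  constructor
  · linarith [h.subgradient x hx t htI]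
  · have := h.subgradient t htI x hx
    nlinarith [mul_le_mul_of_nonneg_right (h.monotoneOn htI hy ht.2) (sub_nonneg.2 ht.1)]

theorem deriv_nonneg (h : IsConvexPair f F I) {p A : ℝ} (hp : p ∈ I) (hA : HasDerivAt F A p) :
    0 ≤ A := by
  have := h.monotoneOn.derivWithin_nonneg (x := p)
  rwa [derivWithin_of_isOpen h.isOpen hp, hA.deriv] at this

theorem of_hasDerivAt {w : ℝ → ℝ} (hI : I.OrdConnected) (hIo : IsOpen I)
    (hf : ∀ x ∈ I, HasDerivAt f (F x) x) (hF : ∀ x ∈ I, HasDerivAt F (w x) x)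
    (hw : ∀ x ∈ I, 0 ≤ w x) : ConvexOn ℝ I f ∧ MonotoneOn F I := by
  have hconv : Convex ℝ I := hI.convex
  have hint : interior I = I := hIo.interior_eq
  have hmono : MonotoneOn F I := by
    refine monotoneOn_of_deriv_nonneg hconv
      (fun x hx => (hF x hx).continuousAt.continuousWithinAt) ?_ ?_
    · rw [hint]; exact fun x hx => (hF x hx).differentiableAt.differentiableWithinAt
    · rw [hint]; intro x hx; rw [(hF x hx).deriv]; exact hw x hx
  refine ⟨MonotoneOn.convexOn_of_deriv hconv
      (fun x hx => (hf x hx).continuousAt.continuousWithinAt) ?_ ?_, hmono⟩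
  · rw [hint]; exact fun x hx => (hf x hx).differentiableAt.differentiableWithinAt
  · rw [hint]; intro x hx y hy hxy
    rw [(hf x hx).deriv, (hf y hy).deriv]; exact hmono hx hy hxy

end IsConvexPair

theorem contDiffOn_two_of_hasDerivAt {g G w : ℝ → ℝ} {I : Set ℝ} (hIo : IsOpen I)
    (hg : ∀ x ∈ I, HasDerivAt g (G x) x) (hG : ∀ x ∈ I, HasDerivAt G (w x) x)
    (hw : ContinuousOn w I) : ContDiffOn ℝ 2 g I := by
  have h1 : ContDiffOn ℝ 1 G I := by
    rw [show (1 : WithTop ℕ∞) = 0 + 1 by rfl, contDiffOn_succ_iff_deriv_of_isOpen hIo]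
    refine ⟨fun x hx => (hG x hx).differentiableAt.differentiableWithinAt, by simp, ?_⟩
    rw [contDiffOn_zero]
    exact hw.congr fun x hx => (hG x hx).deriv
  rw [show (2 : WithTop ℕ∞) = 1 + 1 by rfl, contDiffOn_succ_iff_deriv_of_isOpen hIo]
  exact ⟨fun x hx => (hg x hx).differentiableAt.differentiableWithinAt, by simp,
    h1.congr fun x hx => (hg x hx).deriv⟩

theorem sub_eq_sub_of_hasDerivAt {f F P P' : ℝ → ℝ} {x y : ℝ} (hxy : x ≤ y)
    (hf : ∀ t ∈ Icc x y, HasDerivAt f (F t) t) (hP : ∀ t, HasDerivAt P (P' t) t)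
    (h : ∀ t ∈ Icc x y, F t = P' t) : f y - f x = P y - P x := by
  have hc : ContinuousOn f (Icc x y) := fun t ht => (hf t ht).continuousAt.continuousWithinAt
  have hd : ∀ t ∈ Ico x y, HasDerivWithinAt f (F t) (Ici t) t := fun t ht =>
    (hf t (Ico_subset_Icc_self ht)).hasDerivWithinAt
  exact le_antisymm
    (sub_le_sub_of_rightDeriv_le hxy hc hd hP fun t ht => (h t (Ico_subset_Icc_self ht)).le)
    (sub_le_sub_of_le_rightDeriv hxy hc hd hP fun t ht => (h t (Ico_subset_Icc_self ht)).ge)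

/-- A convex function whose right derivative is locally uniformly differentiable on `K` agrees on
`K` with a convex `C²` function, and the error on each gap is controlled. -/
theorem IsConvexPair.exists_contDiffOn_two {f F s : ℝ → ℝ} {I K : Set ℝ}
    (h : IsConvexPair f F I) (hK : IsSkeleton I K) (H : HasLocallyUniformDerivOn F s I K)
    (hne : K.Nonempty) :
    ∃ g : ℝ → ℝ, ConvexOn ℝ I g ∧ ContDiffOn ℝ 2 g I ∧ (∀ x ∈ K, f x = g x) ∧
      ∀ x y, IsGap K x y → ∀ t ∈ Icc x y, |f t - g t| ≤ (F y - F x) * (y - x) := by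
  have hI := h.ordConnected
  have hIo := h.isOpen
  have gapI : ∀ x y, IsGap K x y → Icc x y ⊆ I := fun x y hg =>
    hI.out (hK.subset hg.left_mem) (hK.subset hg.right_mem)
  have Fd : ∀ p ∈ K, HasDerivAt F (s p) p := fun p hp => H.hasDerivAt hIo hp (hK.subset hp)
  have s0 : ∀ p ∈ K, 0 ≤ s p := fun p hp => h.deriv_nonneg (hK.subset hp) (Fd p hp)
  have interp : ∀ x y, ∃ u v w : ℝ → ℝ, IsGap K x y →
      (IsSecondPrimitive u v w ∧ (∀ t ∈ Icc x y, 0 ≤ w t) ∧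
      (∀ η, NearlyAffine F x y (s x) (s y) (s x) η → ∀ t ∈ Icc x y, |w t - s x| ≤ 11 * η) ∧
      w x = s x ∧ w y = s y ∧ v x = F x ∧ v y = F y ∧ u x = f x ∧ u y = f y) := by
    intro x y
    by_cases hg : IsGap K x y
    · obtain ⟨u, v, w, hu⟩ := exists_interpolation hg.lt (h.continuousOn.mono (gapI x y hg))
        (fun t ht => h.hasDerivWithinAt t (gapI x y hg (Ico_subset_Icc_self ht)))
        (h.monotoneOn.mono (gapI x y hg)) (Fd x hg.left_mem) (Fd y hg.right_mem)
        (s0 x hg.left_mem) (s0 y hg.right_mem)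
      exact ⟨u, v, w, fun _ => hu⟩
    · exact ⟨0, 0, 0, fun hg' => (hg hg').elim⟩
  choose U V W hUVW using interp
  obtain ⟨w, wK, wG⟩ := exists_glue_gaps K s W
  have wW : ∀ x y, IsGap K x y → ∀ t ∈ Icc x y, w t = W x y t := by
    intro x y hg t ht
    obtain ⟨-, -, -, e1, e2, -⟩ := hUVW x y hg
    rcases ht.1.eq_or_lt with rfl | h1
    · rw [wK _ hg.left_mem, e1]
    rcases ht.2.eq_or_lt with rfl | h2
    · rw [wK _ hg.right_mem, e2]
    exact wG x y hg t ⟨h1, h2⟩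
  have wcont : ContinuousOn w I := H.continuousOn_glue hK hI hIo wK wW
    (fun x y hg => (hUVW x y hg).1.continuous) (fun x y hg => (hUVW x y hg).2.2.1)
  have w0 : ∀ x ∈ I, 0 ≤ w x := by
    intro x hx
    by_cases hxK : x ∈ K
    · rw [wK x hxK]; exact s0 x hxK
    · obtain ⟨a, b, hg, hab⟩ := hK.exists_isGap hI hx hxK
      rw [wG a b hg x hab]
      exact (hUVW a b hg).2.1 x (Ioo_subset_Icc_self hab)
  obtain ⟨x₀, hx₀⟩ := hne
  obtain ⟨G, G0, hG⟩ := exists_primitive_of_continuousOn hI hIo wcont (hK.subset hx₀) (F x₀)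
  obtain ⟨g, g0, hg⟩ := exists_primitive_of_continuousOn hI hIo
    (fun x hx => (hG x hx).continuousAt.continuousWithinAt) (hK.subset hx₀) (f x₀)
  have GV : ∀ x y, IsGap K x y → ∀ t ∈ Icc x y, G t - G x = V x y t - V x y x := by
    intro x y hgap t ht
    have hsub : Icc x t ⊆ Icc x y := Icc_subset_Icc_right ht.2
    exact sub_eq_sub_of_hasDerivAt ht.1 (fun r hr => hG r (gapI x y hgap (hsub hr)))
      (hUVW x y hgap).1.2 (fun r hr => wW x y hgap r (hsub hr))
  have GK : ∀ x ∈ K, G x = F x := by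
    intro x hx
    have := hK.eq_of_hasDerivAt_zero hI hIo (D := fun t => G t - F t)
      (fun p hp => ((hG p (hK.subset hp)).sub (Fd p hp)).congr_deriv (by rw [wK p hp, sub_self]))
      (fun a b hgap => by
        have := GV a b hgap b (right_mem_Icc.2 hgap.lt.le)
        obtain ⟨-, -, -, -, -, e1, e2, -⟩ := hUVW a b hgap
        linarith) x hx x₀ hx₀
    linarith
  have gK : ∀ x ∈ K, g x = f x := by
    intro x hx
    have := hK.eq_of_hasDerivAt_zero hI hIo (D := fun t => g t - f t)
      (fun p hp => ((hg p (hK.subset hp)).sub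
        (h.hasDerivAt (hK.subset hp) (Fd p hp).continuousAt)).congr_deriv
          (by rw [GK p hp, sub_self]))
      (fun a b hgap => by
        obtain ⟨P, -, -, -, -, e1, e2, e3, e4⟩ := hUVW a b hgap
        have := sub_eq_sub_of_hasDerivAt hgap.lt.le (fun r hr => hg r (gapI a b hgap hr)) P.1
          (fun r hr => by
            have := GV a b hgap r hr
            rw [GK a hgap.left_mem] at this
            linarith)
        linarith) x hx x₀ hx₀
    linarith
  obtain ⟨gconv, Gmono⟩ := IsConvexPair.of_hasDerivAt hI hIo hg hG w0
  refine ⟨g, gconv, contDiffOn_two_of_hasDerivAt hIo hg hG wcont, fun x hx => (gK x hx).symm, ?_⟩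
  intro x y hgap t ht
  have hx := hK.subset hgap.left_mem
  have hy := hK.subset hgap.right_mem
  have hgpair : IsConvexPair g (fun z => derivWithin g (Ioi z) z) I := gconv.isConvexPair hIo
  have gd : ∀ z ∈ I, derivWithin g (Ioi z) z = G z := fun z hz =>
    (hg z hz).hasDerivWithinAt.derivWithin (uniqueDiffWithinAt_Ioi z)
  obtain ⟨a1, a2⟩ := h.sub_mem_Icc hx hy ht
  obtain ⟨b1, b2⟩ := hgpair.sub_mem_Icc hx hy ht
  simp only [gd x hx, gd y hy, GK x hgap.left_mem, GK y hgap.right_mem, gK x hgap.left_mem]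
    at b1 b2
  have hFxy : 0 ≤ F y - F x := sub_nonneg.2 (h.monotoneOn hx hy hgap.lt.le)
  have : (F y - F x) * (t - x) ≤ (F y - F x) * (y - x) :=
    mul_le_mul_of_nonneg_left (by linarith [ht.2]) hFxy
  rw [abs_le]
  constructor <;> linarith

theorem MonotoneOn.abs_sub_sub_mul_le_of_rat {F : ℝ → ℝ} {I : Set ℝ} (hF : MonotoneOn F I)
    (hIo : IsOpen I) {x σ ρ η : ℝ}
    (h : ∀ q : ℚ, (q : ℝ) ∈ I → |q - x| < ρ → |F q - F x - σ * (q - x)| ≤ η * |q - x|)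
    {y : ℝ} (hy : y ∈ I) (hyx : |y - x| < ρ) :
    |F y - F x - σ * (y - x)| ≤ η * |y - x| := by
  have near : ∀ᶠ z in nhds y, z ∈ I ∧ |z - x| < ρ :=
    (hIo.eventually_mem hy).and ((by fun_prop : Continuous fun z : ℝ =>
      |z - x|).continuousAt.eventually (gt_mem_nhds hyx))
  rw [abs_le]
  constructor
  · by_contra! hlt
    have hc : Continuous fun z : ℝ => F y - F x - σ * (z - x) + η * |z - x| := by fun_prop
    have := near.and (hc.continuousAt.eventually (gt_mem_nhds (show
      F y - F x - σ * (y - x) + η * |y - x| < 0 by linarith)))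
    obtain ⟨e, he, hball⟩ := Metric.eventually_nhds_iff.1 this
    obtain ⟨q, hq1, hq2⟩ := exists_rat_btwn (sub_lt_self y he)
    obtain ⟨⟨hqI, hqx⟩, hq⟩ := hball (y := q) (by
      rw [Real.dist_eq, abs_lt]; constructor <;> linarith)
    have h1 := (abs_le.1 (h q hqI hqx)).1
    have h2 := hF hqI hy hq2.le
    linarith
  · by_contra! hlt
    have hc : Continuous fun z : ℝ => F y - F x - σ * (z - x) - η * |z - x| := by fun_prop
    have := near.and (hc.continuousAt.eventually (lt_mem_nhds (show
      0 < F y - F x - σ * (y - x) - η * |y - x| by linarith)))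
    obtain ⟨e, he, hball⟩ := Metric.eventually_nhds_iff.1 this
    obtain ⟨q, hq1, hq2⟩ := exists_rat_btwn (lt_add_of_pos_right y he)
    obtain ⟨⟨hqI, hqx⟩, hq⟩ := hball (y := q) (by
      rw [Real.dist_eq, abs_lt]; constructor <;> linarith)
    have h1 := (abs_le.1 (h q hqI hqx)).2
    have h2 := hF hy hqI hq1.le
    linarith

/-- A monotone function is uniformly differentiable on compact sets of almost full measure. -/
theorem MonotoneOn.exists_isCompact_uniform_deriv {F : ℝ → ℝ} {I A : Set ℝ}
    (hF : MonotoneOn F I) (hFm : Measurable F) (hIo : IsOpen I) (hAI : A ⊆ I)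
    (hA : MeasurableSet A) (hAfin : volume A ≠ ⊤) {δ : ENNReal} (hδ : δ ≠ 0) :
    ∃ K ⊆ A, IsCompact K ∧ volume (A \ K) < δ ∧ ∀ η > 0, ∃ ρ > 0, ∀ x ∈ K, ∀ y ∈ I,
      |y - x| < ρ → |F y - F x - deriv F x * (y - x)| ≤ η * |y - x| := by
  let B : ℕ → ℕ → Set ℝ := fun k n => {x | ∀ q : ℚ, (q : ℝ) ∈ I →
    |(q : ℝ) - x| < 1 / ((n : ℝ) + 1) →
    |F q - F x - deriv F x * (q - x)| ≤ 1 / ((k : ℝ) + 1) * |(q : ℝ) - x|}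
  have hB : ∀ k n, MeasurableSet (B k n) := by
    intro k n
    have : B k n = ⋂ q : ℚ, {x | (q : ℝ) ∈ I → |(q : ℝ) - x| < 1 / ((n : ℝ) + 1) →
        |F q - F x - deriv F x * (q - x)| ≤ 1 / ((k : ℝ) + 1) * |(q : ℝ) - x|} := by
      ext x; simp [B]
    rw [this]
    refine MeasurableSet.iInter fun q => ?_
    have hd := measurable_deriv F
    refine (MeasurableSet.const _).imp (MeasurableSet.imp ?_ ?_)
    · exact measurableSet_lt (by fun_prop) measurable_const
    · exact measurableSet_le (by fun_prop) (by fun_prop)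
  have hanti : ∀ k, Antitone fun n => A \ B k n := by
    intro k m n hmn
    refine sdiff_subset_sdiff_right fun x hx q hq hqx => hx q hq (hqx.trans_le ?_)
    exact one_div_le_one_div_of_le (by positivity) (by gcongr)
  have hnull : ∀ k, volume (⋂ n, A \ B k n) = 0 := by
    intro k
    refine measure_mono_null ?_ hF.ae_differentiableWithinAt_of_mem
    intro x hx hd
    simp only [mem_iInter, mem_sdiff] at hx
    have hxI := hAI (hx 0).1
    have hd := ((hd hxI).differentiableAt (hIo.mem_nhds hxI)).hasDerivAt
    rw [hasDerivAt_iff_isLittleO, Asymptotics.isLittleO_iff] at hd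
    obtain ⟨e, he, hball⟩ := Metric.eventually_nhds_iff.1
      (hd (show (0 : ℝ) < 1 / ((k : ℝ) + 1) by positivity))
    obtain ⟨n, hn⟩ := exists_nat_one_div_lt he
    refine (hx n).2 fun q _ hqx => ?_
    have := hball (y := q) (hqx.trans hn)
    rwa [Real.norm_eq_abs, Real.norm_eq_abs, smul_eq_mul, mul_comm ((q : ℝ) - x)] at this
  have hδ2 : δ / 2 ≠ 0 := (ENNReal.half_pos hδ).ne'
  obtain ⟨d, hd, hdsum⟩ := ENNReal.exists_pos_sum_of_countable' hδ2 ℕ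
  have hN : ∀ k, ∃ n, volume (A \ B k n) < d k := by
    intro k
    have := tendsto_measure_iInter_atTop (μ := volume) (s := fun n => A \ B k n)
      (fun n => (hA.diff (hB k n)).nullMeasurableSet) (hanti k)
      ⟨0, measure_ne_top_of_subset sdiff_subset hAfin⟩
    rw [hnull k] at this
    exact (this.eventually (gt_mem_nhds (hd k))).exists
  choose N hN using hN
  let C := A ∩ ⋂ k, B k (N k)
  have hC : MeasurableSet C := hA.inter (MeasurableSet.iInter fun k => hB k (N k))
  have hAC : volume (A \ C) < δ / 2 := by
    have : A \ C ⊆ ⋃ k, A \ B k (N k) := by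
      intro x hx
      simp only [C, mem_sdiff, mem_inter_iff, mem_iInter, not_and, not_forall] at hx
      obtain ⟨k, hk⟩ := hx.2 hx.1
      exact mem_iUnion.2 ⟨k, hx.1, hk⟩
    calc volume (A \ C) ≤ ∑' k, volume (A \ B k (N k)) :=
          (measure_mono this).trans (measure_iUnion_le _)
      _ ≤ ∑' k, d k := ENNReal.tsum_le_tsum fun k => (hN k).le
      _ < δ / 2 := hdsum
  obtain ⟨K, hKC, hK, hCK⟩ := hC.exists_isCompact_sdiff_lt
    (measure_ne_top_of_subset inter_subset_left hAfin) hδ2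
  refine ⟨K, hKC.trans inter_subset_left, hK, ?_, fun η hη => ?_⟩
  · have : A \ K ⊆ (A \ C) ∪ (C \ K) := by
      intro x hx
      by_cases hxC : x ∈ C
      · exact Or.inr ⟨hxC, hx.2⟩
      · exact Or.inl ⟨hx.1, hxC⟩
    calc volume (A \ K) ≤ volume (A \ C) + volume (C \ K) :=
          (measure_mono this).trans (measure_union_le _ _)
      _ < δ / 2 + δ / 2 := ENNReal.add_lt_add hAC hCK
      _ = δ := ENNReal.add_halves δ
  · obtain ⟨k, hk⟩ := exists_nat_one_div_lt hη
    refine ⟨1 / ((N k : ℝ) + 1), by positivity, fun x hx y hy hyx => ?_⟩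
    have hxB : x ∈ B k (N k) := mem_iInter.1 (hKC hx).2 k
    exact (hF.abs_sub_sub_mul_le_of_rat hIo hxB hy hyx).trans
      (mul_le_mul_of_nonneg_right hk.le (abs_nonneg _))

theorem IsOpen.exists_continuousOn_exhaustion {I : Set ℝ} (hIo : IsOpen I) :
    ∃ Φ : ℝ → ℝ, ContinuousOn Φ I ∧ Measurable Φ ∧ (∀ x, 0 ≤ Φ x) ∧
      ∀ M, ∃ C ⊆ I, IsCompact C ∧ ∀ x ∈ I, Φ x ≤ M → x ∈ C := by
  by_cases hne : Iᶜ.Nonempty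
  · have hcont := Metric.continuous_infDist_pt Iᶜ
    have hpos : ∀ x, 0 < Metric.infDist x Iᶜ ↔ x ∈ I := fun x => by
      rw [← hIo.isClosed_compl.notMem_iff_infDist_pos hne, notMem_compl_iff]
    refine ⟨fun x => |x| + (Metric.infDist x Iᶜ)⁻¹, ?_, ?_, fun x => ?_, fun M => ?_⟩
    · exact continuousOn_id.abs.add (hcont.continuousOn.inv₀ fun x hx => ((hpos x).2 hx).ne')
    · exact measurable_id.abs.add hcont.measurable.inv
    · have := Metric.infDist_nonneg (x := x) (s := Iᶜ)
      positivity
    · refine ⟨Metric.closedBall 0 M ∩ {x | 1 ≤ M * Metric.infDist x Iᶜ}, ?_, ?_, ?_⟩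
      · rintro x ⟨-, hx⟩
        rw [← hpos]
        refine Metric.infDist_nonneg.lt_of_ne fun h0 => ?_
        rw [mem_ofPred_eq, ← h0] at hx
        norm_num at hx
      · exact (isCompact_closedBall 0 M).inter_right
          (isClosed_le continuous_const (by fun_prop))
      · intro x hx hM
        have h0 := (hpos x).2 hx
        refine ⟨?_, ?_⟩
        · rw [mem_closedBall_zero_iff, Real.norm_eq_abs]
          exact (le_add_of_nonneg_right (inv_nonneg.2 h0.le)).trans hM
        · have h1 : (Metric.infDist x Iᶜ)⁻¹ ≤ M :=
            (le_add_of_nonneg_left (abs_nonneg x)).trans hM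
          exact (inv_le_iff_one_le_mul₀ h0).1 h1
  · rw [not_nonempty_iff_eq_empty, compl_empty_iff] at hne
    subst hne
    refine ⟨fun x => |x|, by fun_prop, by fun_prop, fun x => abs_nonneg x, fun M =>
      ⟨Metric.closedBall 0 M, subset_univ _, isCompact_closedBall 0 M, fun x _ hx => ?_⟩⟩
    rwa [mem_closedBall_zero_iff]

theorem IsCompact.exists_forall_of_eventually {C : Set ℝ} (hC : IsCompact C) {P : ℝ → ℝ → Prop}
    (hP : ∀ x r r', r' ≤ r → P x r → P x r')
    (hloc : ∀ x ∈ C, ∃ r > 0, ∀ᶠ z in nhds x, P z r) : ∃ r > 0, ∀ x ∈ C, P x r := by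
  refine hC.induction_on (p := fun C => ∃ r > 0, ∀ x ∈ C, P x r) ⟨1, one_pos, by simp⟩ ?_ ?_ ?_
  · rintro s t hst ⟨r, hr, h⟩
    exact ⟨r, hr, fun x hx => h x (hst hx)⟩
  · rintro s t ⟨r, hr, h⟩ ⟨r', hr', h'⟩
    refine ⟨min r r', lt_min hr hr', ?_⟩
    rintro x (hx | hx)
    · exact hP _ _ _ (min_le_left _ _) (h x hx)
    · exact hP _ _ _ (min_le_right _ _) (h' x hx)
  · intro x hx
    obtain ⟨r, hr, h⟩ := hloc x hx
    exact ⟨_, mem_nhdsWithin_of_mem_nhds h, r, hr, fun z hz => hz⟩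

theorem MonotoneOn.exists_radius {F Φ ε : ℝ → ℝ} {I : Set ℝ} (hF : MonotoneOn F I)
    (hIo : IsOpen I) (hΦ : ContinuousOn Φ I) (hε : ContinuousOn ε I) (hε0 : ∀ x ∈ I, 0 < ε x)
    {x : ℝ} (hx : x ∈ I) : ∃ r > 0, ∀ᶠ z in nhds x,
      (∀ t ∈ Icc (z - r) (z + r), t ∈ I ∧ |Φ t - Φ z| < 1) ∧
      ∀ α ∈ Icc (z - r) z, ∀ β ∈ Icc z (z + r), (F β - F α) * (β - α) < ε z := by
  have hnhd : ∀ᶠ z in nhds x, z ∈ I ∧ |Φ z - Φ x| < 1 / 2 ∧ ε x / 2 < ε z := by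
    refine (hIo.eventually_mem hx).and (.and ?_ ?_)
    · exact Metric.tendsto_nhds.1 (hΦ.continuousAt (hIo.mem_nhds hx)) _ one_half_pos
    · exact (hε.continuousAt (hIo.mem_nhds hx)).eventually
        (lt_mem_nhds (half_lt_self (hε0 x hx)))
  obtain ⟨e, he, hball⟩ := Metric.eventually_nhds_iff.1 hnhd
  have hb : ∀ t, x - e / 2 ≤ t → t ≤ x + e / 2 → t ∈ I ∧ |Φ t - Φ x| < 1 / 2 ∧ ε x / 2 < ε t := by
    intro t h1 h2
    refine hball ?_
    rw [Real.dist_eq, abs_lt]; constructor <;> linarith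
  have hl := (hb (x - e / 2) le_rfl (by linarith)).1
  have hr := (hb (x + e / 2) (by linarith) le_rfl).1
  set M := F (x + e / 2) - F (x - e / 2) with hM
  have hM0 : 0 ≤ M := sub_nonneg.2 (hF hl hr (by linarith))
  have hεx := hε0 x hx
  refine ⟨min (e / 4) (ε x / (4 * (M + 1))), by positivity, ?_⟩
  set r := min (e / 4) (ε x / (4 * (M + 1))) with hrdef
  have hr1 : r ≤ e / 4 := min_le_left _ _
  have hr2 : r * (4 * (M + 1)) ≤ ε x := by
    rw [← le_div_iff₀ (by positivity)]; exact min_le_right _ _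
  have hr0 : 0 < r := by positivity
  filter_upwards [Metric.ball_mem_nhds x (show 0 < e / 4 by positivity)] with z hz
  rw [Metric.mem_ball, Real.dist_eq, abs_lt] at hz
  obtain ⟨hz1, hz2⟩ := hz
  obtain ⟨hzI, hzΦ, hzε⟩ := hb z (by linarith) (by linarith)
  refine ⟨fun t ht => ?_, fun α hα β hβ => ?_⟩
  · obtain ⟨htI, htΦ, -⟩ := hb t (by linarith [ht.1]) (by linarith [ht.2])
    refine ⟨htI, ?_⟩
    rw [abs_lt] at *
    constructor <;> linarith
  · obtain ⟨hαI, -⟩ := hb α (by linarith [hα.1]) (by linarith [hα.2])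
    obtain ⟨hβI, -⟩ := hb β (by linarith [hβ.1]) (by linarith [hβ.2])
    have h1 := hF hl hαI (by linarith [hα.1])
    have h2 := hF hβI hr (by linarith [hβ.2])
    calc (F β - F α) * (β - α) ≤ M * (2 * r) := by
          refine mul_le_mul (by linarith) (by linarith [hα.1, hβ.2]) ?_ hM0
          linarith [hα.2, hβ.1]
      _ ≤ ε x / 2 := by nlinarith
      _ < ε z := hzε

theorem Nat.floor_le_floor_add_one_of_lt {u v : ℝ} (h : u < v + 1) : ⌊u⌋₊ ≤ ⌊v⌋₊ + 1 := by
  refine Nat.le_of_lt_succ ((Nat.floor_lt' (Nat.succ_ne_zero _)).2 ?_)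
  have := Nat.lt_floor_add_one v
  push_cast
  linarith

theorem MonotoneOn.exists_isSkeleton {F ε : ℝ → ℝ} {I : Set ℝ} (hF : MonotoneOn F I)
    (hFm : Measurable F) (hIo : IsOpen I) (hε : ContinuousOn ε I) (hε0 : ∀ x ∈ I, 0 < ε x)
    {ε₀ : ENNReal} (hε₀ : ε₀ ≠ 0) :
    ∃ K, IsSkeleton I K ∧ HasLocallyUniformDerivOn F (deriv F) I K ∧ volume (I \ K) < ε₀ ∧
      ∀ x ∈ I, ∃ α ∈ K, ∃ β ∈ K, x ∈ Icc α β ∧ (F β - F α) * (β - α) < ε x := by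
  obtain ⟨Φ, hΦ, hΦm, hΦ0, hC⟩ := hIo.exists_continuousOn_exhaustion
  choose C hCI hCc hCΦ using hC
  have hr : ∀ n : ℕ, ∃ r > 0, ∀ z ∈ C (n + 1),
      (∀ t ∈ Icc (z - r) (z + r), t ∈ I ∧ |Φ t - Φ z| < 1) ∧
      ∀ α ∈ Icc (z - r) z, ∀ β ∈ Icc z (z + r), (F β - F α) * (β - α) < ε z := by
    intro n
    refine (hCc (n + 1)).exists_forall_of_eventually (P := fun z r =>
      (∀ t ∈ Icc (z - r) (z + r), t ∈ I ∧ |Φ t - Φ z| < 1) ∧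
      ∀ α ∈ Icc (z - r) z, ∀ β ∈ Icc z (z + r), (F β - F α) * (β - α) < ε z) ?_ ?_
    · rintro z r r' hr ⟨h1, h2⟩
      have hl : z - r ≤ z - r' := by linarith
      have hr : z + r' ≤ z + r := by linarith
      exact ⟨fun t ht => h1 t (Icc_subset_Icc hl hr ht), fun α hα β hβ =>
        h2 α (Icc_subset_Icc_left hl hα) β (Icc_subset_Icc_right hr hβ)⟩
    · exact fun x hx => hF.exists_radius hIo hΦ hε hε0 (hCI _ hx)
  choose r hr0 hr using hr
  obtain ⟨d, hd, hdsum⟩ := ENNReal.exists_pos_sum_of_countable' hε₀ ℕ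
  let T : ℕ → Set ℝ := fun n => I ∩ {x | ⌊Φ x⌋₊ = n}
  have hTC : ∀ n, T n ⊆ C (n + 1) := by
    rintro n x ⟨hxI, rfl⟩
    exact hCΦ _ x hxI (Nat.lt_floor_add_one (Φ x)).le
  have hT : ∀ n, MeasurableSet (T n) := fun n => hIo.measurableSet.inter
    ((Nat.measurable_floor.comp hΦm) (measurableSet_singleton n))
  have hK : ∀ n, ∃ K ⊆ T n, IsCompact K ∧
      volume (T n \ K) < min (d n) (ENNReal.ofReal (min (r (n - 1)) (min (r n) (r (n + 1))) / 4)) ∧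
      ∀ η > 0, ∃ ρ > 0, ∀ x ∈ K, ∀ y ∈ I,
        |y - x| < ρ → |F y - F x - deriv F x * (y - x)| ≤ η * |y - x| := by
    intro n
    refine hF.exists_isCompact_uniform_deriv hFm hIo inter_subset_left (hT n) ?_ ?_
    · exact measure_ne_top_of_subset (hTC n) (hCc _).measure_lt_top.ne
    · have h1 := hr0 (n - 1)
      have h2 := hr0 n
      have h3 := hr0 (n + 1)
      exact (lt_min (hd n) (ENNReal.ofReal_pos.2 (by positivity))).ne'
  choose K hKT hKc hKvol hKder using hK
  have hvol : ∀ m n, m ≤ n + 1 → n ≤ m + 1 → volume (T m \ K m) ≤ ENNReal.ofReal (r n / 4) := by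
    intro m n h1 h2
    refine (hKvol m).le.trans ((min_le_right _ _).trans (ENNReal.ofReal_le_ofReal ?_))
    gcongr
    obtain rfl | rfl | rfl : n = m - 1 ∨ n = m ∨ n = m + 1 := by omega
    · exact min_le_left _ _
    · exact (min_le_right _ _).trans (min_le_left _ _)
    · exact (min_le_right _ _).trans (min_le_right _ _)
  have hmem : ∀ x ∈ I, ∀ t ∈ I, |Φ t - Φ x| < 1 →
      (t ∈ T (⌊Φ x⌋₊ - 1) ∨ t ∈ T ⌊Φ x⌋₊ ∨ t ∈ T (⌊Φ x⌋₊ + 1)) := by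
    intro x _ t ht htx
    obtain ⟨h1, h2⟩ := abs_lt.1 htx
    have h3 := Nat.floor_le_floor_add_one_of_lt (show Φ t < Φ x + 1 by linarith)
    have h4 := Nat.floor_le_floor_add_one_of_lt (show Φ x < Φ t + 1 by linarith)
    simp only [T, mem_inter_iff, mem_ofPred_eq, ht, true_and]
    omega
  have meets : ∀ x ∈ I, ∀ u v, v - u = r ⌊Φ x⌋₊ → (∀ t ∈ Icc u v, t ∈ I ∧ |Φ t - Φ x| < 1) →
      ∃ t ∈ Icc u v, t ∈ ⋃ n, K n := by
    intro x hx u v huv hsub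
    by_contra! hno
    set n := ⌊Φ x⌋₊
    have hno' : ∀ t ∈ Icc u v, ∀ m, t ∉ K m := fun t ht m hm => hno t ht (mem_iUnion.2 ⟨m, hm⟩)
    have hcov : Icc u v ⊆ (T (n - 1) \ K (n - 1)) ∪ ((T n \ K n) ∪ (T (n + 1) \ K (n + 1))) := by
      intro t ht
      rcases hmem x hx t (hsub t ht).1 (hsub t ht).2 with h | h | h
      · exact Or.inl ⟨h, hno' t ht _⟩
      · exact Or.inr (Or.inl ⟨h, hno' t ht _⟩)
      · exact Or.inr (Or.inr ⟨h, hno' t ht _⟩)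
    have hlt : ENNReal.ofReal (r n) < ENNReal.ofReal (r n) := by
      have hrn := hr0 n
      calc ENNReal.ofReal (r n) = volume (Icc u v) := by rw [Real.volume_Icc, huv]
        _ ≤ volume (T (n - 1) \ K (n - 1)) +
            (volume (T n \ K n) + volume (T (n + 1) \ K (n + 1))) :=
          (measure_mono hcov).trans ((measure_union_le _ _).trans
            (add_le_add le_rfl (measure_union_le _ _)))
        _ ≤ ENNReal.ofReal (r n / 4) + (ENNReal.ofReal (r n / 4) + ENNReal.ofReal (r n / 4)) :=
          add_le_add (hvol _ _ (by omega) (by omega)) (add_le_add (hvol _ _ (by omega) (by omega))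
            (hvol _ _ (by omega) (by omega)))
        _ = ENNReal.ofReal (r n / 4 + (r n / 4 + r n / 4)) := by
          rw [ENNReal.ofReal_add (by positivity) (by positivity),
            ENNReal.ofReal_add (by positivity) (by positivity)]
        _ < ENNReal.ofReal (r n) := (ENNReal.ofReal_lt_ofReal_iff hrn).2 (by linarith)
    exact lt_irrefl _ hlt
  have hsand : ∀ x ∈ I, ∃ α ∈ ⋃ n, K n, ∃ β ∈ ⋃ n, K n,
      x ∈ Icc α β ∧ (F β - F α) * (β - α) < ε x := by
    intro x hx
    obtain ⟨h1, h2⟩ := hr ⌊Φ x⌋₊ x (hTC _ ⟨hx, rfl⟩)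
    have hrn := hr0 ⌊Φ x⌋₊
    obtain ⟨α, hα, hαK⟩ := meets x hx (x - r ⌊Φ x⌋₊) x (by ring) fun t ht =>
      h1 t ⟨ht.1, by linarith [ht.2]⟩
    obtain ⟨β, hβ, hβK⟩ := meets x hx x (x + r ⌊Φ x⌋₊) (by ring) fun t ht =>
      h1 t ⟨by linarith [ht.1], ht.2⟩
    exact ⟨α, hαK, β, hβK, ⟨hα.2, hβ.1⟩, h2 α hα β hβ⟩
  have hKI : ⋃ n, K n ⊆ I := iUnion_subset fun n => (hKT n).trans inter_subset_left
  have hTuniq : ∀ {t m n}, t ∈ T m → t ∈ T n → m = n := fun h h' => h.2.symm.trans h'.2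
  have hnear : ∀ x ∈ I, ∀ᶠ t in nhds x, t ∈ ⋃ n, K n →
      (t ∈ K (⌊Φ x⌋₊ - 1) ∨ t ∈ K ⌊Φ x⌋₊ ∨ t ∈ K (⌊Φ x⌋₊ + 1)) := by
    intro x hx
    filter_upwards [Metric.tendsto_nhds.1 (hΦ.continuousAt (hIo.mem_nhds hx)) 1 one_pos]
      with t ht htK
    obtain ⟨m, hm⟩ := mem_iUnion.1 htK
    rcases hmem x hx t (hKI htK) ht with h | h | h
    · exact Or.inl (hTuniq (hKT m hm) h ▸ hm)
    · exact Or.inr (Or.inl (hTuniq (hKT m hm) h ▸ hm))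
    · exact Or.inr (Or.inr (hTuniq (hKT m hm) h ▸ hm))
  refine ⟨⋃ n, K n, ⟨hKI, fun x hx hxK => ?_, fun x hx => ?_, fun x hx => ?_⟩, ?_, ?_, hsand⟩
  · have hcl : ∀ m, ∀ᶠ t in nhds x, t ∉ K m := fun m =>
      (hKc m).isClosed.isOpen_compl.eventually_mem fun h => hxK (mem_iUnion.2 ⟨m, h⟩)
    filter_upwards [hnear x hx, hcl (⌊Φ x⌋₊ - 1), hcl ⌊Φ x⌋₊, hcl (⌊Φ x⌋₊ + 1)]
      with t h0 h1 h2 h3 htK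
    rcases h0 htK with h | h | h
    exacts [h1 h, h2 h, h3 h]
  · obtain ⟨α, hα, _, _, hx, -⟩ := hsand x hx
    exact ⟨α, hα, hx.1⟩
  · obtain ⟨_, _, β, hβ, hx, -⟩ := hsand x hx
    exact ⟨β, hβ, hx.2⟩
  · intro p hp η hη
    have hder : ∀ m, ∃ δ > 0, ∀ x ∈ K m, |x - p| < δ → ∀ y ∈ I, |y - p| < δ →
        |F y - F x - deriv F x * (y - x)| ≤ η * |y - x| := by
      intro m
      obtain ⟨ρ, hρ, h⟩ := hKder m η hη
      refine ⟨ρ / 2, by positivity, fun x hx hxp y hy hyp => h x hx y hy ?_⟩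
      rw [abs_lt] at *
      constructor <;> linarith
    obtain ⟨e, he, hball⟩ := Metric.eventually_nhds_iff.1 (hnear p (hKI hp))
    obtain ⟨δ₁, hδ₁, h1⟩ := hder (⌊Φ p⌋₊ - 1)
    obtain ⟨δ₂, hδ₂, h2⟩ := hder ⌊Φ p⌋₊
    obtain ⟨δ₃, hδ₃, h3⟩ := hder (⌊Φ p⌋₊ + 1)
    refine ⟨min e (min δ₁ (min δ₂ δ₃)), by positivity, fun x hx hxp y hy hyp => ?_⟩
    simp only [lt_min_iff] at hxp hyp
    rcases hball (y := x) hxp.1 hx with h | h | h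
    exacts [h1 x h hxp.2.1 y hy hyp.2.1, h2 x h hxp.2.2.1 y hy hyp.2.2.1,
      h3 x h hxp.2.2.2 y hy hyp.2.2.2]
  · have hcov : I \ ⋃ n, K n ⊆ ⋃ n, T n \ K n := by
      rintro x ⟨hx, hxK⟩
      exact mem_iUnion.2 ⟨⌊Φ x⌋₊, ⟨hx, rfl⟩, fun h => hxK (mem_iUnion.2 ⟨_, h⟩)⟩
    calc volume (I \ ⋃ n, K n) ≤ ∑' n, volume (T n \ K n) :=
          (measure_mono hcov).trans (measure_iUnion_le _)
      _ ≤ ∑' n, d n := ENNReal.tsum_le_tsum fun n => (hKvol n).le.trans (min_le_left _ _)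
      _ < ε₀ := hdsum

theorem ConvexOn.exists_contDiffOn_two_approx {f ε : ℝ → ℝ} {I : Set ℝ} (hf : ConvexOn ℝ I f)
    (hIo : IsOpen I) (hε : ContinuousOn ε I) (hε0 : ∀ x ∈ I, 0 < ε x) {ε₀ : ENNReal}
    (hε₀ : ε₀ ≠ 0) :
    ∃ g : ℝ → ℝ, ConvexOn ℝ I g ∧ ContDiffOn ℝ 2 g I ∧ volume {x | x ∈ I ∧ f x ≠ g x} < ε₀ ∧
      ∀ x ∈ I, |f x - g x| < ε x := by
  rcases I.eq_empty_or_nonempty with rfl | ⟨x₀, hx₀⟩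
  · exact ⟨f, hf, contDiffOn_empty, by simpa using hε₀.bot_lt, by simp⟩
  have hp := hf.isConvexPair hIo
  obtain ⟨K, hK, H, hvol, hsand⟩ := hp.monotoneOn.exists_isSkeleton
    (measurable_derivWithin_Ioi f) hIo hε hε0 hε₀
  obtain ⟨y₀, hy₀, -⟩ := hK.exists_le x₀ hx₀
  obtain ⟨g, gconv, gC2, gK, gerr⟩ := hp.exists_contDiffOn_two hK H ⟨y₀, hy₀⟩
  refine ⟨g, gconv, gC2, (measure_mono ?_).trans_lt hvol, fun x hx => ?_⟩
  · exact fun x hx => ⟨hx.1, fun hxK => hx.2 (gK x hxK)⟩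
  by_cases hxK : x ∈ K
  · simpa [gK x hxK] using hε0 x hx
  obtain ⟨u, v, hg, hxuv⟩ := hK.exists_isGap hp.ordConnected hx hxK
  obtain ⟨α, hα, β, hβ, hxαβ, hlt⟩ := hsand x hx
  have hαu : α ≤ u := by
    by_contra! h
    exact hg.notMem α ⟨h, hxαβ.1.trans_lt hxuv.2⟩ hα
  have hvβ : v ≤ β := by
    by_contra! h
    exact hg.notMem β ⟨hxuv.1.trans_le hxαβ.2, h⟩ hβ
  have h1 := hp.monotoneOn (hK.subset hα) (hK.subset hg.left_mem) hαu
  have h2 := hp.monotoneOn (hK.subset hg.right_mem) (hK.subset hβ) hvβ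
  have h3 := hp.monotoneOn (hK.subset hg.left_mem) (hK.subset hg.right_mem) hg.lt.le
  refine (gerr u v hg x (Ioo_subset_Icc_self hxuv)).trans_lt (lt_of_le_of_lt ?_ hlt)
  exact mul_le_mul (by linarith) (by linarith) (by linarith [hg.lt]) (by linarith)

/-- **Theorem 3.** Let `f : (a,b) → ℝ` be convex, `−∞ ≤ a < b ≤ ∞`. Then for every
`ε₀ > 0` and every continuous `ε : (a,b) → (0,∞)` there is a convex function
`g ∈ C²(a,b)` with `|{f ≠ g}| < ε₀` and `|f − g| < ε` on `(a,b)`. -/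
theorem convex_lusin_C2_general (a b : EReal) (hab : a < b) (f : ℝ → ℝ)
    (hf : ConvexOn ℝ {x : ℝ | a < (x : EReal) ∧ (x : EReal) < b} f)
    (ε₀ : ℝ) (hε₀ : 0 < ε₀) (ε : ℝ → ℝ)
    (hεcont : ContinuousOn ε {x : ℝ | a < (x : EReal) ∧ (x : EReal) < b})
    (hεpos : ∀ x : ℝ, a < (x : EReal) → (x : EReal) < b → 0 < ε x) :
    ∃ g : ℝ → ℝ,
      ConvexOn ℝ {x : ℝ | a < (x : EReal) ∧ (x : EReal) < b} g ∧
      ContDiffOn ℝ 2 g {x : ℝ | a < (x : EReal) ∧ (x : EReal) < b} ∧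
      volume {x : ℝ | (a < (x : EReal) ∧ (x : EReal) < b) ∧ f x ≠ g x} < ENNReal.ofReal ε₀ ∧
      ∀ x : ℝ, a < (x : EReal) → (x : EReal) < b → |f x - g x| < ε x := by
  have hIo : IsOpen {x : ℝ | a < (x : EReal) ∧ (x : EReal) < b} :=
    isOpen_Ioo.preimage continuous_coe_real_ereal
  obtain ⟨g, h1, h2, h3, h4⟩ := hf.exists_contDiffOn_two_approx hIo hεcont
    (fun x hx => hεpos x hx.1 hx.2) (ENNReal.ofReal_pos.2 hε₀).ne'
  exact ⟨g, h1, h2, h3, fun x hxa hxb => h4 x ⟨hxa, hxb⟩⟩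
end

section
/- Let a, b ∈ ℝ with a < b, and let f : [a,b] → ℝ be continuous on [a,b] and convex on (a,b). Then for every ε₀ > 0 there exists a convex function g that is of class C² on (a,b), continuous on [a,b], satisfies g(a) = f(a) and g(b) = f(b), and such that the Lebesgue measure of the set {x ∈ (a,b) : f(x) ≠ g(x)} is less than ε₀. -/
open MeasureTheory Set

open Filter Topology

/-- `(c, d)` is a bounded component of the complement of `K`, with endpoints in `K`. -/
structure IsGap_s1 (K : Set ℝ) (c d : ℝ) : Prop where
  left_mem : c ∈ K
  right_mem : d ∈ K
  lt : c < d
  notMem : ∀ y, c < y → y < d → y ∉ K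

namespace IsGap_s1

variable {K : Set ℝ} {c d c' d' x y : ℝ}

lemma le_left (h : IsGap_s1 K c d) (hy : y ∈ K) (hyx : y < d) : y ≤ c :=
  not_lt.1 fun hcy => h.notMem y hcy hyx hy

lemma right_le (h : IsGap_s1 K c d) (hy : y ∈ K) (hyx : c < y) : d ≤ y :=
  not_lt.1 fun hyd => h.notMem y hyx hyd hy

lemma eq_of_mem (h : IsGap_s1 K c d) (h' : IsGap_s1 K c' d') (hx : x ∈ Ioo c d) (hx' : x ∈ Ioo c' d') :
    c = c' ∧ d = d' :=
  ⟨le_antisymm (h'.le_left h.left_mem (hx.1.trans hx'.2))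
      (h.le_left h'.left_mem (hx'.1.trans hx.2)),
    le_antisymm (h.right_le h'.right_mem (hx.1.trans hx'.2))
      (h'.right_le h.right_mem (hx'.1.trans hx.2))⟩

end IsGap_s1

lemma IsClosed.exists_isGap {K : Set ℝ} (hK : IsClosed K) {a b x : ℝ} (ha : a ∈ K) (hb : b ∈ K)
    (hx : x ∈ Icc a b) (hxK : x ∉ K) : ∃ c d, IsGap_s1 K c d ∧ x ∈ Ioo c d := by
  obtain ⟨c, ⟨hcK, hca⟩, hc⟩ := (isCompact_Icc.inter_left hK : IsCompact (K ∩ Icc a x)).exists_isGreatest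
    ⟨a, ha, le_rfl, hx.1⟩
  obtain ⟨d, ⟨hdK, hdb⟩, hd⟩ := (isCompact_Icc.inter_left hK : IsCompact (K ∩ Icc x b)).exists_isLeast
    ⟨b, hb, hx.2, le_rfl⟩
  have hcx : c < x := hca.2.lt_of_ne fun h => hxK (h ▸ hcK)
  have hxd : x < d := hdb.1.lt_of_ne fun h => hxK (h ▸ hdK)
  refine ⟨c, d, ⟨hcK, hdK, hcx.trans hxd, fun y hcy hyd hy => ?_⟩, hcx, hxd⟩
  rcases le_total y x with h | h
  · exact hcy.not_ge (hc ⟨hy, hca.1.trans hcy.le, h⟩)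
  · exact hyd.not_ge (hd ⟨hy, h, hyd.le.trans hdb.2⟩)

/-- A function on a closed set with vanishing derivative, which moreover takes equal values at the
two ends of each gap, is constant. -/
lemma eq_of_hasDerivWithinAt_zero_of_isGap {K : Set ℝ} (hK : IsClosed K) {a b : ℝ} (ha : a ∈ K)
    (hb : b ∈ K) (hKab : K ⊆ Icc a b) {e : ℝ → ℝ} (hd : ∀ x ∈ K, HasDerivWithinAt e 0 K x)
    (hgap : ∀ c d, IsGap_s1 K c d → e c = e d) : ∀ x ∈ K, e x = e a := by
  classical
  have hex : ∀ x, ∃ E : ℝ, (x ∈ K → E = e x) ∧ ∀ c d, IsGap_s1 K c d → x ∈ Ioo c d → E = e c := by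
    intro x
    by_cases hx : x ∈ K
    · exact ⟨e x, fun _ => rfl, fun c d h hxI => absurd hx (h.notMem x hxI.1 hxI.2)⟩
    by_cases hg : ∃ c d, IsGap_s1 K c d ∧ x ∈ Ioo c d
    · obtain ⟨c, d, h, hxI⟩ := hg
      exact ⟨e c, fun h => absurd h hx, fun c' d' h' hxI' => by rw [(h.eq_of_mem h' hxI hxI').1]⟩
    · exact ⟨0, fun h => absurd h hx, fun c d h hxI => absurd ⟨c, d, h, hxI⟩ hg⟩
  choose E hEK hEgap using hex
  have key : ∀ x ∈ K, ∀ z ∈ Icc a b, ∃ k ∈ K, E z = e k ∧ |k - x| ≤ |z - x| := by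
    intro x hx z hz
    by_cases hzK : z ∈ K
    · exact ⟨z, hzK, hEK z hzK, le_rfl⟩
    obtain ⟨c, d, h, hzI⟩ := hK.exists_isGap ha hb hz hzK
    rcases lt_or_ge x z with hxz | hxz
    · have := h.le_left hx (hxz.trans hzI.2)
      refine ⟨c, h.left_mem, hEgap z c d h hzI, ?_⟩
      rw [abs_of_nonneg (by linarith), abs_of_nonneg (by linarith)]
      linarith [hzI.1]
    · have := h.right_le hx (hzI.1.trans_le hxz)
      refine ⟨d, h.right_mem, (hEgap z c d h hzI).trans (hgap c d h), ?_⟩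
      rw [abs_of_nonpos (by linarith), abs_of_nonpos (by linarith)]
      linarith [hzI.2]
  have hder : ∀ x ∈ Icc a b, HasDerivWithinAt E 0 (Icc a b) x := by
    intro x hx
    by_cases hxK : x ∈ K
    · rw [hasDerivWithinAt_iff_isLittleO, Asymptotics.isLittleO_iff]
      intro ε hε
      have h1 := (hasDerivWithinAt_iff_isLittleO.1 (hd x hxK))
      rw [Asymptotics.isLittleO_iff] at h1
      have h2 := h1 hε
      rw [eventually_nhdsWithin_iff, Metric.eventually_nhds_iff] at h2 ⊢
      obtain ⟨δ, hδ, h2⟩ := h2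
      refine ⟨δ, hδ, fun z hz hzI => ?_⟩
      obtain ⟨k, hkK, hk, hkz⟩ := key x hxK z hzI
      have h3 := @h2 k (by rw [Real.dist_eq] at hz ⊢; exact hkz.trans_lt hz) hkK
      rw [hk, hEK x hxK]
      simp only [smul_zero, sub_zero, Real.norm_eq_abs] at h3 ⊢
      exact h3.trans (by gcongr)
    · obtain ⟨c, d, h, hxI⟩ := hK.exists_isGap ha hb hx hxK
      have : HasDerivAt E 0 x := by
        refine (hasDerivAt_const x (e c)).congr_of_eventuallyEq ?_
        filter_upwards [Ioo_mem_nhds hxI.1 hxI.2] with z hz using hEgap z c d h hz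
      exact this.hasDerivWithinAt
  have hconst := constant_of_has_deriv_right_zero (fun x hx => (hder x hx).continuousWithinAt)
    (fun x hx => (hder x ⟨hx.1, hx.2.le⟩).mono_of_mem_nhdsWithin
      (mem_of_superset (Icc_mem_nhdsGE hx.2) (Icc_subset_Icc_left hx.1)))
  intro x hx
  rw [← hEK x hx, ← hEK a ha]
  exact hconst x (hKab hx)

/-- On the gap `(c, d)` the function `u` may serve as the second derivative of an extension with
values `f`, first derivatives `h` and second derivatives `l` at the endpoints. -/
structure IsGapFill (f h l : ℝ → ℝ) (c d : ℝ) (u : ℝ → ℝ) : Prop where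
  continuous : Continuous u
  nonneg : ∀ x ∈ Icc c d, 0 ≤ u x
  left : u c = l c
  right : u d = l d
  integral : ∫ t in c..d, u t = h d - h c
  moment : ∫ t in c..d, (d - t) * u t = f d - f c - h c * (d - c)

lemma exists_isGapFill_nearly_optimal {f h l : ℝ → ℝ} {c d : ℝ} (hcd : c < d)
    (hex : ∃ u, IsGapFill f h l c d u) :
    ∃ u, IsGapFill f h l c d u ∧ ∀ ε u', IsGapFill f h l c d u' →
      (∀ x ∈ Icc c d, |u' x - l c| ≤ ε) → ∀ x ∈ Icc c d, |u x - l c| ≤ ε + (d - c) := by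
  set E : Set ℝ := {ε | ∃ u, IsGapFill f h l c d u ∧ ∀ x ∈ Icc c d, |u x - l c| ≤ ε}
  have hne : E.Nonempty := by
    obtain ⟨u, hu⟩ := hex
    obtain ⟨C, hC⟩ := isCompact_Icc.exists_bound_of_continuousOn
      (s := Icc c d) (f := fun x => u x - l c) (by have := hu.continuous; fun_prop)
    exact ⟨C, u, hu, hC⟩
  have hbdd : BddBelow E := ⟨0, fun ε ⟨u, _, hu⟩ =>
    (abs_nonneg _).trans (hu c (left_mem_Icc.2 hcd.le))⟩
  obtain ⟨ε₁, ⟨u, hu, hu1⟩, hε₁⟩ := Real.lt_sInf_add_pos hne (sub_pos.2 hcd)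
  refine ⟨u, hu, fun ε u' hu' hb x hx => (hu1 x hx).trans ?_⟩
  have := csInf_le hbdd (show ε ∈ E from ⟨u', hu', hb⟩)
  linarith

/-- Fillings of the individual gaps can be patched together with `l` to a continuous function,
provided the short gaps have fillings of small oscillation. -/
lemma exists_continuousOn_of_isGapFill {K : Set ℝ} (hK : IsClosed K) {a b : ℝ} (ha : a ∈ K)
    (hb : b ∈ K) {f h l : ℝ → ℝ} (hl : ContinuousOn l K) (hl0 : ∀ x ∈ K, 0 ≤ l x)
    (hU : ∀ c d, IsGap_s1 K c d → ∃ u, IsGapFill f h l c d u)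
    (hV : ∀ ε > 0, ∃ δ > 0, ∀ c d, IsGap_s1 K c d → d - c < δ →
      ∃ u, IsGapFill f h l c d u ∧ ∀ x ∈ Icc c d, |u x - l c| ≤ ε) :
    ∃ u : ℝ → ℝ, ContinuousOn u (Icc a b) ∧ (∀ x ∈ Icc a b, 0 ≤ u x) ∧ (∀ x ∈ K, u x = l x) ∧
      ∀ c d, IsGap_s1 K c d → ∃ v, IsGapFill f h l c d v ∧ EqOn u v (Icc c d) := by
  classical
  have hU' : ∀ c d, ∃ u, IsGap_s1 K c d → IsGapFill f h l c d u ∧ ∀ ε u', IsGapFill f h l c d u' →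
      (∀ x ∈ Icc c d, |u' x - l c| ≤ ε) → ∀ x ∈ Icc c d, |u x - l c| ≤ ε + (d - c) := by
    intro c d
    by_cases hg : IsGap_s1 K c d
    · obtain ⟨u, hu⟩ := exists_isGapFill_nearly_optimal hg.lt (hU c d hg)
      exact ⟨u, fun _ => hu⟩
    · exact ⟨0, fun h => absurd h hg⟩
  choose U hUf using hU'
  have hUε : ∀ ε > 0, ∃ δ > 0, ∀ c d, IsGap_s1 K c d → d - c < δ →
      ∀ x ∈ Icc c d, |U c d x - l c| ≤ ε := by
    intro ε hε
    obtain ⟨δ, hδ, hVδ⟩ := hV (ε / 2) (by positivity)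
    refine ⟨min δ (ε / 2), by positivity, fun c d hg hdc x hx => ?_⟩
    obtain ⟨u, hu, hub⟩ := hVδ c d hg (hdc.trans_le (min_le_left _ _))
    have := (hUf c d hg).2 _ u hu hub x hx
    have := hdc.trans_le (min_le_right _ _)
    linarith
  have hex : ∀ x, ∃ y : ℝ, (x ∈ K → y = l x) ∧ ∀ c d, IsGap_s1 K c d → x ∈ Ioo c d → y = U c d x := by
    intro x
    by_cases hx : x ∈ K
    · exact ⟨l x, fun _ => rfl, fun c d h hxI => absurd hx (h.notMem x hxI.1 hxI.2)⟩
    by_cases hg : ∃ c d, IsGap_s1 K c d ∧ x ∈ Ioo c d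
    · obtain ⟨c, d, h, hxI⟩ := hg
      refine ⟨U c d x, fun h => absurd h hx, fun c' d' h' hxI' => ?_⟩
      obtain ⟨rfl, rfl⟩ := h.eq_of_mem h' hxI hxI'
      rfl
    · exact ⟨0, fun h => absurd h hx, fun c d h hxI => absurd ⟨c, d, h, hxI⟩ hg⟩
  choose u huK hugap using hex
  have heq : ∀ c d, IsGap_s1 K c d → EqOn u (U c d) (Icc c d) := by
    intro c d hg x hx
    rcases hx.1.eq_or_lt with rfl | hcx
    · rw [huK _ hg.left_mem, (hUf _ d hg).1.left]
    rcases hx.2.eq_or_lt with rfl | hxd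
    · rw [huK _ hg.right_mem, (hUf c _ hg).1.right]
    exact hugap x c d hg ⟨hcx, hxd⟩
  have hright : ∀ x ∈ K, ∀ ε > 0, ∃ r > 0, ∀ z ∈ Icc a b, x < z → z < x + r →
      |u z - l x| ≤ ε := by
    intro x hx ε hε
    by_cases hg : ∃ d, IsGap_s1 K x d
    · obtain ⟨d, hg⟩ := hg
      obtain ⟨r, hr, hrb⟩ := Metric.continuous_iff.1 (hUf x d hg).1.continuous x ε hε
      refine ⟨min r (d - x), lt_min hr (sub_pos.2 hg.lt), fun z _ hxz hzr => ?_⟩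
      have h1 := hzr.trans_le (add_le_add_right (min_le_left _ _) x)
      have h2 := hzr.trans_le (add_le_add_right (min_le_right _ _) x)
      rw [heq x d hg ⟨hxz.le, by linarith⟩, ← (hUf x d hg).1.left]
      exact (hrb z (by rw [Real.dist_eq, abs_of_pos] <;> linarith)).le
    · obtain ⟨δ, hδ, hδU⟩ := hUε (ε / 2) (by positivity)
      obtain ⟨r, hr, hrb⟩ := Metric.continuousOn_iff.1 hl x hx (ε / 2) (by positivity)
      simp only [Real.dist_eq] at hrb
      by_cases hk : ∃ k ∈ K, x < k ∧ k < x + min δ r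
      · obtain ⟨k, hkK, hxk, hkr⟩ := hk
        have h1 := hkr.trans_le (add_le_add_right (min_le_left _ _) x)
        have h2 := hkr.trans_le (add_le_add_right (min_le_right _ _) x)
        refine ⟨k - x, sub_pos.2 hxk, fun z hz hxz hzr => ?_⟩
        by_cases hzK : z ∈ K
        · rw [huK z hzK]
          linarith [hrb z hzK (by rw [abs_of_pos] <;> linarith)]
        · obtain ⟨c, d, hcd, hzI⟩ := hK.exists_isGap ha hb hz hzK
          have hxc := hcd.le_left hx (hxz.trans hzI.2)
          have hdk := hcd.right_le hkK (by linarith [hzI.1])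
          have h3 := hδU c d hcd (by linarith) z ⟨hzI.1.le, hzI.2.le⟩
          have h4 := hrb c hcd.left_mem (by rw [abs_of_nonneg] <;> linarith [hzI.1])
          rw [hugap z c d hcd hzI]
          linarith [abs_sub_le (U c d z) (l c) (l x)]
      · refine ⟨min δ r, by positivity, fun z hz hxz hzr => ?_⟩
        exfalso
        by_cases hzK : z ∈ K
        · exact hk ⟨z, hzK, hxz, hzr⟩
        · obtain ⟨c, d, hcd, hzI⟩ := hK.exists_isGap ha hb hz hzK
          have hxc := hcd.le_left hx (hxz.trans hzI.2)
          rcases hxc.eq_or_lt with rfl | hxc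
          · exact hg ⟨d, hcd⟩
          · exact hk ⟨c, hcd.left_mem, hxc, hzI.1.trans hzr⟩
  have hleft : ∀ x ∈ K, ∀ ε > 0, ∃ r > 0, ∀ z ∈ Icc a b, z < x → x - r < z →
      |u z - l x| ≤ ε := by
    intro x hx ε hε
    by_cases hg : ∃ c, IsGap_s1 K c x
    · obtain ⟨c, hg⟩ := hg
      obtain ⟨r, hr, hrb⟩ := Metric.continuous_iff.1 (hUf c x hg).1.continuous x ε hε
      refine ⟨min r (x - c), lt_min hr (sub_pos.2 hg.lt), fun z _ hxz hzr => ?_⟩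
      have h1 := (sub_le_sub_left (min_le_left r (x - c)) x).trans_lt hzr
      have h2 := (sub_le_sub_left (min_le_right r (x - c)) x).trans_lt hzr
      rw [heq c x hg ⟨by linarith, hxz.le⟩, ← (hUf c x hg).1.right]
      exact (hrb z (by rw [Real.dist_eq, abs_of_neg] <;> linarith)).le
    · obtain ⟨δ, hδ, hδU⟩ := hUε (ε / 3) (by positivity)
      obtain ⟨r, hr, hrb⟩ := Metric.continuousOn_iff.1 hl x hx (ε / 3) (by positivity)
      simp only [Real.dist_eq] at hrb
      by_cases hk : ∃ k ∈ K, k < x ∧ x - min δ r < k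
      · obtain ⟨k, hkK, hxk, hkr⟩ := hk
        have h1 := (sub_le_sub_left (min_le_left δ r) x).trans_lt hkr
        have h2 := (sub_le_sub_left (min_le_right δ r) x).trans_lt hkr
        refine ⟨x - k, sub_pos.2 hxk, fun z hz hxz hzr => ?_⟩
        by_cases hzK : z ∈ K
        · rw [huK z hzK]
          linarith [hrb z hzK (by rw [abs_of_neg] <;> linarith)]
        · obtain ⟨c, d, hcd, hzI⟩ := hK.exists_isGap ha hb hz hzK
          have hxd := hcd.right_le hx (hzI.1.trans hxz)
          have hkc := hcd.le_left hkK (by linarith [hzI.2])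
          have h3 := hδU c d hcd (by linarith) z ⟨hzI.1.le, hzI.2.le⟩
          have h4 := hrb c hcd.left_mem (by rw [abs_of_neg] <;> linarith [hzI.1])
          rw [hugap z c d hcd hzI]
          linarith [abs_sub_le (U c d z) (l c) (l x)]
      · refine ⟨min δ r, by positivity, fun z hz hxz hzr => ?_⟩
        exfalso
        by_cases hzK : z ∈ K
        · exact hk ⟨z, hzK, hxz, hzr⟩
        · obtain ⟨c, d, hcd, hzI⟩ := hK.exists_isGap ha hb hz hzK
          have hxd := hcd.right_le hx (hzI.1.trans hxz)
          rcases hxd.eq_or_lt with rfl | hxd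
          · exact hg ⟨c, hcd⟩
          · exact hk ⟨d, hcd.right_mem, hxd, hzr.trans hzI.2⟩
  refine ⟨u, fun x hx => ?_, fun x hx => ?_, huK, fun c d hg => ⟨U c d, (hUf c d hg).1, heq c d hg⟩⟩
  · by_cases hxK : x ∈ K
    · rw [Metric.continuousWithinAt_iff]
      intro ε hε
      obtain ⟨r, hr, hr'⟩ := hright x hxK (ε / 2) (by positivity)
      obtain ⟨s, hs, hs'⟩ := hleft x hxK (ε / 2) (by positivity)
      refine ⟨min r s, by positivity, fun {z} hz hzx => ?_⟩
      rw [Real.dist_eq] at hzx ⊢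
      have h1 := abs_lt.1 (hzx.trans_le (min_le_left _ _))
      have h2 := abs_lt.1 (hzx.trans_le (min_le_right _ _))
      rw [huK x hxK]
      rcases lt_trichotomy z x with h | rfl | h
      · linarith [hs' z hz h (by linarith)]
      · rw [huK z hxK]; simpa using hε
      · linarith [hr' z hz h (by linarith)]
    · obtain ⟨c, d, hg, hxI⟩ := hK.exists_isGap ha hb hx hxK
      have : ContinuousAt u x := by
        refine (hUf c d hg).1.continuous.continuousAt.congr ?_
        filter_upwards [Ioo_mem_nhds hxI.1 hxI.2] with z hz using (hugap z c d hg hz).symm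
      exact this.continuousWithinAt
  · by_cases hxK : x ∈ K
    · rw [huK x hxK]; exact hl0 x hxK
    · obtain ⟨c, d, hg, hxI⟩ := hK.exists_isGap ha hb hx hxK
      rw [hugap x c d hg hxI]
      exact (hUf c d hg).1.nonneg x ⟨hxI.1.le, hxI.2.le⟩

/-- A Whitney extension theorem for convex functions of class `C²` on the line, in which the
extension over the gaps is given. -/
theorem exists_convex_contDiff_two_extension {K : Set ℝ} (hK : IsClosed K) {a b : ℝ}
    (ha : a ∈ K) (hb : b ∈ K) (hKab : K ⊆ Icc a b) {f h l : ℝ → ℝ}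
    (hl : ContinuousOn l K) (hl0 : ∀ x ∈ K, 0 ≤ l x)
    (hf : ∀ x ∈ K, HasDerivWithinAt f (h x) K x) (hh : ∀ x ∈ K, HasDerivWithinAt h (l x) K x)
    (hU : ∀ c d, IsGap_s1 K c d → ∃ u, IsGapFill f h l c d u)
    (hV : ∀ ε > 0, ∃ δ > 0, ∀ c d, IsGap_s1 K c d → d - c < δ →
      ∃ u, IsGapFill f h l c d u ∧ ∀ x ∈ Icc c d, |u x - l c| ≤ ε) :
    ∃ g : ℝ → ℝ, ContDiff ℝ 2 g ∧ ConvexOn ℝ univ g ∧ EqOn g f K := by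
  obtain ⟨u, huc, hu0, huK, hugap⟩ := exists_continuousOn_of_isGapFill hK ha hb hl hl0 hU hV
  have hab : a ≤ b := (hKab ha).2
  set v : ℝ → ℝ := IccExtend hab ((Icc a b).domRestrict u) with hv
  have hvc : Continuous v := (continuousOn_iff_continuous_domRestrict.1 huc).Icc_extend'
  have hvu : EqOn v u (Icc a b) := fun x hx => by
    rw [hv, IccExtend_of_mem hab _ hx, domRestrict_apply]
  have hv0 : ∀ x, 0 ≤ v x := fun x => hu0 _ (projIcc a b hab x).2
  have hvi : ∀ x y, IntervalIntegrable v volume x y := fun x y => hvc.intervalIntegrable x y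
  set H : ℝ → ℝ := fun x => h a + ∫ t in a..x, v t with hH
  have hHd : ∀ x, HasDerivAt H (v x) x := fun x =>
    (intervalIntegral.integral_hasDerivAt_right (hvi a x)
      (hvc.stronglyMeasurableAtFilter _ _) hvc.continuousAt).const_add _
  have hHc : Continuous H := continuous_iff_continuousAt.2 fun x => (hHd x).continuousAt
  have hHi : ∀ x y, IntervalIntegrable H volume x y := fun x y => hHc.intervalIntegrable x y
  set G : ℝ → ℝ := fun x => f a + ∫ t in a..x, H t with hG
  have hGd : ∀ x, HasDerivAt G (H x) x := fun x =>
    (intervalIntegral.integral_hasDerivAt_right (hHi a x)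
      (hHc.stronglyMeasurableAtFilter _ _) hHc.continuousAt).const_add _
  have hHsub : ∀ x y, H y - H x = ∫ t in x..y, v t := fun x y => by
    rw [← intervalIntegral.integral_interval_sub_left (hvi a y) (hvi a x)]; simp [hH]
  have hGsub : ∀ x y, G y - G x = ∫ t in x..y, H t := fun x y => by
    rw [← intervalIntegral.integral_interval_sub_left (hHi a y) (hHi a x)]; simp [hG]
  have hvgap : ∀ c d, IsGap_s1 K c d → ∃ w, IsGapFill f h l c d w ∧ EqOn v w (uIcc c d) := by
    intro c d hg
    obtain ⟨w, hw, huw⟩ := hugap c d hg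
    refine ⟨w, hw, fun x hx => ?_⟩
    rw [uIcc_of_le hg.lt.le] at hx
    rw [hvu ⟨(hKab hg.left_mem).1.trans hx.1, hx.2.trans (hKab hg.right_mem).2⟩, huw hx]
  have hHK : ∀ x ∈ K, H x = h x := by
    have := eq_of_hasDerivWithinAt_zero_of_isGap hK ha hb hKab (e := fun x => H x - h x)
      (fun x hx => by
        have := (hHd x).hasDerivWithinAt.sub (hh x hx)
        rwa [hvu (hKab hx), huK x hx, sub_self] at this)
      (fun c d hg => by
        obtain ⟨w, hw, hvw⟩ := hvgap c d hg
        have h1 := hHsub c d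
        rw [intervalIntegral.integral_congr hvw, hw.integral] at h1
        linarith)
    intro x hx
    have h1 := this x hx
    simp only [hH, intervalIntegral.integral_same] at h1 ⊢
    linarith
  have hGK : ∀ x ∈ K, G x = f x := by
    have := eq_of_hasDerivWithinAt_zero_of_isGap hK ha hb hKab (e := fun x => G x - f x)
      (fun x hx => by
        have := (hGd x).hasDerivWithinAt.sub (hf x hx)
        rwa [hHK x hx, sub_self] at this)
      (fun c d hg => by
        obtain ⟨w, hw, hvw⟩ := hvgap c d hg
        have h1 := hGsub c d
        have h2 := intervalIntegral.integral_mul_deriv_eq_deriv_mul (a := c) (b := d)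
          (u := fun t => d - t) (u' := fun _ => -1) (v := H) (v' := v)
          (fun x _ => by simpa using (hasDerivAt_id x).const_sub d) (fun x _ => hHd x)
          (by simp) (hvi c d)
        have h3 : ∫ t in c..d, (d - t) * v t = ∫ t in c..d, (d - t) * w t :=
          intervalIntegral.integral_congr fun t ht => by simp only [hvw ht]
        rw [h3, hw.moment, hHK c hg.left_mem] at h2
        simp only [neg_mul, one_mul, intervalIntegral.integral_neg] at h2
        linarith)
    intro x hx
    have h1 := this x hx
    simp only [hG, intervalIntegral.integral_same] at h1 ⊢
    linarith
  have hdG : deriv G = H := funext fun x => (hGd x).deriv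
  have hdH : deriv H = v := funext fun x => (hHd x).deriv
  have hH1 : ContDiff ℝ 1 H :=
    contDiff_one_iff_deriv.2 ⟨fun x => (hHd x).differentiableAt, hdH ▸ hvc⟩
  refine ⟨G, ?_, ?_, hGK⟩
  · rw [show (2 : WithTop ℕ∞) = 1 + 1 by norm_num, contDiff_succ_iff_deriv, hdG]
    exact ⟨fun x => (hGd x).differentiableAt, by simp, hH1⟩
  · refine convexOn_univ_of_deriv2_nonneg (fun x => (hGd x).differentiableAt) ?_ ?_
    · rw [hdG]; exact fun x => (hHd x).differentiableAt
    · intro x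
      simp only [Function.iterate_succ, Function.iterate_zero, Function.comp, id, hdG, hdH]
      exact hv0 x

lemma exists_cap {c d y p : ℝ} (hp : 0 < p) (hc : c ≤ y - p) (hd : y + p ≤ d) :
    ∃ φ : ℝ → ℝ, Continuous φ ∧ (∀ x, 0 ≤ φ x) ∧ (∀ x, φ x ≤ p ^ 2) ∧ φ c = 0 ∧ φ d = 0 ∧
      ∫ t in c..d, φ t = 4 / 3 * p ^ 3 ∧
      ∫ t in c..d, (d - t) * φ t = (d - y) * (4 / 3 * p ^ 3) := by
  set φ : ℝ → ℝ := fun x => max 0 (p ^ 2 - (x - y) ^ 2) with hφ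
  have hφc : Continuous φ := by fun_prop
  have hout1 : ∀ x, x ≤ y - p → φ x = 0 := fun x hx => max_eq_left (by nlinarith)
  have hout2 : ∀ x, y + p ≤ x → φ x = 0 := fun x hx => max_eq_left (by nlinarith)
  have hin : ∀ x ∈ Icc (y - p) (y + p), φ x = p ^ 2 - (x - y) ^ 2 := fun x hx =>
    max_eq_right (by nlinarith [hx.1, hx.2])
  have hsplit : ∀ s : ℝ → ℝ, Continuous s → ∫ t in c..d, s t * φ t =
      ∫ t in (y - p)..(y + p), s t * (p ^ 2 - (t - y) ^ 2) := by
    intro s hs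
    have hi : ∀ x z, IntervalIntegrable (fun t => s t * φ t) volume x z :=
      fun x z => (hs.mul hφc).intervalIntegrable x z
    rw [← intervalIntegral.integral_add_adjacent_intervals (hi c (y - p)) (hi _ d),
      ← intervalIntegral.integral_add_adjacent_intervals (hi (y - p) (y + p)) (hi _ d)]
    have h1 : ∫ t in c..(y - p), s t * φ t = 0 := by
      rw [intervalIntegral.integral_congr (g := fun _ => 0), intervalIntegral.integral_zero]
      intro t ht
      rw [uIcc_of_le hc] at ht
      simp [hout1 t ht.2]
    have h2 : ∫ t in (y + p)..d, s t * φ t = 0 := by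
      rw [intervalIntegral.integral_congr (g := fun _ => 0), intervalIntegral.integral_zero]
      intro t ht
      rw [uIcc_of_le hd] at ht
      simp [hout2 t ht.1]
    rw [h1, h2, zero_add, add_zero]
    refine intervalIntegral.integral_congr fun t ht => ?_
    rw [uIcc_of_le (by linarith)] at ht
    simp only [hin t ht]
  refine ⟨φ, hφc, fun x => le_max_left _ _, fun x => max_le (by positivity)
    (by nlinarith [sq_nonneg (x - y)]), hout1 c hc, hout2 d hd, ?_, ?_⟩
  · have h1 := hsplit (fun _ => 1) continuous_const
    simp only [one_mul] at h1
    rw [h1, intervalIntegral.integral_eq_sub_of_hasDerivAt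
      (f := fun t => p ^ 2 * t - (t - y) ^ 3 / 3)]
    · ring
    · intro t _
      have := ((hasDerivAt_id t).const_mul (p ^ 2)).sub
        ((((hasDerivAt_id t).sub_const y).pow 3).div_const 3)
      refine this.congr_deriv ?_
      simp
    · exact Continuous.intervalIntegrable (by fun_prop) _ _
  · rw [hsplit (fun t => d - t) (by fun_prop), intervalIntegral.integral_eq_sub_of_hasDerivAt
      (f := fun t => (d - y) * (p ^ 2 * t - (t - y) ^ 3 / 3) - p ^ 2 * (t - y) ^ 2 / 2 +
        (t - y) ^ 4 / 4)]
    · ring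
    · intro t _
      have h0 := (hasDerivAt_id t).sub_const y
      have := (((((hasDerivAt_id t).const_mul (p ^ 2)).sub ((h0.pow 3).div_const 3)).const_mul
        (d - y)).sub (((h0.pow 2).const_mul (p ^ 2)).div_const 2)).add ((h0.pow 4).div_const 4)
      refine this.congr_deriv ?_
      simp
      ring
    · exact Continuous.intervalIntegrable (by fun_prop) _ _

lemma exists_boundary_layer {c d A A₀ A₁ η : ℝ} (hcd : c < d) (hA₀ : 0 ≤ A₀) (hA₀A : A₀ ≤ A)
    (hA₁ : 0 ≤ A₁) (hA₁A : A₁ ≤ A) (hη : 0 < η) :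
    ∃ w : ℝ → ℝ, Continuous w ∧ w c = A₀ ∧ w d = A₁ ∧ (∀ x ∈ Icc c d, 0 ≤ w x) ∧
      (∀ x ∈ Icc c d, w x ≤ 2 * A) ∧ ∫ t in c..d, w t ≤ η := by
  have hL : 0 < d - c := sub_pos.2 hcd
  obtain ⟨N, hN⟩ := exists_nat_gt (2 * A * (d - c) / η)
  rw [div_lt_iff₀ hη] at hN
  refine ⟨fun x => A₀ * ((d - x) / (d - c)) ^ (N + 1) + A₁ * ((x - c) / (d - c)) ^ (N + 1),
    by fun_prop, by simp [hL.ne'], by simp [hL.ne'], fun x hx => ?_, fun x hx => ?_, ?_⟩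
  · have h1 : 0 ≤ d - x := sub_nonneg.2 hx.2
    have h2 : 0 ≤ x - c := sub_nonneg.2 hx.1
    positivity
  · have h1 : 0 ≤ d - x := sub_nonneg.2 hx.2
    have h2 : 0 ≤ x - c := sub_nonneg.2 hx.1
    have h3 : ((d - x) / (d - c)) ^ (N + 1) ≤ 1 :=
      pow_le_one₀ (by positivity) ((div_le_one hL).2 (by linarith))
    have h4 : ((x - c) / (d - c)) ^ (N + 1) ≤ 1 :=
      pow_le_one₀ (by positivity) ((div_le_one hL).2 (by linarith))
    nlinarith
  · rw [intervalIntegral.integral_eq_sub_of_hasDerivAt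
      (f := fun x => -(A₀ * ((d - c) / (N + 2) * ((d - x) / (d - c)) ^ (N + 2))) +
        A₁ * ((d - c) / (N + 2) * ((x - c) / (d - c)) ^ (N + 2)))]
    · have : (A₀ + A₁) * (d - c) / (N + 2) ≤ η := by
        rw [div_le_iff₀ (by positivity)]
        nlinarith
      simp only [sub_self, zero_div, div_self hL.ne', one_pow]
      rw [zero_pow (by omega)]
      calc _ = (A₀ + A₁) * (d - c) / (N + 2) := by ring
        _ ≤ η := this
    · intro x _
      have h1 := ((((((hasDerivAt_id x).const_sub d).div_const (d - c)).pow (N + 2)).const_mul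
        ((d - c) / (N + 2))).const_mul A₀).neg
      have h2 := (((((hasDerivAt_id x).sub_const c).div_const (d - c)).pow (N + 2)).const_mul
        ((d - c) / (N + 2))).const_mul A₁
      refine (h1.add h2).congr_deriv ?_
      have : (N : ℝ) + 2 ≠ 0 := by positivity
      simp
      field_simp
    · exact Continuous.intervalIntegrable (by fun_prop) _ _

/-- A gap can be filled by a function between prescribed bounds as soon as the mass and the first
moment of the excess over the lower bound are not too concentrated. -/
lemma exists_isGapFill_of_moments {f h l : ℝ → ℝ} {c d lo A M n₀ n₁ : ℝ} (hcd : c < d)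
    (hlo : 0 ≤ lo) (hlc : lo ≤ l c) (hlcA : l c ≤ lo + A) (hld : lo ≤ l d) (hldA : l d ≤ lo + A)
    (hn₀ : n₀ = h d - h c - lo * (d - c))
    (hn₁ : n₁ = f d - f c - h c * (d - c) - lo * (d - c) ^ 2 / 2)
    (hM : 0 < M) (h0 : 0 < n₀) (h1 : 3 / 4 * n₀ ^ 2 < M * n₁)
    (h2 : 3 / 4 * n₀ ^ 2 < M * (n₀ * (d - c) - n₁)) :
    ∃ u, IsGapFill f h l c d u ∧ ∀ x ∈ Icc c d, lo ≤ u x ∧ u x ≤ lo + 2 * A + M := by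
  set L := d - c with hL
  have hL0 : 0 < L := sub_pos.2 hcd
  set κ := 3 / 4 * n₀ ^ 2 / M with hκ
  have hκ0 : 0 < κ := by positivity
  have h1' : κ < n₁ := by rw [hκ, div_lt_iff₀ hM]; linarith
  have h2' : κ < n₀ * L - n₁ := by rw [hκ, div_lt_iff₀ hM]; linarith
  set μ := min (n₁ - κ) (n₀ * L - n₁ - κ)
  have hμ : 0 < μ := lt_min (by linarith) (by linarith)
  obtain ⟨w, hwc, hwl, hwr, hw0, hwA, hwη⟩ := exists_boundary_layer (A := A) (A₀ := l c - lo)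
    (A₁ := l d - lo) (η := μ / L) hcd (by linarith) (by linarith) (by linarith) (by linarith)
    (by positivity)
  set σ₀ := ∫ t in c..d, w t
  set σ₁ := ∫ t in c..d, (d - t) * w t
  have hσ₁ : 0 ≤ σ₁ := intervalIntegral.integral_nonneg hcd.le fun t ht =>
    mul_nonneg (sub_nonneg.2 ht.2) (hw0 t ht)
  have hσ₀ : 0 ≤ σ₀ := intervalIntegral.integral_nonneg hcd.le fun t ht => hw0 t ht
  have hσ₁' : σ₁ ≤ L * σ₀ := by
    rw [← intervalIntegral.integral_const_mul]
    refine intervalIntegral.integral_mono_on hcd.le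
      (Continuous.intervalIntegrable (by fun_prop) _ _)
      (Continuous.intervalIntegrable (by fun_prop) _ _) fun t ht => ?_
    exact mul_le_mul_of_nonneg_right (by linarith [ht.1]) (hw0 t ht)
  have hσμ : L * σ₀ ≤ μ := by rw [le_div_iff₀ hL0] at hwη; linarith
  have hμ1 : μ ≤ n₁ - κ := min_le_left _ _
  have hμ2 : μ ≤ n₀ * L - n₁ - κ := min_le_right _ _
  set N₀ := n₀ - σ₀ with hN₀
  set N₁ := n₁ - σ₁ with hN₁
  have hN₁κ : κ ≤ N₁ := by linarith
  have hN₁κ' : κ ≤ N₀ * L - N₁ := by rw [hN₀, hN₁, sub_mul]; linarith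
  have hN₀0 : 0 < N₀ := by
    have : 0 < N₀ * L := by linarith
    exact pos_of_mul_pos_left this hL0.le
  set p := min (N₁ / N₀) (L - N₁ / N₀) with hp
  have hpκ : κ / N₀ ≤ p := by
    refine le_min (by gcongr) ?_
    rw [div_le_iff₀ hN₀0, sub_mul, div_mul_cancel₀ _ hN₀0.ne']
    linarith
  have hp0 : 0 < p := lt_of_lt_of_le (by positivity) hpκ
  obtain ⟨φ, hφc, hφ0, hφp, hφl, hφr, hφi, hφm⟩ := exists_cap (c := c) (d := d)
    (y := d - N₁ / N₀) (p := p) hp0 (by linarith [min_le_right (N₁ / N₀) (L - N₁ / N₀)])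
    (by linarith [min_le_left (N₁ / N₀) (L - N₁ / N₀)])
  set k := N₀ / (4 / 3 * p ^ 3) with hk
  have hk0 : 0 < k := by positivity
  have hkp : k * p ^ 2 ≤ M := by
    have e1 : k * p ^ 2 = 3 / 4 * N₀ / p := by rw [hk]; field_simp
    rw [e1, div_le_iff₀ hp0]
    calc 3 / 4 * N₀ = M * (3 / 4 * N₀ ^ 2 / M / N₀) := by field_simp
      _ ≤ M * (κ / N₀) := by
        rw [hκ]
        have : N₀ ≤ n₀ := by linarith
        gcongr
      _ ≤ M * p := by gcongr
  refine ⟨fun x => lo + w x + k * φ x, ⟨by fun_prop, fun x hx => ?_, ?_, ?_, ?_, ?_⟩,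
    fun x hx => ⟨?_, ?_⟩⟩
  · have := hw0 x hx
    have := hφ0 x
    positivity
  · simp [hwl, hφl]
  · simp [hwr, hφr]
  · rw [intervalIntegral.integral_add (Continuous.intervalIntegrable (by fun_prop) _ _)
        (Continuous.intervalIntegrable (by fun_prop) _ _),
      intervalIntegral.integral_add (Continuous.intervalIntegrable (by fun_prop) _ _)
        (Continuous.intervalIntegrable (by fun_prop) _ _),
      intervalIntegral.integral_const_mul, hφi, intervalIntegral.integral_const, smul_eq_mul, hk,
      div_mul_cancel₀ _ (by positivity)]
    change (d - c) * lo + σ₀ + N₀ = _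
    rw [hN₀, hn₀, hL]
    ring
  · have e1 : ∀ t, (d - t) * (lo + w t + k * φ t) =
        lo * (d - t) + (d - t) * w t + k * ((d - t) * φ t) := fun t => by ring
    have e2 : ∫ t in c..d, (d - t) = L ^ 2 / 2 := by
      rw [intervalIntegral.integral_comp_sub_left (fun t => t) d, integral_id]
      ring
    simp only [e1]
    rw [intervalIntegral.integral_add (Continuous.intervalIntegrable (by fun_prop) _ _)
        (Continuous.intervalIntegrable (by fun_prop) _ _),
      intervalIntegral.integral_add (Continuous.intervalIntegrable (by fun_prop) _ _)
        (Continuous.intervalIntegrable (by fun_prop) _ _),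
      intervalIntegral.integral_const_mul, intervalIntegral.integral_const_mul, hφm, e2, hk]
    change lo * (L ^ 2 / 2) + σ₁ + _ = _
    have e3 : N₀ / (4 / 3 * p ^ 3) * ((d - (d - N₁ / N₀)) * (4 / 3 * p ^ 3)) = N₁ := by
      field_simp
      ring
    rw [e3, hN₁, hn₁]
    ring
  · have := hw0 x hx
    have := mul_nonneg hk0.le (hφ0 x)
    linarith
  · have := hwA x hx
    have := mul_le_mul_of_nonneg_left (hφp x) hk0.le
    linarith

lemma exists_isGapFill_of_pos {f h l : ℝ → ℝ} {c d : ℝ} (hcd : c < d) (hlc : 0 ≤ l c)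
    (hld : 0 ≤ l d) (hc : 0 < f d - f c - h c * (d - c)) (hd : 0 < f c - f d - h d * (c - d)) :
    ∃ u, IsGapFill f h l c d u := by
  have hL : 0 < d - c := sub_pos.2 hcd
  set n₀ := h d - h c with hn₀
  set n₁ := f d - f c - h c * (d - c) with hn₁
  have hd' : 0 < n₀ * (d - c) - n₁ := by rw [hn₀, hn₁]; linarith
  have h0 : 0 < n₀ := pos_of_mul_pos_left (show 0 < n₀ * (d - c) by linarith) hL.le
  have e1 : 0 < n₀ ^ 2 / n₁ := by positivity
  have e2 : 0 < n₀ ^ 2 / (n₀ * (d - c) - n₁) := by positivity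
  have e3 : n₀ ^ 2 / n₁ * n₁ = n₀ ^ 2 := div_mul_cancel₀ _ hc.ne'
  have e4 : n₀ ^ 2 / (n₀ * (d - c) - n₁) * (n₀ * (d - c) - n₁) = n₀ ^ 2 :=
    div_mul_cancel₀ _ hd'.ne'
  obtain ⟨u, hu, -⟩ := exists_isGapFill_of_moments (f := f) (h := h) (l := l) (lo := 0)
    (A := max (l c) (l d)) (n₀ := n₀) (n₁ := n₁)
    (M := n₀ ^ 2 / n₁ + n₀ ^ 2 / (n₀ * (d - c) - n₁)) hcd le_rfl hlc (by simp) hld (by simp)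
    (by rw [hn₀]; ring) (by rw [hn₁]; ring) (by positivity) h0
    (by nlinarith [mul_pos e2 hc, pow_pos h0 2]) (by nlinarith [mul_pos e1 hd', pow_pos h0 2])
  exact ⟨u, hu⟩

lemma exists_isGapFill_of_taylor {f h l : ℝ → ℝ} {c d ε : ℝ} (hcd : c < d) (hε : 0 < ε)
    (hlc : 0 ≤ l c) (hld : 0 ≤ l d) (hl : |l d - l c| ≤ ε)
    (hc : 0 < f d - f c - h c * (d - c)) (hd : 0 < f c - f d - h d * (c - d))
    (hSc : ∀ z ∈ Icc c d, f c + h c * (z - c) ≤ f z)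
    (hSd : ∀ z ∈ Icc c d, f d + h d * (z - d) ≤ f z)
    (hTc : ∀ z ∈ Icc c d, |f z - f c - h c * (z - c) - l c * (z - c) ^ 2 / 2| ≤
      ε * (z - c) ^ 2 / 2)
    (hTd : ∀ z ∈ Icc c d, |f z - f d - h d * (z - d) - l d * (z - d) ^ 2 / 2| ≤
      ε * (z - d) ^ 2 / 2) :
    ∃ u, IsGapFill f h l c d u ∧ ∀ x ∈ Icc c d, |u x - l c| ≤ 20 * ε := by
  have hL : 0 < d - c := sub_pos.2 hcd
  obtain ⟨hl1, hl2⟩ := abs_le.1 hl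
  set lo := max (l c - 3 * ε) 0 with hlo
  have hlo1 : l c - 3 * ε ≤ lo := le_max_left _ _
  have hlo0 : 0 ≤ lo := le_max_right _ _
  have hlo2 : lo ≤ l c := max_le (by linarith) hlc
  have hlo3 : lo ≤ l d := max_le (by linarith) hld
  have hLc : ∀ z ∈ Icc c d, lo * (z - c) ^ 2 / 2 ≤ f z - f c - h c * (z - c) := by
    intro z hz
    rcases max_choice (l c - 3 * ε) 0 with h | h <;> rw [hlo, h]
    · nlinarith [(abs_le.1 (hTc z hz)).1, mul_nonneg hε.le (sq_nonneg (z - c))]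
    · linarith [hSc z hz]
  have hLd : ∀ z ∈ Icc c d, lo * (z - d) ^ 2 / 2 ≤ f z - f d - h d * (z - d) := by
    intro z hz
    rcases max_choice (l c - 3 * ε) 0 with h | h <;> rw [hlo, h]
    · nlinarith [(abs_le.1 (hTd z hz)).1, mul_nonneg hε.le (sq_nonneg (z - d)),
        mul_nonneg (show 0 ≤ l d - l c + ε by linarith) (sq_nonneg (z - d))]
    · linarith [hSd z hz]
  have hUc : ∀ z ∈ Icc c d, f z - f c - h c * (z - c) ≤ (lo + 5 * ε) * (z - c) ^ 2 / 2 := by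
    intro z hz
    nlinarith [(abs_le.1 (hTc z hz)).2,
      mul_nonneg (show 0 ≤ lo + 5 * ε - (l c + ε) by linarith) (sq_nonneg (z - c))]
  have hUd : ∀ z ∈ Icc c d, f z - f d - h d * (z - d) ≤ (lo + 5 * ε) * (z - d) ^ 2 / 2 := by
    intro z hz
    nlinarith [(abs_le.1 (hTd z hz)).2,
      mul_nonneg (show 0 ≤ lo + 5 * ε - (l d + ε) by linarith) (sq_nonneg (z - d))]
  set n₀ := h d - h c - lo * (d - c) with hn₀
  set n₁ := f d - f c - h c * (d - c) - lo * (d - c) ^ 2 / 2 with hn₁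
  have hcI := left_mem_Icc.2 hcd.le
  have hdI := right_mem_Icc.2 hcd.le
  have hεL : 0 < ε * (d - c) ^ 2 := by positivity
  have hn₁' : n₀ * (d - c) - n₁ = f c - f d - h d * (c - d) - lo * (c - d) ^ 2 / 2 := by
    rw [hn₀, hn₁]; ring
  have h1 : 0 < n₁ := by
    rw [hn₁]
    rcases max_choice (l c - 3 * ε) 0 with h | h <;> rw [hlo, h]
    · nlinarith [(abs_le.1 (hTc d hdI)).1]
    · linarith
  have h2 : 0 < n₀ * (d - c) - n₁ := by
    rw [hn₁']
    rcases max_choice (l c - 3 * ε) 0 with h | h <;> rw [hlo, h]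
    · nlinarith [(abs_le.1 (hTd c hcI)).1,
        mul_nonneg (show 0 ≤ l d - l c + ε by linarith) (sq_nonneg (c - d))]
    · linarith
  have h0 : 0 < n₀ := pos_of_mul_pos_left (show 0 < n₀ * (d - c) by linarith) hL.le
  have h0L : n₀ ≤ 5 * ε * (d - c) := by
    have e1 := hUc d hdI
    have e2 := hUd c hcI
    have : n₀ * (d - c) ≤ 5 * ε * (d - c) * (d - c) := by nlinarith
    exact le_of_mul_le_mul_right this hL
  set s := n₀ / (5 * ε) with hs
  have hs0 : 0 < s := by positivity
  have hsL : s ≤ d - c := by rw [hs, div_le_iff₀ (by positivity)]; linarith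
  have hsε : n₀ = 5 * ε * s := by rw [hs]; field_simp
  have hc1 : n₀ ^ 2 ≤ 10 * ε * n₁ := by
    have hz : d - s ∈ Icc c d := ⟨by linarith, by linarith⟩
    have e1 := hLc _ hz
    have e2 := hUd _ hz
    have e3 : n₀ * s - 5 * ε * s ^ 2 / 2 ≤ n₁ := by rw [hn₀, hn₁]; linarith
    have e4 : 5 * ε * s ^ 2 / 2 ≤ n₁ := by
      calc 5 * ε * s ^ 2 / 2 = n₀ * s - 5 * ε * s ^ 2 / 2 := by rw [hsε]; ring
        _ ≤ _ := e3
    calc n₀ ^ 2 = 10 * ε * (5 * ε * s ^ 2 / 2) := by rw [hsε]; ring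
      _ ≤ _ := by gcongr
  have hc2 : n₀ ^ 2 ≤ 10 * ε * (n₀ * (d - c) - n₁) := by
    have hz : c + s ∈ Icc c d := ⟨by linarith, by linarith⟩
    have e1 := hLd _ hz
    have e2 := hUc _ hz
    have e3 : n₀ * s - 5 * ε * s ^ 2 / 2 ≤ n₀ * (d - c) - n₁ := by rw [hn₁', hn₀]; linarith
    have e4 : 5 * ε * s ^ 2 / 2 ≤ n₀ * (d - c) - n₁ := by
      calc 5 * ε * s ^ 2 / 2 = n₀ * s - 5 * ε * s ^ 2 / 2 := by rw [hsε]; ring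
        _ ≤ _ := e3
    calc n₀ ^ 2 = 10 * ε * (5 * ε * s ^ 2 / 2) := by rw [hsε]; ring
      _ ≤ _ := by gcongr
  have hsq : 0 < n₀ ^ 2 := by positivity
  obtain ⟨u, hu, hub⟩ := exists_isGapFill_of_moments (l := l) (A := 4 * ε) (M := 10 * ε) hcd hlo0
    hlo2 (by linarith) hlo3 (by linarith) hn₀ hn₁ (by positivity) h0 (by linarith) (by linarith)
  refine ⟨u, hu, fun x hx => ?_⟩
  have := hub x hx
  exact abs_le.2 ⟨by linarith, by linarith⟩

lemma ConvexOn.eq_zero_of_taylor_of_eq {s : Set ℝ} {f : ℝ → ℝ} (hf : ConvexOn ℝ s f)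
    {x y p q : ℝ} (hx : x ∈ s) (hy : y ∈ s) (hxy : y ≠ x) (hq : 0 ≤ q)
    (heq : f y = f x + p * (y - x))
    (hT : ∀ ε > 0, ∃ δ > 0, ∀ z ∈ s, |z - x| < δ →
      |f z - f x - p * (z - x) - q * (z - x) ^ 2 / 2| ≤ ε * (z - x) ^ 2 / 2) : q = 0 := by
  by_contra hne
  have hq0 : 0 < q := hq.lt_of_ne' hne
  obtain ⟨δ, hδ, h⟩ := hT (q / 2) (by positivity)
  have hyx : 0 < |y - x| := abs_pos.2 (sub_ne_zero.2 hxy)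
  set t := min 1 (δ / 2 / |y - x|) with ht
  have ht0 : 0 < t := by positivity
  have ht1 : t ≤ 1 := min_le_left _ _
  have hz := hf.1 hx hy (sub_nonneg.2 ht1) ht0.le (by ring)
  have hfz := hf.2 hx hy (sub_nonneg.2 ht1) ht0.le (by ring)
  simp only [smul_eq_mul] at hz hfz
  have hzx : (1 - t) * x + t * y - x = t * (y - x) := by ring
  have hlt : |(1 - t) * x + t * y - x| < δ := by
    rw [hzx, abs_mul, abs_of_pos ht0]
    have : t * |y - x| ≤ δ / 2 := by rw [← le_div_iff₀ hyx]; exact min_le_right _ _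
    linarith
  have h1 := (abs_le.1 (h _ hz hlt)).1
  rw [hzx] at h1
  have h2 : 0 < q * (t * (y - x)) ^ 2 := by
    have : y - x ≠ 0 := sub_ne_zero.2 hxy
    positivity
  rw [heq] at hfz
  nlinarith

lemma eq_of_hasDerivAt_of_affine_le {f : ℝ → ℝ} {a b x y p q : ℝ} (hy : y ∈ Ioo a b)
    (hS : ∀ z ∈ Icc a b, f x + p * (z - x) ≤ f z) (heq : f y = f x + p * (y - x))
    (hd : HasDerivAt f q y) : q = p := by
  have h1 : HasDerivAt (fun z => f z - (f x + p * (z - x))) (q - p) y := by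
    refine (hd.sub ((((hasDerivAt_id y).sub_const x).const_mul p).const_add (f x))).congr_deriv ?_
    simp
  have h2 : IsLocalMin (fun z => f z - (f x + p * (z - x))) y := by
    filter_upwards [Icc_mem_nhds hy.1 hy.2] with z hz
    have := hS z hz
    rw [heq]
    linarith
  exact sub_eq_zero.1 (h2.hasDerivAt_eq_zero h1)

lemma isGapFill_zero {f h l : ℝ → ℝ} {c d : ℝ} (hlc : l c = 0) (hld : l d = 0) (hh : h d = h c)
    (hf : f d = f c + h c * (d - c)) : IsGapFill f h l c d 0 where
  continuous := continuous_zero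
  nonneg _ _ := le_rfl
  left := hlc.symm
  right := hld.symm
  integral := by simp [hh]
  moment := by simp [hf]

/-- A convex function on `[a, b]` agrees on a compact set `K ⊆ (a, b)` on which it has a uniform
second-order Taylor expansion, and at the endpoints, with a convex function of class `C²`. -/
theorem ConvexOn.exists_contDiff_two_eqOn_of_taylor {a b : ℝ} {K : Set ℝ} (hK : IsCompact K)
    (hKne : K.Nonempty) (hKab : K ⊆ Ioo a b) {f h l : ℝ → ℝ} (hf : ConvexOn ℝ (Icc a b) f)
    (hl : ContinuousOn l K) (hl0 : ∀ x ∈ K, 0 ≤ l x)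
    (hS : ∀ x ∈ K, ∀ z ∈ Icc a b, f x + h x * (z - x) ≤ f z)
    (hfd : ∀ x ∈ K, HasDerivAt f (h x) x) (hhd : ∀ x ∈ K, HasDerivAt h (l x) x)
    (hT : ∀ ε > 0, ∃ δ > 0, ∀ x ∈ K, ∀ z ∈ Icc a b, |z - x| < δ →
      |f z - f x - h x * (z - x) - l x * (z - x) ^ 2 / 2| ≤ ε * (z - x) ^ 2 / 2) :
    ∃ g : ℝ → ℝ, ContDiff ℝ 2 g ∧ ConvexOn ℝ univ g ∧ EqOn g f K ∧ g a = f a ∧ g b = f b := by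
  classical
  obtain ⟨c₁, hc₁, hc₁min⟩ := hK.exists_isLeast hKne
  obtain ⟨c₂, hc₂, hc₂max⟩ := hK.exists_isGreatest hKne
  have hac₁ := (hKab hc₁).1
  have hcb₂ := (hKab hc₂).2
  have hab : a < b := hac₁.trans (hKab hc₁).2
  have haI : a ∈ Icc a b := left_mem_Icc.2 hab.le
  have hbI : b ∈ Icc a b := right_mem_Icc.2 hab.le
  have hTx : ∀ x ∈ K, ∀ ε > 0, ∃ δ > 0, ∀ z ∈ Icc a b, |z - x| < δ →
      |f z - f x - h x * (z - x) - l x * (z - x) ^ 2 / 2| ≤ ε * (z - x) ^ 2 / 2 :=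
    fun x hx ε hε => (hT ε hε).imp fun δ hδ => ⟨hδ.1, hδ.2 x hx⟩
  set h' : ℝ → ℝ := fun x => if x = a then 2 * ((f c₁ - f a) / (c₁ - a)) - h c₁ else
    if x = b then 2 * ((f b - f c₂) / (b - c₂)) - h c₂ else h x with hh'
  set l' : ℝ → ℝ := fun x => if x = a ∨ x = b then 0 else l x with hl'
  have h'a : h' a = 2 * ((f c₁ - f a) / (c₁ - a)) - h c₁ := by simp [hh']
  have h'b : h' b = 2 * ((f b - f c₂) / (b - c₂)) - h c₂ := by simp [hh', hab.ne']
  have h'K : ∀ x ∈ Ioo a b, h' x = h x := fun x hx => by simp [hh', hx.1.ne', hx.2.ne]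
  have l'a : l' a = 0 := by simp [hl']
  have l'b : l' b = 0 := by simp [hl']
  have l'K : ∀ x ∈ Ioo a b, l' x = l x := fun x hx => by simp [hl', hx.1.ne', hx.2.ne]
  set K' : Set ℝ := insert a (insert b K) with hK'
  have hK'cl : IsClosed K' := ((hK.insert b).insert a).isClosed
  have haK' : a ∈ K' := mem_insert _ _
  have hbK' : b ∈ K' := mem_insert_of_mem _ (mem_insert _ _)
  have hKK' : K ⊆ K' := fun x hx => mem_insert_of_mem _ (mem_insert_of_mem _ hx)
  have hK'K : ∀ x ∈ K', x ∈ Ioo a b → x ∈ K := by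
    rintro x (rfl | rfl | hx) hxI
    exacts [absurd hxI.1 (lt_irrefl _), absurd hxI.2 (lt_irrefl _), hx]
  have hK'I : K' ⊆ Icc a b := by
    rintro x (rfl | rfl | hx)
    exacts [haI, hbI, Ioo_subset_Icc_self (hKab hx)]
  have hna : {a} ∈ 𝓝[K'] a := by
    refine mem_nhdsWithin.2 ⟨Iio c₁, isOpen_Iio, hac₁, ?_⟩
    rintro x ⟨hx, rfl | rfl | hxK⟩
    exacts [rfl, absurd hx (not_lt.2 (hKab hc₁).2.le), absurd hx (not_lt.2 (hc₁min hxK))]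
  have hnb : {b} ∈ 𝓝[K'] b := by
    refine mem_nhdsWithin.2 ⟨Ioi c₂, isOpen_Ioi, hcb₂, ?_⟩
    rintro x ⟨hx, rfl | rfl | hxK⟩
    exacts [absurd hx (not_lt.2 (hKab hc₂).1.le), rfl, absurd hx (not_lt.2 (hc₂max hxK))]
  have hgap : ∀ c d, IsGap_s1 K' c d → (c ∈ K ∧ d ∈ K) ∨ (c = a ∧ d = c₁) ∨ (c = c₂ ∧ d = b) := by
    intro c d hg
    rcases hg.left_mem with rfl | rfl | hcK
    · right; left
      refine ⟨rfl, le_antisymm (hg.right_le (hKK' hc₁) hac₁) ?_⟩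
      rcases hg.right_mem with rfl | rfl | hdK
      exacts [absurd hg.lt (lt_irrefl _), (hKab hc₁).2.le, hc₁min hdK]
    · exact absurd hg.lt (not_lt.2 (hK'I hg.right_mem).2)
    · rcases hg.right_mem with rfl | rfl | hdK
      · exact absurd hg.lt (not_lt.2 (hK'I hg.left_mem).1)
      · right; right
        exact ⟨le_antisymm (hc₂max hcK) (hg.le_left (hKK' hc₂) hcb₂), rfl⟩
      · exact Or.inl ⟨hcK, hdK⟩
  have hdich : ∀ c ∈ K, ∀ d ∈ K, c ≠ d → f d = f c + h c * (d - c) →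
      h d = h c ∧ l c = 0 ∧ l d = 0 := by
    intro c hc d hd hcd heq
    have hcI := Ioo_subset_Icc_self (hKab hc)
    have hdI := Ioo_subset_Icc_self (hKab hd)
    have hh := eq_of_hasDerivAt_of_affine_le (hKab hd) (hS c hc) heq (hfd d hd)
    exact ⟨hh, hf.eq_zero_of_taylor_of_eq hcI hdI hcd.symm (hl0 c hc) heq (hTx c hc),
      hf.eq_zero_of_taylor_of_eq hdI hcI hcd (hl0 d hd) (by rw [heq, hh]; ring) (hTx d hd)⟩
  have hcases : ∀ c ∈ K, ∀ d ∈ K, c < d → IsGapFill f h' l' c d 0 ∧ l' c = 0 ∨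
      (0 < f d - f c - h' c * (d - c) ∧ 0 < f c - f d - h' d * (c - d)) := by
    intro c hc d hd hcd
    have hcI := Ioo_subset_Icc_self (hKab hc)
    have hdI := Ioo_subset_Icc_self (hKab hd)
    rw [h'K c (hKab hc), h'K d (hKab hd), l'K c (hKab hc)]
    by_cases h1 : f d = f c + h c * (d - c)
    · obtain ⟨e1, e2, e3⟩ := hdich c hc d hd hcd.ne h1
      left
      refine ⟨isGapFill_zero ?_ ?_ ?_ ?_, e2⟩
      · rwa [l'K c (hKab hc)]
      · rwa [l'K d (hKab hd)]
      · rwa [h'K c (hKab hc), h'K d (hKab hd)]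
      · rwa [h'K c (hKab hc)]
    by_cases h2 : f c = f d + h d * (c - d)
    · obtain ⟨e1, -, -⟩ := hdich d hd c hc hcd.ne' h2
      exact absurd (by rw [h2, e1]; ring) h1
    · right
      have e1 := (hS c hc d hdI).lt_of_ne' h1
      have e2 := (hS d hd c hcI).lt_of_ne' h2
      exact ⟨by linarith, by linarith⟩
  have hsing : ∀ (φ : ℝ → ℝ) (c x : ℝ), HasDerivWithinAt φ c {x} x := fun φ c x =>
    HasFDerivWithinAt.of_finite (finite_singleton x)
  suffices hext : ∃ g : ℝ → ℝ, ContDiff ℝ 2 g ∧ ConvexOn ℝ univ g ∧ EqOn g f K' by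
    obtain ⟨g, hg, hgc, hgK⟩ := hext
    exact ⟨g, hg, hgc, hgK.mono hKK', hgK haK', hgK hbK'⟩
  refine exists_convex_contDiff_two_extension hK'cl haK' hbK' hK'I (f := f) (h := h') (l := l')
    ?_ ?_ ?_ ?_ ?_ ?_
  · rintro x hxK'
    rcases hxK' with rfl | rfl | hx
    · exact continuousWithinAt_singleton.mono_of_mem_nhdsWithin hna
    · exact continuousWithinAt_singleton.mono_of_mem_nhdsWithin hnb
    · have hnx : K ∈ 𝓝[K'] x := mem_nhdsWithin.2 ⟨Ioo a b, isOpen_Ioo, hKab hx,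
        fun y hy => hK'K y hy.2 hy.1⟩
      exact ((hl x hx).congr (fun y hy => l'K y (hKab hy))
        (l'K x (hKab hx))).mono_of_mem_nhdsWithin hnx
  · rintro x (rfl | rfl | hx)
    · exact l'a.ge
    · exact l'b.ge
    · rw [l'K x (hKab hx)]; exact hl0 x hx
  · rintro x (rfl | rfl | hx)
    · exact (hsing _ _ _).mono_of_mem_nhdsWithin hna
    · exact (hsing _ _ _).mono_of_mem_nhdsWithin hnb
    · rw [h'K x (hKab hx)]; exact (hfd x hx).hasDerivWithinAt
  · rintro x (rfl | rfl | hx)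
    · exact (hsing _ _ _).mono_of_mem_nhdsWithin hna
    · exact (hsing _ _ _).mono_of_mem_nhdsWithin hnb
    · rw [l'K x (hKab hx)]
      refine ((hhd x hx).congr_of_eventuallyEq ?_).hasDerivWithinAt
      filter_upwards [Ioo_mem_nhds (hKab hx).1 (hKab hx).2] with z hz using h'K z hz
  · intro c d hg
    rcases hgap c d hg with ⟨hc, hd⟩ | ⟨rfl, rfl⟩ | ⟨rfl, rfl⟩
    · rcases hcases c hc d hd hg.lt with ⟨h1, -⟩ | ⟨h1, h2⟩
      · exact ⟨0, h1⟩
      · refine exists_isGapFill_of_pos hg.lt ?_ ?_ h1 h2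
        · rw [l'K c (hKab hc)]; exact hl0 c hc
        · rw [l'K d (hKab hd)]; exact hl0 d hd
    · have hne : d - c ≠ 0 := (sub_pos.2 hac₁).ne'
      have e1 : f d - f c - h' c * (d - c) = f c - f d - h' d * (c - d) := by
        rw [h'a, h'K d (hKab hc₁)]
        field_simp
        ring
      rw [h'K d (hKab hc₁)] at e1
      rcases (hS d hc₁ c haI).eq_or_lt with h1 | h1
      · have e2 := hf.eq_zero_of_taylor_of_eq (Ioo_subset_Icc_self (hKab hc₁)) haI hg.lt.ne
          (hl0 d hc₁) h1.symm (hTx d hc₁)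
        have e3 : f d = f c + h' c * (d - c) := by linarith
        refine ⟨0, isGapFill_zero l'a (by rw [l'K d (hKab hc₁), e2]) ?_ e3⟩
        rw [h'K d (hKab hc₁)]
        exact mul_right_cancel₀ hne (by linarith)
      · refine exists_isGapFill_of_pos hg.lt l'a.ge ?_ (by linarith) ?_
        · rw [l'K d (hKab hc₁)]; exact hl0 d hc₁
        · rw [h'K d (hKab hc₁)]; linarith
    · have hne : d - c ≠ 0 := (sub_pos.2 hcb₂).ne'
      have e1 : f d - f c - h' c * (d - c) = f c - f d - h' d * (c - d) := by
        rw [h'b, h'K c (hKab hc₂)]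
        field_simp
        ring
      rw [h'K c (hKab hc₂)] at e1
      rcases (hS c hc₂ d hbI).eq_or_lt with h1 | h1
      · have e2 := hf.eq_zero_of_taylor_of_eq (Ioo_subset_Icc_self (hKab hc₂)) hbI hg.lt.ne'
          (hl0 c hc₂) h1.symm (hTx c hc₂)
        refine ⟨0, isGapFill_zero (by rw [l'K c (hKab hc₂), e2]) l'b ?_ ?_⟩
        · rw [h'K c (hKab hc₂)]
          exact mul_right_cancel₀ hne (by linarith)
        · rw [h'K c (hKab hc₂)]; exact h1.symm
      · refine exists_isGapFill_of_pos hg.lt ?_ l'b.ge ?_ (by linarith)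
        · rw [l'K c (hKab hc₂)]; exact hl0 c hc₂
        · rw [h'K c (hKab hc₂)]; linarith
  · intro ε hε
    obtain ⟨δ₁, hδ₁, hT₁⟩ := hT (ε / 20) (by positivity)
    obtain ⟨δ₂, hδ₂, hl₂⟩ := Metric.uniformContinuousOn_iff.1
      (hK.uniformContinuousOn_of_continuous hl) (ε / 20) (by positivity)
    refine ⟨min (min δ₁ δ₂) (min (c₁ - a) (b - c₂)),
      lt_min (lt_min hδ₁ hδ₂) (lt_min (sub_pos.2 hac₁) (sub_pos.2 hcb₂)), fun c d hg hcd => ?_⟩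
    simp only [lt_min_iff] at hcd
    obtain ⟨⟨hcd1, hcd2⟩, hcd3, hcd4⟩ := hcd
    rcases hgap c d hg with ⟨hc, hd⟩ | ⟨rfl, rfl⟩ | ⟨rfl, rfl⟩
    · rcases hcases c hc d hd hg.lt with ⟨h1, h2⟩ | ⟨h1, h2⟩
      · exact ⟨0, h1, fun x _ => by simp [h2, hε.le]⟩
      · have hcdI : Icc c d ⊆ Icc a b := Icc_subset_Icc (hKab hc).1.le (hKab hd).2.le
        have e1 := l'K c (hKab hc)
        have e2 := l'K d (hKab hd)
        have e3 := h'K c (hKab hc)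
        have e4 := h'K d (hKab hd)
        obtain ⟨u, hu, hub⟩ := exists_isGapFill_of_taylor (f := f) (h := h') (l := l')
          (ε := ε / 20) hg.lt (by positivity) (by rw [e1]; exact hl0 c hc)
          (by rw [e2]; exact hl0 d hd)
          (by
            rw [e1, e2, ← Real.dist_eq]
            refine (hl₂ d hd c hc ?_).le
            rwa [Real.dist_eq, abs_of_pos (sub_pos.2 hg.lt)]) h1 h2
          (fun z hz => by rw [e3]; exact hS c hc z (hcdI hz))
          (fun z hz => by rw [e4]; exact hS d hd z (hcdI hz))
          (fun z hz => by
            rw [e1, e3]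
            refine hT₁ c hc z (hcdI hz) ?_
            rw [abs_of_nonneg (sub_nonneg.2 hz.1)]
            linarith [hz.2])
          (fun z hz => by
            rw [e2, e4]
            refine hT₁ d hd z (hcdI hz) ?_
            rw [abs_of_nonpos (sub_nonpos.2 hz.2)]
            linarith [hz.1])
        exact ⟨u, hu, fun x hx => (hub x hx).trans (by linarith)⟩
    · exact absurd hcd3 (lt_irrefl _)
    · exact absurd hcd4 (lt_irrefl _)

/-- A primitive of a function differentiable at `x` has a second-order Taylor expansion at `x`. -/
theorem taylor_two_of_hasDerivAt {a b x L : ℝ} (hx : x ∈ Ioo a b) {F h : ℝ → ℝ}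
    (hF : Continuous F) (hr : ∀ y ∈ Ioo a b, HasDerivWithinAt F (h y) (Ici y) y)
    (hh : HasDerivAt h L x) {ε : ℝ} (hε : 0 < ε) :
    ∃ δ > 0, ∀ z, |z - x| < δ →
      |F z - F x - h x * (z - x) - L * (z - x) ^ 2 / 2| ≤ ε * (z - x) ^ 2 / 2 := by
  have hbd := (hasDerivAt_iff_isLittleO.1 hh).def hε
  obtain ⟨δ, hδ, hball⟩ := Metric.mem_nhds_iff.1 (inter_mem (Ioo_mem_nhds hx.1 hx.2) hbd)
  refine ⟨δ, hδ, fun z hz => ?_⟩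
  have hmem : ∀ s, |s - x| ≤ |z - x| → s ∈ Ioo a b ∧ |h s - h x - L * (s - x)| ≤ ε * |s - x| := by
    intro s hs
    have h1 := hball (show s ∈ Metric.ball x δ by
      rw [Metric.mem_ball, Real.dist_eq]; exact hs.trans_lt hz)
    refine ⟨h1.1, ?_⟩
    have h2 : ‖h s - h x - (s - x) • L‖ ≤ ε * ‖s - x‖ := h1.2
    rwa [smul_eq_mul, mul_comm (s - x), Real.norm_eq_abs, Real.norm_eq_abs] at h2
  set G : ℝ → ℝ := fun s => F s - F x - h x * (s - x) - L * (s - x) ^ 2 / 2 with hG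
  have hGc : Continuous G := by fun_prop
  have hpoly : ∀ c d s : ℝ, HasDerivAt (fun s => c + d * (s - x) ^ 2 / 2) (d * (s - x)) s := by
    intro c d s
    have h1 := (((((hasDerivAt_id s).sub_const x).pow 2).const_mul d).div_const 2).const_add c
    refine h1.congr_deriv ?_
    simp only [id]; ring
  have hGd : ∀ s ∈ Ioo a b, HasDerivWithinAt G (h s - h x - L * (s - x)) (Ici s) s := by
    intro s hs
    have h1 : HasDerivAt (fun s => h x * (s - x)) (h x) s := by
      simpa using ((hasDerivAt_id s).sub_const x).const_mul (h x)
    have h2 := (((hr s hs).sub_const (F x)).sub h1.hasDerivWithinAt).sub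
      (hpoly 0 L s).hasDerivWithinAt
    simp only [zero_add] at h2
    exact h2
  rcases le_total x z with hxz | hzx
  · have key := image_norm_le_of_norm_deriv_right_le_deriv_boundary (f := G)
      (f' := fun s => h s - h x - L * (s - x)) (a := x) (b := z)
      (B := fun s => 0 + ε * (s - x) ^ 2 / 2) (B' := fun s => ε * (s - x))
      hGc.continuousOn (fun s hs => hGd s (hmem s ?_).1) (by simp [hG]) (hpoly 0 ε)
      (fun s hs => ?_) (right_mem_Icc.2 hxz)
    · simpa using key
    · rw [abs_of_nonneg (by linarith [hs.1]), abs_of_nonneg (by linarith)]; linarith [hs.2]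
    · have h1 := (hmem s (by
        rw [abs_of_nonneg (by linarith [hs.1]), abs_of_nonneg (by linarith)]; linarith [hs.2])).2
      rwa [abs_of_nonneg (a := s - x) (by linarith [hs.1])] at h1
  · have key := image_norm_le_of_norm_deriv_right_le_deriv_boundary (f := fun s => G s - G z)
      (f' := fun s => h s - h x - L * (s - x)) (a := z) (b := x)
      (B := fun s => ε * (z - x) ^ 2 / 2 + (-ε) * (s - x) ^ 2 / 2) (B' := fun s => (-ε) * (s - x))
      (by fun_prop) (fun s hs => (hGd s (hmem s ?_).1).sub_const _) ?_ (hpoly _ (-ε))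
      (fun s hs => ?_) (right_mem_Icc.2 hzx)
    · have hGx : G x = 0 := by simp [hG]
      simpa [hGx] using key
    · rw [abs_of_nonpos (by linarith [hs.2]), abs_of_nonpos (by linarith)]; linarith [hs.1]
    · rw [sub_self, norm_zero]; exact le_of_eq (by ring)
    · have h1 := (hmem s (by
        rw [abs_of_nonpos (by linarith [hs.2]), abs_of_nonpos (by linarith)]; linarith [hs.1])).2
      rw [abs_of_nonpos (a := s - x) (by linarith [hs.2])] at h1
      rw [Real.norm_eq_abs]
      linarith

theorem hasDerivAt_of_taylor_two {x p L : ℝ} {F : ℝ → ℝ}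
    (hT : ∀ ε > 0, ∃ δ > 0, ∀ z, |z - x| < δ →
      |F z - F x - p * (z - x) - L * (z - x) ^ 2 / 2| ≤ ε * (z - x) ^ 2 / 2) :
    HasDerivAt F p x := by
  obtain ⟨δ, hδ, hT⟩ := hT 1 one_pos
  have h0 : HasFDerivAt (fun z => F z - F x - p * (z - x) - L * (z - x) ^ 2 / 2)
      (0 : ℝ →L[ℝ] ℝ) x := by
    refine Asymptotics.IsBigO.hasFDerivAt (n := 2) (Asymptotics.IsBigO.of_bound (1 / 2) ?_) one_lt_two
    filter_upwards [Metric.ball_mem_nhds x hδ] with z hz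
    rw [Metric.mem_ball, Real.dist_eq] at hz
    have h1 := hT z hz
    rw [Real.norm_eq_abs, Real.norm_eq_abs, Real.norm_eq_abs, abs_of_nonneg (a := |z - x| ^ 2)
      (by positivity), sq_abs]
    linarith
  have h1 : HasDerivAt (fun z => F x + p * (z - x) + L * (z - x) ^ 2 / 2) p x := by
    have h2 := (((((hasDerivAt_id x).sub_const x).pow 2).const_mul L).div_const 2)
    have h3 := ((((hasDerivAt_id x).sub_const x).const_mul p).const_add (F x)).add h2
    refine h3.congr_deriv ?_
    simp
  have h2 := h0.hasDerivAt.add h1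
  refine (h2.congr_deriv (by simp)).congr_of_eventuallyEq (Eventually.of_forall fun z => ?_)
  simp only [Pi.add_apply]; ring

/-- A pointwise second-order Taylor expansion is uniform on compact subsets of almost full
measure. -/
theorem exists_isCompact_uniform_taylor_two {S : Set ℝ} (hS : MeasurableSet S)
    (hSfin : volume S ≠ ⊤) {F h l : ℝ → ℝ} (hF : Continuous F) (hh : Measurable h)
    (hl : Measurable l)
    (hT : ∀ x ∈ S, ∀ ε > 0, ∃ δ > 0, ∀ z, |z - x| < δ →
      |F z - F x - h x * (z - x) - l x * (z - x) ^ 2 / 2| ≤ ε * (z - x) ^ 2 / 2)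
    {η : ENNReal} (hη : η ≠ 0) :
    ∃ K ⊆ S, IsCompact K ∧ volume (S \ K) < η ∧ ∀ ε > 0, ∃ δ > 0, ∀ x ∈ K, ∀ z, |z - x| < δ →
      |F z - F x - h x * (z - x) - l x * (z - x) ^ 2 / 2| ≤ ε * (z - x) ^ 2 / 2 := by
  set B : ℕ → ℕ → Set ℝ := fun n m => {x | ∀ q : ℚ, |(q : ℝ)| < 1 / ((m : ℝ) + 1) →
    |F (x + q) - F x - h x * q - l x * (q : ℝ) ^ 2 / 2| ≤ 1 / ((n : ℝ) + 1) * (q : ℝ) ^ 2 / 2}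
    with hB
  have hBm : ∀ n m, MeasurableSet (B n m) := by
    intro n m
    simp only [hB, ofPred_forall]
    refine MeasurableSet.iInter fun q => MeasurableSet.iInter fun _ => ?_
    have : Measurable fun x => |F (x + q) - F x - h x * q - l x * (q : ℝ) ^ 2 / 2| := by
      have := hF.measurable
      fun_prop
    exact measurableSet_le this measurable_const
  have hBmono : ∀ n, Monotone (B n) := by
    intro n m m' hmm x hx q hq
    refine hx q (hq.trans_le ?_)
    gcongr
  have hBun : ∀ n, S ⊆ ⋃ m, B n m := by
    intro n x hx
    obtain ⟨δ, hδ, hTx⟩ := hT x hx (1 / ((n : ℝ) + 1)) (by positivity)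
    obtain ⟨m, hm⟩ := exists_nat_one_div_lt hδ
    refine mem_iUnion.2 ⟨m, fun q hq => ?_⟩
    simpa using hTx (x + q) (by simpa using hq.trans hm)
  have hη2 : η / 2 ≠ 0 := by simpa using hη
  obtain ⟨e, he, hesum⟩ := ENNReal.exists_pos_sum_of_countable' hη2 ℕ
  have hm : ∀ n, ∃ m, volume (S \ B n m) < e n := by
    intro n
    have h1 := tendsto_measure_iInter_atTop (μ := volume) (s := fun m => S \ B n m)
      (fun m => (hS.diff (hBm n m)).nullMeasurableSet)
      (fun m m' hmm => sdiff_subset_sdiff_right (hBmono n hmm))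
      ⟨0, ((measure_mono sdiff_subset).trans_lt hSfin.lt_top).ne⟩
    have h2 : ⋂ m, S \ B n m = ∅ := by
      rw [← sdiff_iUnion, sdiff_eq_empty.2 (hBun n)]
    rw [h2, measure_empty] at h1
    exact (h1.eventually (gt_mem_nhds (he n))).exists
  choose m hm using hm
  set A : Set ℝ := S ∩ ⋂ n, B n (m n) with hA
  have hAm : MeasurableSet A := hS.inter (MeasurableSet.iInter fun n => hBm n (m n))
  have hSA : volume (S \ A) < η / 2 := by
    have h1 : S \ A ⊆ ⋃ n, S \ B n (m n) := by
      rintro x ⟨hx, hxA⟩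
      by_contra hcon
      refine hxA ⟨hx, mem_iInter.2 fun n => ?_⟩
      by_contra hn
      exact hcon (mem_iUnion.2 ⟨n, hx, hn⟩)
    calc volume (S \ A) ≤ ∑' n, volume (S \ B n (m n)) :=
          (measure_mono h1).trans (measure_iUnion_le _)
      _ ≤ ∑' n, e n := ENNReal.tsum_le_tsum fun n => (hm n).le
      _ < η / 2 := hesum
  obtain ⟨K, hKA, hK, hAK⟩ := hAm.exists_isCompact_sdiff_lt
    ((measure_mono inter_subset_left).trans_lt hSfin.lt_top).ne hη2
  refine ⟨K, hKA.trans inter_subset_left, hK, ?_, fun ε hε => ?_⟩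
  · have h1 : S \ K ⊆ (S \ A) ∪ (A \ K) := by
      rintro x ⟨hx, hxK⟩
      by_cases hxA : x ∈ A
      exacts [Or.inr ⟨hxA, hxK⟩, Or.inl ⟨hx, hxA⟩]
    calc volume (S \ K) ≤ volume (S \ A) + volume (A \ K) :=
          (measure_mono h1).trans (measure_union_le _ _)
      _ < η / 2 + η / 2 := ENNReal.add_lt_add hSA hAK
      _ = η := ENNReal.add_halves η
  · obtain ⟨n, hn⟩ := exists_nat_one_div_lt hε
    refine ⟨1 / ((m n : ℝ) + 1), by positivity, fun x hx z hz => ?_⟩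
    have hxB : x ∈ B n (m n) := mem_iInter.1 (hKA hx).2 n
    set C : Set ℝ := {t | |F (x + t) - F x - h x * t - l x * t ^ 2 / 2|
      ≤ 1 / ((n : ℝ) + 1) * t ^ 2 / 2} with hC
    have hCcl : IsClosed C := isClosed_le (by fun_prop) (by fun_prop)
    have hO : IsOpen {t : ℝ | |t| < 1 / ((m n : ℝ) + 1)} := isOpen_lt (by fun_prop) (by fun_prop)
    have h1 : {t : ℝ | |t| < 1 / ((m n : ℝ) + 1)} ⊆ C := by
      refine (Rat.denseRange_cast.open_subset_closure_inter hO).trans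
        (closure_minimal ?_ hCcl)
      rintro _ ⟨ht, q, rfl⟩
      exact hxB q ht
    have h2 : |F (x + (z - x)) - F x - h x * (z - x) - l x * (z - x) ^ 2 / 2|
      ≤ 1 / ((n : ℝ) + 1) * (z - x) ^ 2 / 2 := h1 hz
    rw [add_sub_cancel] at h2
    refine h2.trans ?_
    gcongr

theorem continuousOn_of_uniform_taylor_two {K : Set ℝ} {F h l : ℝ → ℝ} (hF : Continuous F)
    (hh : ContinuousOn h K)
    (hT : ∀ ε > 0, ∃ δ > 0, ∀ x ∈ K, ∀ z, |z - x| < δ →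
      |F z - F x - h x * (z - x) - l x * (z - x) ^ 2 / 2| ≤ ε * (z - x) ^ 2 / 2) :
    ContinuousOn l K := by
  refine continuousOn_of_uniform_approx_of_continuousOn fun u hu => ?_
  obtain ⟨ε, hε, hεu⟩ := Metric.mem_uniformity_dist.1 hu
  obtain ⟨δ, hδ, hT⟩ := hT (ε / 2) (by positivity)
  have ht : 0 < δ / 2 := by positivity
  refine ⟨fun y => (F (y + δ / 2) - F y - h y * (δ / 2)) * (2 / (δ / 2) ^ 2),
    (((hF.comp (continuous_add_const (δ / 2))).sub hF).continuousOn.sub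
      (hh.mul continuousOn_const)).mul continuousOn_const, fun y hy => hεu ?_⟩
  have h1 := hT y hy (y + δ / 2) (by rw [add_sub_cancel_left, abs_of_pos ht]; linarith)
  rw [add_sub_cancel_left] at h1
  have h2 : dist (l y) ((F (y + δ / 2) - F y - h y * (δ / 2)) * (2 / (δ / 2) ^ 2)) =
      |F (y + δ / 2) - F y - h y * (δ / 2) - l y * (δ / 2) ^ 2 / 2| * (2 / (δ / 2) ^ 2) := by
    rw [dist_comm, Real.dist_eq, ← abs_of_pos (a := 2 / (δ / 2) ^ 2) (by positivity), ← abs_mul,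
      abs_of_pos (a := 2 / (δ / 2) ^ 2) (by positivity)]
    congr 1
    field_simp
  rw [h2]
  calc _ ≤ ε / 2 * (δ / 2) ^ 2 / 2 * (2 / (δ / 2) ^ 2) := by gcongr
    _ = ε / 2 := by field_simp
    _ < ε := by linarith

theorem ConvexOn.Icc_of_Ioo {a b : ℝ} (hab : a < b) {f : ℝ → ℝ} (hfc : Continuous f)
    (hf : ConvexOn ℝ (Ioo a b) f) : ConvexOn ℝ (Icc a b) f := by
  refine ⟨convex_Icc a b, fun x hx y hy s t hs ht hst => ?_⟩
  have hcl : IsClosed {p : ℝ × ℝ | f (s • p.1 + t • p.2) ≤ s • f p.1 + t • f p.2} :=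
    isClosed_le (by fun_prop) (by fun_prop)
  have hsub : Ioo a b ×ˢ Ioo a b ⊆ {p : ℝ × ℝ | f (s • p.1 + t • p.2) ≤ s • f p.1 + t • f p.2} :=
    fun p hp => hf.2 hp.1 hp.2 hs ht hst
  have hmem : (x, y) ∈ closure (Ioo a b ×ˢ Ioo a b) := by
    rw [closure_prod_eq, closure_Ioo hab.ne]
    exact ⟨hx, hy⟩
  exact closure_minimal hsub hcl hmem

theorem ConvexOn.add_rightDeriv_mul_le {a b : ℝ} {f : ℝ → ℝ} (hf : ConvexOn ℝ (Icc a b) f)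
    {x z : ℝ} (hx : x ∈ Ioo a b) (hz : z ∈ Icc a b) :
    f x + derivWithin f (Ioi x) x * (z - x) ≤ f z := by
  have hxi : x ∈ interior (Icc a b) := by rwa [interior_Icc]
  rcases lt_trichotomy x z with hxz | rfl | hzx
  · have h1 := hf.rightDeriv_le_slope_of_mem_interior hxi hz hxz
    rw [slope_def_field, le_div_iff₀ (sub_pos.2 hxz)] at h1
    linarith
  · simp
  · have h1 := (hf.slope_le_leftDeriv_of_mem_interior hz hxi hzx).trans
      (hf.leftDeriv_le_rightDeriv_of_mem_interior hxi)
    rw [slope_def_field, div_le_iff₀ (sub_pos.2 hzx)] at h1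
    linarith

/-- A continuous function convex on `[a, b]` agrees, outside a set of small measure and at the
endpoints, with a convex function of class `C²`. -/
theorem ConvexOn.exists_contDiff_two_eqOn {a b : ℝ} (hab : a < b) {f : ℝ → ℝ} (hfc : Continuous f)
    (hf : ConvexOn ℝ (Icc a b) f) {ε : ENNReal} (hε : ε ≠ 0) :
    ∃ (K : Set ℝ) (g : ℝ → ℝ), volume (Ioo a b \ K) < ε ∧ ContDiff ℝ 2 g ∧
      ConvexOn ℝ univ g ∧ EqOn g f K ∧ g a = f a ∧ g b = f b := by
  set h : ℝ → ℝ := fun x => derivWithin f (Ioi x) x with hh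
  have hhm : Measurable h := measurable_derivWithin_Ioi f
  have hmono : MonotoneOn h (Ioo a b) := by
    have h1 := hf.monotoneOn_rightDeriv
    rwa [interior_Icc] at h1
  have hr : ∀ y ∈ Ioo a b, HasDerivWithinAt f (h y) (Ici y) y := fun y hy =>
    (hf.hasDerivWithinAt_rightDeriv_of_mem_interior (by rwa [interior_Icc])).Ici_of_Ioi
  set S : Set ℝ := Ioo a b ∩ {x | DifferentiableAt ℝ h x} with hS
  have hSm : MeasurableSet S := measurableSet_Ioo.inter (measurableSet_of_differentiableAt ℝ h)
  have hSfin : volume S ≠ ⊤ :=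
    ((measure_mono inter_subset_left).trans_lt measure_Ioo_lt_top).ne
  have hnull : volume (Ioo a b \ S) = 0 := by
    refine measure_mono_null ?_ hmono.ae_differentiableWithinAt_of_mem
    rintro x ⟨hx, hxS⟩ hd
    exact hxS ⟨hx, (hd hx).differentiableAt (Ioo_mem_nhds hx.1 hx.2)⟩
  have hdiff : ∀ x ∈ S, HasDerivAt h (deriv h x) x := fun x hx => hx.2.hasDerivAt
  have hT : ∀ x ∈ S, ∀ ε > 0, ∃ δ > 0, ∀ z, |z - x| < δ →
      |f z - f x - h x * (z - x) - deriv h x * (z - x) ^ 2 / 2| ≤ ε * (z - x) ^ 2 / 2 :=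
    fun x hx ε hε => taylor_two_of_hasDerivAt hx.1 hfc hr (hdiff x hx) hε
  have hvol : 0 < volume (Ioo a b) := by simpa using hab
  obtain ⟨K, hKS, hK, hKvol, hKT⟩ := exists_isCompact_uniform_taylor_two hSm hSfin hfc hhm
    (measurable_deriv h) hT (lt_min (pos_iff_ne_zero.2 hε) hvol).ne'
  have hvolK : volume (Ioo a b \ K) < min ε (volume (Ioo a b)) := by
    refine lt_of_le_of_lt ?_ hKvol
    calc volume (Ioo a b \ K) ≤ volume ((Ioo a b \ S) ∪ (S \ K)) := by
          refine measure_mono ?_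
          rintro x ⟨hx, hxK⟩
          by_cases hxS : x ∈ S
          exacts [Or.inr ⟨hxS, hxK⟩, Or.inl ⟨hx, hxS⟩]
      _ ≤ volume (Ioo a b \ S) + volume (S \ K) := measure_union_le _ _
      _ = volume (S \ K) := by rw [hnull, zero_add]
  have hKne : K.Nonempty := by
    by_contra hne
    rw [not_nonempty_iff_eq_empty.1 hne, sdiff_empty] at hvolK
    exact (hvolK.trans_le (min_le_right _ _)).false
  have hcont : ContinuousOn h K := fun x hx => (hdiff x (hKS hx)).continuousAt.continuousWithinAt
  obtain ⟨g, hg⟩ := ConvexOn.exists_contDiff_two_eqOn_of_taylor hK hKne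
    (hKS.trans inter_subset_left) hf (continuousOn_of_uniform_taylor_two hfc hcont hKT)
    (fun x hx => by
      have hx1 := (hKS hx).1
      rw [← derivWithin_of_mem_nhds (Ioo_mem_nhds hx1.1 hx1.2)]
      exact hmono.derivWithin_nonneg)
    (fun x hx z hz => hf.add_rightDeriv_mul_le (hKS hx).1 hz)
    (fun x hx => hasDerivAt_of_taylor_two (hT x (hKS hx))) (fun x hx => hdiff x (hKS hx))
    (fun ε hε => (hKT ε hε).imp fun δ hδ => ⟨hδ.1, fun x hx z _ => hδ.2 x hx z⟩)
  exact ⟨K, g, hvolK.trans_le (min_le_left _ _), hg⟩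

/-- If `f` is continuous on `[a,b]` and convex on `(a,b)`, then for every `ε₀ > 0` there is a
convex function `g ∈ C²(a,b) ∩ C([a,b])` with `g a = f a`, `g b = f b` and `|{f ≠ g}| < ε₀`. -/
theorem convex_lusin_C2_boundary (a b : ℝ) (hab : a < b) (f : ℝ → ℝ)
    (hfc : ContinuousOn f (Icc a b)) (hf : ConvexOn ℝ (Ioo a b) f)
    (ε₀ : ℝ) (hε₀ : 0 < ε₀) :
    ∃ g : ℝ → ℝ,
      ConvexOn ℝ (Ioo a b) g ∧
      ContDiffOn ℝ 2 g (Ioo a b) ∧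
      ContinuousOn g (Icc a b) ∧
      g a = f a ∧ g b = f b ∧
      volume {x ∈ Ioo a b | f x ≠ g x} < ENNReal.ofReal ε₀ := by
  set F : ℝ → ℝ := IccExtend hab.le ((Icc a b).domRestrict f) with hF
  have hFc : Continuous F := (continuousOn_iff_continuous_domRestrict.1 hfc).Icc_extend'
  have hFf : EqOn F f (Icc a b) := fun x hx => by
    rw [hF, IccExtend_of_mem hab.le _ hx, domRestrict_apply]
  have hFconv : ConvexOn ℝ (Icc a b) F :=
    ConvexOn.Icc_of_Ioo hab hFc (hf.congr (hFf.symm.mono Ioo_subset_Icc_self))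
  obtain ⟨K, g, hvol, hg, hgconv, hgK, hga, hgb⟩ := hFconv.exists_contDiff_two_eqOn hab hFc
    (ENNReal.ofReal_pos.2 hε₀).ne'
  refine ⟨g, hgconv.subset (subset_univ _) (convex_Ioo a b), hg.contDiffOn,
    hg.continuous.continuousOn, ?_, ?_, lt_of_le_of_lt (measure_mono ?_) hvol⟩
  · rw [hga, hFf (left_mem_Icc.2 hab.le)]
  · rw [hgb, hFf (right_mem_Icc.2 hab.le)]
  · rintro x ⟨hx, hne⟩
    refine ⟨hx, fun hxK => hne ?_⟩
    rw [hgK hxK, hFf (Ioo_subset_Icc_self hx)]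
end
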